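/- Define ν(x_1, x_2) = G'(x_1)μ(x_2) + (1/2)G''(x_1)σ(x_2)^2, where G'' denotes the second derivative of G, which exists on ℝ∖{ζ_1,…,ζ_m} and is extended to the points ζ_k as the right derivative of G'. There exist a constant C ∈ (0,∞) and δ_0 ∈ (0,1) such that for every n ∈ ℕ with δ = T/n ∈ (0,δ_0), it holds that E[ sup_{τ∈[0,T]} | ∫_0^τ ( ν(X^{(δ)}_{s̲}, X^{(δ)}_{s̲}) − ν(X^{(δ)}_s, X^{(δ)}_{s̲}) ) ds |^2 ] ≤ C δ. -/

import Mathlib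

open MeasureTheory ProbabilityTheory

/-- Grid values of the Euler–Maruyama scheme with step size `δ` and initial value `x`. -/
noncomputable def emGrid {Ω : Type*} (μ σ ρ : ℝ → ℝ) (W N : ℝ → Ω → ℝ)
    (δ : ℝ) (x : ℝ) : ℕ → Ω → ℝ
  | 0, _ => x
  | (j + 1), ω =>
      emGrid μ σ ρ W N δ x j ω
        + μ (emGrid μ σ ρ W N δ x j ω) * δ
        + σ (emGrid μ σ ρ W N δ x j ω) * (W (((j : ℝ) + 1) * δ) ω - W ((j : ℝ) * δ) ω)
        + ρ (emGrid μ σ ρ W N δ x j ω) * (N (((j : ℝ) + 1) * δ) ω - N ((j : ℝ) * δ) ω)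

/-- The last grid point `t̲ = δ ⌊t/δ⌋` before time `t`. -/
noncomputable def lastGrid (δ t : ℝ) : ℝ := (⌊t / δ⌋.toNat : ℝ) * δ

/-- The continuous-time Euler–Maruyama scheme
`X_t = X_t̲ + μ(X_t̲)(t - t̲) + σ(X_t̲)(W_t - W_t̲) + ρ(X_t̲)(N_t - N_t̲)`. -/
noncomputable def emProc {Ω : Type*} (μ σ ρ : ℝ → ℝ) (W N : ℝ → Ω → ℝ)
    (δ : ℝ) (x : ℝ) (t : ℝ) (ω : Ω) : ℝ :=
  emGrid μ σ ρ W N δ x (⌊t / δ⌋.toNat) ω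
    + μ (emGrid μ σ ρ W N δ x (⌊t / δ⌋.toNat) ω) * (t - lastGrid δ t)
    + σ (emGrid μ σ ρ W N δ x (⌊t / δ⌋.toNat) ω) * (W t ω - W (lastGrid δ t) ω)
    + ρ (emGrid μ σ ρ W N δ x (⌊t / δ⌋.toNat) ω) * (N t ω - N (lastGrid δ t) ω)

/-- The bump function `φ(u) = (1+u)^3 (1-u)^3` for `|u| ≤ 1` and `φ(u) = 0` otherwise. -/
noncomputable def bumpPhi (u : ℝ) : ℝ := if |u| ≤ 1 then (1 + u) ^ 3 * (1 - u) ^ 3 else 0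

/-- The transform `G(x) = x + ∑ k, α k * φ((x - ζ k)/c) * (x - ζ k) * |x - ζ k|`. -/
noncomputable def Gtransform (m : ℕ) (ζ α : Fin m → ℝ) (c : ℝ) (x : ℝ) : ℝ :=
  x + ∑ k : Fin m, α k * bumpPhi ((x - ζ k) / c) * ((x - ζ k) * |x - ζ k|)

/-- The coefficient `ν(x₁, x₂) = G'(x₁) μ(x₂) + (1/2) G''(x₁) σ(x₂)²`, where `G''` is the
second derivative of `G`, taken as the right derivative of `G'` at the points `ζ k`. -/
noncomputable def nuFun (G μ σ : ℝ → ℝ) (x₁ x₂ : ℝ) : ℝ :=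
  deriv G x₁ * μ x₂ + (1 / 2) * derivWithin (deriv G) (Set.Ici x₁) x₁ * σ x₂ ^ 2

lemma hasDerivAt_posPart_pow (k : ℕ) (u : ℝ) :
    HasDerivAt (fun u : ℝ => (max 0 u) ^ (k + 2)) (((k + 2 : ℕ) : ℝ) * (max 0 u) ^ (k + 1)) u := by
  rcases lt_trichotomy u 0 with h | h | h
  · have h1 : HasDerivAt (fun _ : ℝ => (0 : ℝ)) 0 u := hasDerivAt_const _ _
    have h2 : (fun u : ℝ => (max 0 u) ^ (k + 2)) =ᶠ[nhds u] fun _ => (0 : ℝ) := by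
      filter_upwards [Iio_mem_nhds h] with v hv
      rw [max_eq_left (le_of_lt hv)]; simp
    have := h1.congr_of_eventuallyEq h2
    rw [max_eq_left h.le]; simpa using this
  · subst h
    have h1 : HasDerivWithinAt (fun u : ℝ => (max 0 u) ^ (k + 2)) 0 (Set.Iic 0) 0 := by
      have h1 : HasDerivWithinAt (fun _ : ℝ => (0 : ℝ)) 0 (Set.Iic 0) 0 := hasDerivWithinAt_const _ _ _
      refine h1.congr (fun v hv => ?_) (by simp)
      rw [max_eq_left hv]; simp
    have h2 : HasDerivWithinAt (fun u : ℝ => (max 0 u) ^ (k + 2)) 0 (Set.Ici 0) 0 := by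
      have h1 : HasDerivWithinAt (fun u : ℝ => u ^ (k + 2)) 0 (Set.Ici 0) 0 := by
        have := (hasDerivAt_pow (k+2) (0:ℝ)).hasDerivWithinAt (s := Set.Ici 0)
        simpa using this
      refine h1.congr (fun v hv => ?_) (by simp)
      rw [max_eq_right hv]
    have := h1.union h2
    rw [Set.Iic_union_Ici, hasDerivWithinAt_univ] at this
    simpa using this
  · have h1 := hasDerivAt_pow (k+2) u
    have h2 : (fun u : ℝ => (max 0 u) ^ (k + 2)) =ᶠ[nhds u] fun u => u ^ (k + 2) := by
      filter_upwards [Ioi_mem_nhds h] with v hv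
      rw [max_eq_right (le_of_lt hv)]
    have := h1.congr_of_eventuallyEq h2
    rw [max_eq_right h.le]; simpa using this

lemma hasDerivAt_mul_abs' (u : ℝ) : HasDerivAt (fun u : ℝ => u * |u|) (2 * |u|) u := by
  rcases lt_trichotomy u 0 with h | h | h
  · have h1 : HasDerivAt (fun u : ℝ => -(u ^ 2)) (2 * |u|) u := by
      have := (hasDerivAt_pow 2 u).fun_neg
      rw [abs_of_neg h]; exact this.congr_deriv (by simp)
    refine h1.congr_of_eventuallyEq ?_
    filter_upwards [Iio_mem_nhds h] with v hv
    rw [abs_of_neg hv]; ring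
  · subst h
    have h1 : HasDerivWithinAt (fun u : ℝ => u * |u|) 0 (Set.Iic 0) 0 := by
      have h1 : HasDerivWithinAt (fun u : ℝ => -(u ^ 2)) 0 (Set.Iic 0) 0 := by
        have := ((hasDerivAt_pow 2 (0:ℝ)).fun_neg).hasDerivWithinAt (s := Set.Iic 0)
        simpa using this
      refine h1.congr (fun v hv => ?_) (by simp)
      rw [abs_of_nonpos hv]; ring
    have h2 : HasDerivWithinAt (fun u : ℝ => u * |u|) 0 (Set.Ici 0) 0 := by
      have h1 : HasDerivWithinAt (fun u : ℝ => (u ^ 2)) 0 (Set.Ici 0) 0 := by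
        have := ((hasDerivAt_pow 2 (0:ℝ))).hasDerivWithinAt (s := Set.Ici 0)
        simpa using this
      refine h1.congr (fun v hv => ?_) (by simp)
      rw [abs_of_nonneg hv]; ring
    have := h1.union h2
    rw [Set.Iic_union_Ici, hasDerivWithinAt_univ] at this
    simpa using this
  · have h1 : HasDerivAt (fun u : ℝ => (u ^ 2)) (2 * |u|) u := by
      have := (hasDerivAt_pow 2 u)
      rw [abs_of_pos h]; exact this.congr_deriv (by simp)
    refine h1.congr_of_eventuallyEq ?_
    filter_upwards [Ioi_mem_nhds h] with v hv
    rw [abs_of_pos hv]; ring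

/-- `m(y) = (1 - y²/c²)⁺`. -/
noncomputable def gm (c y : ℝ) : ℝ := max 0 (1 - y ^ 2 / c ^ 2)
/-- `k(y)`, with `g' = |y| k`. -/
noncomputable def gk (c y : ℝ) : ℝ := 2 * gm c y ^ 3 - 6 * y ^ 2 / c ^ 2 * gm c y ^ 2
/-- `k'(y)`. -/
noncomputable def gk' (c y : ℝ) : ℝ := -24 * y / c ^ 2 * gm c y ^ 2 + 24 * y ^ 3 / c ^ 4 * gm c y
/-- `e(y) = k + y k'`. -/
noncomputable def ge (c y : ℝ) : ℝ := gk c y + y * gk' c y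

lemma bump_eq (c : ℝ) (_hc : 0 < c) (y : ℝ) : bumpPhi (y / c) = gm c y ^ 3 := by
  unfold bumpPhi gm
  have : y ^ 2 / c ^ 2 = (y / c) ^ 2 := by rw [div_pow]
  rw [this]
  set u := y / c
  split_ifs with h
  · have : u ^ 2 ≤ 1 := by rw [sq_le_one_iff_abs_le_one]; exact h
    rw [max_eq_right (by linarith)]; ring
  · have : 1 < u ^ 2 := by rw [one_lt_sq_iff_one_lt_abs]; exact not_le.mp h
    rw [max_eq_left (by linarith)]; simp

lemma hasDerivAt_inner (c y : ℝ) : HasDerivAt (fun y : ℝ => 1 - y ^ 2 / c ^ 2) (-(2 * y / c ^ 2)) y := by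
  have := ((hasDerivAt_pow 2 y).div_const (c ^ 2)).const_sub 1
  simpa using this

lemma hasDerivAt_gm3 (c y : ℝ) :
    HasDerivAt (fun y => gm c y ^ 3) (3 * gm c y ^ 2 * (-(2 * y / c ^ 2))) y := by
  have := (hasDerivAt_posPart_pow 1 (1 - y ^ 2 / c ^ 2)).comp y (hasDerivAt_inner c y)
  simpa [gm, Function.comp_def] using this

lemma hasDerivAt_gm2 (c y : ℝ) :
    HasDerivAt (fun y => gm c y ^ 2) (2 * gm c y * (-(2 * y / c ^ 2))) y := by
  have := (hasDerivAt_posPart_pow 0 (1 - y ^ 2 / c ^ 2)).comp y (hasDerivAt_inner c y)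
  simpa [gm, Function.comp_def] using this

lemma hasDerivAt_g (c y : ℝ) :
    HasDerivAt (fun y => gm c y ^ 3 * (y * |y|)) (|y| * gk c y) y := by
  have := (hasDerivAt_gm3 c y).fun_mul (hasDerivAt_mul_abs' y)
  refine this.congr_deriv ?_
  unfold gk
  ring

lemma hasDerivAt_gk (c y : ℝ) : HasDerivAt (gk c) (gk' c y) y := by
  have h1 := ((hasDerivAt_gm3 c y).const_mul 2).fun_sub
    ((((hasDerivAt_pow 2 y).const_mul 6).div_const (c ^ 2)).fun_mul (hasDerivAt_gm2 c y))
  refine h1.congr_deriv ?_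
  unfold gk'
  simp only [Nat.cast_ofNat]
  ring

/-- one-sided second derivative -/
noncomputable def gs (c y : ℝ) : ℝ := if 0 ≤ y then ge c y else - ge c y

lemma hasDerivWithinAt_g' (c y : ℝ) :
    HasDerivWithinAt (fun y => |y| * gk c y) (gs c y) (Set.Ici y) y := by
  have h1 : HasDerivAt (fun y => y * gk c y) (ge c y) y := by
    have := (hasDerivAt_id' y).fun_mul (hasDerivAt_gk c y)
    simpa [ge] using this
  unfold gs
  split_ifs with h
  · refine h1.hasDerivWithinAt.congr (fun v hv => ?_) ?_
    · rw [abs_of_nonneg (h.trans hv)]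
    · rw [abs_of_nonneg h]
  · push Not at h
    have h2 := h1.neg
    refine (h2.congr_of_eventuallyEq ?_).hasDerivWithinAt
    filter_upwards [Iio_mem_nhds h] with v hv
    rw [abs_of_neg hv]; simp

/-- clamp -/
noncomputable def gcl (c y : ℝ) : ℝ := max (-c) (min y c)

lemma gcl_mem (c : ℝ) (hc : 0 < c) (y : ℝ) : gcl c y ∈ Set.Icc (-c) c := by
  unfold gcl
  constructor
  · exact le_max_left _ _
  · exact max_le (by linarith) (min_le_right _ _)

lemma gcl_lip (c x y : ℝ) : |gcl c x - gcl c y| ≤ |x - y| := by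
  unfold gcl
  refine (abs_max_sub_max_le_max _ _ _ _).trans ?_
  simp only [sub_self, abs_zero]
  refine max_le (abs_nonneg _) ((abs_min_sub_min_le_max _ _ _ _).trans ?_)
  simp

lemma gcl_cases (c : ℝ) (hc : 0 < c) (y : ℝ) :
    (gcl c y = y) ∨ (gm c y = 0 ∧ gm c (gcl c y) = 0) := by
  unfold gcl gm
  by_cases h1 : y < -c
  · right
    rw [min_eq_left (by linarith), max_eq_left h1.le]
    have : c ^ 2 ≤ y ^ 2 := by nlinarith
    constructor
    · rw [max_eq_left]
      have : 1 ≤ y ^ 2 / c ^ 2 := by rw [le_div_iff₀ (by positivity)]; linarith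
      linarith
    · have : c ^ 2 ≠ 0 := by positivity
      simp [this]
  · by_cases h2 : c < y
    · right
      rw [min_eq_right h2.le, max_eq_right (a := -c) (b := c) (by linarith)]
      have : c ^ 2 ≤ y ^ 2 := by nlinarith
      constructor
      · rw [max_eq_left]
        have : 1 ≤ y ^ 2 / c ^ 2 := by rw [le_div_iff₀ (by positivity)]; linarith
        linarith
      · have : c ^ 2 ≠ 0 := by positivity
        simp [this]
    · left
      rw [min_eq_left (by linarith), max_eq_right (by linarith)]

lemma ge_zero (c y : ℝ) (h : gm c y = 0) : ge c y = 0 := by simp [ge, gk, gk', h]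
lemma gk_zero (c y : ℝ) (h : gm c y = 0) : gk c y = 0 := by simp [gk, h]

lemma gm_eq (c y : ℝ) (hc : 0 < c) (hy : y ∈ Set.Icc (-c) c) : gm c y = 1 - y ^ 2 / c ^ 2 := by
  unfold gm
  rw [max_eq_right]
  have : y ^ 2 / c ^ 2 ≤ 1 := by
    rw [div_le_one (by positivity)]
    nlinarith [hy.1, hy.2]
  linarith

lemma lip_of_poly (c : ℝ) (f : ℝ → ℝ) (hf : ContDiff ℝ 1 f) :
    ∃ K : ℝ, 0 ≤ K ∧ ∀ x ∈ Set.Icc (-c) c, ∀ y ∈ Set.Icc (-c) c, |f x - f y| ≤ K * |x - y| := by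
  obtain ⟨K, hK⟩ := (hf.locallyLipschitz.locallyLipschitzOn (s := Set.Icc (-c) c)).exists_lipschitzOnWith_of_compact isCompact_Icc
  refine ⟨K, K.2, fun x hx y hy => ?_⟩
  have := hK.dist_le_mul x hx y hy
  simpa [Real.dist_eq] using this

lemma bd_of_poly (c : ℝ) (f : ℝ → ℝ) (hf : Continuous f) :
    ∃ B : ℝ, 0 ≤ B ∧ ∀ x ∈ Set.Icc (-c) c, |f x| ≤ B := by
  obtain ⟨B, hB⟩ := (isCompact_Icc (a := -c) (b := c)).exists_bound_of_continuousOn hf.continuousOn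
  refine ⟨max B 0, le_max_right _ _, fun x hx => (hB x hx).trans (le_max_left _ _)⟩

lemma ge_lip (c : ℝ) (hc : 0 < c) :
    ∃ K : ℝ, 0 ≤ K ∧ (∀ x y, |ge c x - ge c y| ≤ K * |x - y|) ∧ (∀ x, |ge c x| ≤ K) := by
  let E : ℝ → ℝ := fun y => (2 * (1 - y ^ 2 / c ^ 2) ^ 3 - 6 * y ^ 2 / c ^ 2 * (1 - y ^ 2 / c ^ 2) ^ 2)
    + y * (-24 * y / c ^ 2 * (1 - y ^ 2 / c ^ 2) ^ 2 + 24 * y ^ 3 / c ^ 4 * (1 - y ^ 2 / c ^ 2))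
  have hE : ContDiff ℝ 1 E := by fun_prop
  have key : ∀ y, ge c y = E (gcl c y) := by
    intro y
    have h1 : E (gcl c y) = ge c (gcl c y) := by
      simp only [E, ge, gk, gk', gm_eq c _ hc (gcl_mem c hc y)]
    rw [h1]
    rcases gcl_cases c hc y with h | ⟨h, h'⟩
    · rw [h]
    · rw [ge_zero _ _ h, ge_zero _ _ h']
  obtain ⟨K, hK0, hK⟩ := lip_of_poly c E hE
  obtain ⟨B, hB0, hB⟩ := bd_of_poly c E hE.continuous
  refine ⟨max K B, hK0.trans (le_max_left _ _), fun x y => ?_, fun x => ?_⟩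
  · rw [key, key]
    refine (hK _ (gcl_mem c hc x) _ (gcl_mem c hc y)).trans ?_
    exact mul_le_mul (le_max_left _ _) (gcl_lip c x y) (abs_nonneg _) (hK0.trans (le_max_left _ _))
  · rw [key]; exact (hB _ (gcl_mem c hc x)).trans (le_max_right _ _)

lemma g'_lip (c : ℝ) (hc : 0 < c) :
    ∃ K : ℝ, 0 ≤ K ∧ (∀ x y, |(|x| * gk c x - |y| * gk c y)| ≤ K * |x - y|) := by
  let E : ℝ → ℝ := fun y => (2 * (1 - y ^ 2 / c ^ 2) ^ 3 - 6 * y ^ 2 / c ^ 2 * (1 - y ^ 2 / c ^ 2) ^ 2)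
  have hE : ContDiff ℝ 1 E := by fun_prop
  have key : ∀ y, |y| * gk c y = |gcl c y| * E (gcl c y) := by
    intro y
    have h1 : E (gcl c y) = gk c (gcl c y) := by
      simp only [E, gk, gm_eq c _ hc (gcl_mem c hc y)]
    rw [h1]
    rcases gcl_cases c hc y with h | ⟨h, h'⟩
    · rw [h]
    · rw [gk_zero _ _ h, gk_zero _ _ h']; simp
  obtain ⟨K, hK0, hK⟩ := lip_of_poly c E hE
  obtain ⟨B, hB0, hB⟩ := bd_of_poly c E hE.continuous
  refine ⟨c * K + B, by positivity, fun x y => ?_⟩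
  rw [key, key]
  have hx := gcl_mem c hc x
  have hy := gcl_mem c hc y
  have hl := gcl_lip c x y
  set a := gcl c x
  set b := gcl c y
  have h1 : |a| * E a - |b| * E b = |a| * (E a - E b) + (|a| - |b|) * E b := by ring
  rw [h1]
  refine (abs_add_le _ _).trans ?_
  rw [abs_mul, abs_mul, abs_abs]
  have h2 : |a| ≤ c := abs_le.mpr hx
  have h3 : |a| * |E a - E b| ≤ c * (K * |x - y|) := by
    have := hK a hx b hy
    have h4 : |E a - E b| ≤ K * |x - y| := this.trans (mul_le_mul_of_nonneg_left hl hK0)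
    gcongr
  have h5 : |(|a| - |b|)| * |E b| ≤ |x - y| * B := by
    exact mul_le_mul ((abs_abs_sub_abs_le_abs_sub a b).trans hl) (hB b hy) (abs_nonneg _) (abs_nonneg _)
  nlinarith

/-- `G''` (right derivative) -/
noncomputable def Gss (m : ℕ) (ζ α : Fin m → ℝ) (c x : ℝ) : ℝ := ∑ k : Fin m, α k * gs c (x - ζ k)

lemma deriv_G (m : ℕ) (ζ α : Fin m → ℝ) (c : ℝ) (hc : 0 < c) (x : ℝ) :
    deriv (Gtransform m ζ α c) x = 1 + ∑ k : Fin m, α k * (|x - ζ k| * gk c (x - ζ k)) := by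
  apply HasDerivAt.deriv
  unfold Gtransform
  simp only [bump_eq c hc]
  refine (hasDerivAt_id' x).add (HasDerivAt.fun_sum (fun k _ => ?_))
  have := ((hasDerivAt_g c (x - ζ k)).comp_sub_const x (ζ k)).const_mul (α k)
  simpa [mul_assoc] using this

lemma deriv2_G (m : ℕ) (ζ α : Fin m → ℝ) (c : ℝ) (hc : 0 < c) (x : ℝ) :
    derivWithin (deriv (Gtransform m ζ α c)) (Set.Ici x) x = Gss m ζ α c x := by
  have h0 : deriv (Gtransform m ζ α c) = fun x => 1 + ∑ k : Fin m, α k * (|x - ζ k| * gk c (x - ζ k)) :=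
    funext (deriv_G m ζ α c hc)
  rw [h0]
  apply HasDerivWithinAt.derivWithin _ (uniqueDiffWithinAt_Ici x)
  refine HasDerivWithinAt.const_add _ (HasDerivWithinAt.fun_sum (fun k _ => ?_))
  have h1 := hasDerivWithinAt_g' c (x - ζ k)
  have h2 : HasDerivWithinAt (fun x => x - ζ k) 1 (Set.Ici x) x :=
    ((hasDerivAt_id' x).sub_const _).hasDerivWithinAt
  have h3 := (h1.comp x h2 (fun v hv => by simpa using hv)).const_mul (α k)
  simpa [Function.comp_def] using h3

lemma gs_facts (c : ℝ) (hc : 0 < c) : ∃ K : ℝ, 0 ≤ K ∧ (∀ y, |gs c y| ≤ K) ∧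
    (∀ y, c ≤ |y| → gs c y = 0) ∧ (∀ x y, |x - y| < |y| → |gs c y - gs c x| ≤ K * |x - y|) := by
  obtain ⟨K, hK0, hK1, hK2⟩ := ge_lip c hc
  refine ⟨K, hK0, fun y => ?_, fun y hy => ?_, fun x y hxy => ?_⟩
  · unfold gs; split_ifs
    · exact hK2 y
    · rw [abs_neg]; exact hK2 y
  · have : gm c y = 0 := by
      unfold gm
      rw [max_eq_left]
      have : 1 ≤ y ^ 2 / c ^ 2 := by
        rw [le_div_iff₀ (by positivity)]
        have : c ^ 2 ≤ |y| ^ 2 := by gcongr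
        rw [sq_abs] at this; linarith
      linarith
    unfold gs; simp [ge_zero c y this]
  · by_cases hy : 0 ≤ y
    · rw [abs_of_nonneg hy, abs_lt] at hxy
      unfold gs
      rw [if_pos hy, if_pos (by linarith), abs_sub_comm x y]; exact hK1 _ _
    · push Not at hy
      rw [abs_of_neg hy, abs_lt] at hxy
      unfold gs
      rw [if_neg (by linarith), if_neg (by linarith), abs_sub_comm x y, neg_sub_neg, abs_sub_comm]
      exact hK1 _ _

lemma gs_term (c : ℝ) (hc : 0 < c) (z η : ℝ) (hη : 0 < η) (σ : ℝ → ℝ) (K : ℝ) (hK : 0 ≤ K)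
    (hσ : ∀ x, |σ x| ≤ K * (1 + |x|)) :
    ∃ C : ℝ, 0 ≤ C ∧ ∀ x1 x2 : ℝ, |gs c (x2 - z) - gs c (x1 - z)| * σ x2 ^ 2 ≤
      C * ((1 + |x2|) * |x1 - x2| + if |x2 - z| ≤ η ∧ |x2 - z| ≤ |x1 - x2| then 1 else 0) := by
  obtain ⟨A, hA0, hA1, hA2, hA3⟩ := gs_facts c hc
  set C1 : ℝ := 2 * A * (K ^ 2 * (1 + |z| + η) ^ 2) with hC1
  set C2 : ℝ := 2 * A * K ^ 2 * ((1 + |z|) / η + 1) with hC2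
  set C3 : ℝ := A * K ^ 2 * (1 + |z| + 2 * c) with hC3
  set C4 : ℝ := 2 * A * K ^ 2 * (2 * ((1 + |z|) / (2 * c) + 1)) with hC4
  have h1 : 0 ≤ C1 := by positivity
  have h2 : 0 ≤ C2 := by positivity
  have h3 : 0 ≤ C3 := by positivity
  have h4 : 0 ≤ C4 := by positivity
  refine ⟨C1 + C2 + C3 + C4, by positivity, fun x1 x2 => ?_⟩
  have hs : σ x2 ^ 2 ≤ K ^ 2 * (1 + |x2|) ^ 2 := by
    rw [← sq_abs, ← mul_pow]; gcongr; exact hσ x2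
  have hx2 : |x2| ≤ |z| + |x2 - z| := by
    have := abs_add_le z (x2 - z); simpa using this
  have hd2 : |gs c (x2 - z) - gs c (x1 - z)| ≤ 2 * A := by
    refine (abs_sub _ _).trans ?_
    linarith [hA1 (x2 - z), hA1 (x1 - z)]
  set a := |x2 - z| with ha
  set d := |x1 - x2| with hd
  have hd0 : 0 ≤ d := abs_nonneg _
  have ha0 : 0 ≤ a := abs_nonneg _
  have hx0 : 0 ≤ |x2| := abs_nonneg _
  have hz0 : 0 ≤ |z| := abs_nonneg _
  -- general: if `1+|x2| ≤ Q d`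
  have gen : ∀ Q, 0 ≤ Q → 1 + |x2| ≤ Q * d →
      |gs c (x2 - z) - gs c (x1 - z)| * σ x2 ^ 2 ≤ 2 * A * K ^ 2 * Q * ((1 + |x2|) * d) := by
    intro Q hQ h
    calc |gs c (x2 - z) - gs c (x1 - z)| * σ x2 ^ 2
        ≤ 2 * A * (K ^ 2 * (1 + |x2|) ^ 2) := by gcongr
      _ = 2 * A * K ^ 2 * (1 + |x2|) * (1 + |x2|) := by ring
      _ ≤ 2 * A * K ^ 2 * (1 + |x2|) * (Q * d) := by gcongr
      _ = _ := by ring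
  have hP0 : 0 ≤ (1 + |x2|) * d := by positivity
  set I : ℝ := if a ≤ η ∧ a ≤ d then 1 else 0 with hI
  have hI0 : 0 ≤ I := by rw [hI]; split_ifs <;> norm_num
  have fin : ∀ D, 0 ≤ D → D ≤ C1 + C2 + C3 + C4 →
      |gs c (x2 - z) - gs c (x1 - z)| * σ x2 ^ 2 ≤ D * ((1 + |x2|) * d) →
      |gs c (x2 - z) - gs c (x1 - z)| * σ x2 ^ 2 ≤ (C1 + C2 + C3 + C4) * ((1 + |x2|) * d + I) := by
    intro D _ hD h
    refine h.trans ?_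
    gcongr
    linarith
  by_cases had : a ≤ d
  · by_cases haη : a ≤ η
    · have : I = 1 := by rw [hI, if_pos ⟨haη, had⟩]
      calc |gs c (x2 - z) - gs c (x1 - z)| * σ x2 ^ 2
          ≤ 2 * A * (K ^ 2 * (1 + |x2|) ^ 2) := by gcongr
        _ ≤ C1 := by
            have : 1 + |x2| ≤ 1 + |z| + η := by linarith
            rw [hC1]; gcongr
        _ ≤ (C1 + C2 + C3 + C4) * I := by rw [this]; linarith
        _ ≤ _ := by gcongr; linarith
    · push Not at haη
      refine fin C2 h2 (by linarith) (gen _ (by positivity) ?_)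
      have : (1 + |z|) / η * η = 1 + |z| := by field_simp
      have h5 : (1 + |z|) / η * η ≤ (1 + |z|) / η * a := by gcongr
      have h6 : ((1 + |z|) / η + 1) * a ≤ ((1 + |z|) / η + 1) * d := by gcongr
      linarith
  · push Not at had
    have hdd : |(x1 - z) - (x2 - z)| = d := by rw [hd]; congr 1; ring
    have h5 : |gs c (x2 - z) - gs c (x1 - z)| ≤ A * d := by
      have := hA3 (x1 - z) (x2 - z) (by rw [hdd]; exact had)
      rwa [hdd] at this
    by_cases hac : a ≤ 2 * c
    · refine fin C3 h3 (by linarith) ?_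
      calc |gs c (x2 - z) - gs c (x1 - z)| * σ x2 ^ 2
          ≤ A * d * (K ^ 2 * (1 + |x2|) ^ 2) := by gcongr
        _ = A * K ^ 2 * (1 + |x2|) * ((1 + |x2|) * d) := by ring
        _ ≤ C3 * ((1 + |x2|) * d) := by
            have : 1 + |x2| ≤ 1 + |z| + 2 * c := by linarith
            rw [hC3]; gcongr
    · push Not at hac
      by_cases h1c : c ≤ |x1 - z|
      · rw [hA2 _ h1c, hA2 (x2 - z) (by linarith)]
        simp only [sub_self, abs_zero, zero_mul]
        positivity
      · push Not at h1c
        refine fin C4 h4 (by linarith) (gen _ (by positivity) ?_)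
        have h6 : a ≤ |x1 - z| + d := by
          have := abs_sub (x1 - z) (x1 - x2)
          have e : x1 - z - (x1 - x2) = x2 - z := by ring
          rw [e] at this
          exact this
        have h7 : a ≤ 2 * d := by linarith
        have : (1 + |z|) / (2 * c) * (2 * c) = 1 + |z| := by field_simp
        have h5 : (1 + |z|) / (2 * c) * (2 * c) ≤ (1 + |z|) / (2 * c) * a := by gcongr
        have h6 : ((1 + |z|) / (2 * c) + 1) * a ≤ ((1 + |z|) / (2 * c) + 1) * (2 * d) := by gcongr
        linarith

lemma nu_bound (m : ℕ) (ζ α : Fin m → ℝ) (c : ℝ) (hc : 0 < c) (η : ℝ) (hη : 0 < η)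
    (μ σ : ℝ → ℝ) (K : ℝ) (hK : 0 ≤ K)
    (hμ : ∀ x, |μ x| ≤ K * (1 + |x|)) (hσ : ∀ x, |σ x| ≤ K * (1 + |x|)) :
    ∃ C : ℝ, 0 ≤ C ∧ ∀ x1 x2 : ℝ,
      |nuFun (Gtransform m ζ α c) μ σ x2 x2 - nuFun (Gtransform m ζ α c) μ σ x1 x2| ≤
      C * ((1 + |x2|) * |x1 - x2| +
        ∑ k : Fin m, if |x2 - ζ k| ≤ η ∧ |x2 - ζ k| ≤ |x1 - x2| then (1 : ℝ) else 0) := by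
  obtain ⟨A, hA0, hA⟩ := g'_lip c hc
  choose B hB0 hB using fun k => gs_term c hc (ζ k) η hη σ K hK hσ
  set C1 : ℝ := ∑ k, |α k| * A * K
  set C2 : ℝ := ∑ k, |α k| * B k
  have hC1 : 0 ≤ C1 := Finset.sum_nonneg (fun k _ => by positivity)
  have hC2 : 0 ≤ C2 := Finset.sum_nonneg (fun k _ => mul_nonneg (abs_nonneg _) (hB0 k))
  refine ⟨C1 + C2, by positivity, fun x1 x2 => ?_⟩
  unfold nuFun
  rw [deriv_G _ _ _ _ hc, deriv_G _ _ _ _ hc, deriv2_G _ _ _ _ hc, deriv2_G _ _ _ _ hc]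
  set I : Fin m → ℝ := fun k => if |x2 - ζ k| ≤ η ∧ |x2 - ζ k| ≤ |x1 - x2| then (1 : ℝ) else 0 with hI
  have hI0 : ∀ k, 0 ≤ I k := fun k => by rw [hI]; dsimp only; split_ifs <;> norm_num
  set d := |x1 - x2| with hd
  have hd0 : 0 ≤ d := abs_nonneg _
  have e : ∀ k, |x1 - ζ k - (x2 - ζ k)| = d := fun k => by rw [hd]; congr 1; ring
  have hP0 : 0 ≤ (1 + |x2|) * d := by positivity
  have t1 : |(∑ k, α k * (|x2 - ζ k| * gk c (x2 - ζ k)) - ∑ k, α k * (|x1 - ζ k| * gk c (x1 - ζ k))) * μ x2|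
      ≤ C1 * ((1 + |x2|) * d) := by
    rw [← Finset.sum_sub_distrib, abs_mul]
    calc _ ≤ (∑ k, |α k| * (A * d)) * (K * (1 + |x2|)) := by
          gcongr
          · refine (Finset.abs_sum_le_sum_abs _ _).trans (Finset.sum_le_sum fun k _ => ?_)
            rw [← mul_sub, abs_mul]
            gcongr
            rw [← e k, abs_sub_comm (x1 - ζ k)]
            exact hA _ _
          · exact hμ x2
      _ = _ := by
        simp only [C1, Finset.sum_mul]
        refine Finset.sum_congr rfl fun k _ => by ring
  have t2 : |(Gss m ζ α c x2 - Gss m ζ α c x1) * σ x2 ^ 2| ≤ C2 * ((1 + |x2|) * d + ∑ k, I k) := by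
    unfold Gss
    rw [← Finset.sum_sub_distrib, abs_mul, abs_of_nonneg (sq_nonneg (σ x2))]
    calc _ ≤ (∑ k, |α k| * |gs c (x2 - ζ k) - gs c (x1 - ζ k)|) * σ x2 ^ 2 := by
          gcongr
          refine (Finset.abs_sum_le_sum_abs _ _).trans (Finset.sum_le_sum fun k _ => ?_)
          rw [← mul_sub, abs_mul]
      _ = ∑ k, |α k| * (|gs c (x2 - ζ k) - gs c (x1 - ζ k)| * σ x2 ^ 2) := by
          rw [Finset.sum_mul]
          refine Finset.sum_congr rfl fun k _ => by ring
      _ ≤ ∑ k, |α k| * (B k * ((1 + |x2|) * d + ∑ k, I k)) := by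
          refine Finset.sum_le_sum fun k _ => ?_
          have := hB0 k
          refine mul_le_mul_of_nonneg_left ((hB k x1 x2).trans ?_) (abs_nonneg _)
          gcongr
          exact Finset.single_le_sum (f := I) (fun i _ => hI0 i) (Finset.mem_univ k)
      _ = _ := by
        simp only [C2, Finset.sum_mul]
        refine Finset.sum_congr rfl fun k _ => by ring
  have hs0 : 0 ≤ ∑ k, I k := Finset.sum_nonneg fun k _ => hI0 k
  have e2 : ∀ a b p q r s : ℝ, (1 + a) * r + 1 / 2 * p * s - ((1 + b) * r + 1 / 2 * q * s)
      = (a - b) * r + 1 / 2 * ((p - q) * s) := by intros; ring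
  rw [e2]
  refine (abs_add_le _ _).trans ?_
  rw [abs_mul (1 / 2 : ℝ), abs_of_pos (by norm_num : (0:ℝ) < 1 / 2)]
  have := abs_nonneg ((Gss m ζ α c x2 - Gss m ζ α c x1) * σ x2 ^ 2)
  have : C1 * ((1 + |x2|) * d) ≤ C1 * ((1 + |x2|) * d + ∑ k, I k) := by gcongr; linarith
  nlinarith

lemma lip_growth (μ : ℝ → ℝ) (s : Set ℝ) (h : ∃ K : NNReal, LipschitzOnWith K μ s) (hs : s.Nonempty) :
    ∃ K : ℝ, 0 ≤ K ∧ ∀ x ∈ s, |μ x| ≤ K * (1 + |x|) := by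
  obtain ⟨K, hK⟩ := h
  obtain ⟨p, hp⟩ := hs
  refine ⟨|μ p| + K * (1 + |p|), by positivity, fun x hx => ?_⟩
  have h1 := hK.dist_le_mul x hx p hp
  rw [Real.dist_eq, Real.dist_eq] at h1
  have h2 : |μ x| ≤ |μ p| + |μ x - μ p| := by
    have := abs_add_le (μ p) (μ x - μ p); simpa using this
  have h3 : |x - p| ≤ |x| + |p| := abs_sub _ _
  have h4 : (K:ℝ) * |x - p| ≤ K * (|x| + |p|) := by gcongr
  have := abs_nonneg x
  have := abs_nonneg p
  have := abs_nonneg (μ p)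
  have hK0 : (0:ℝ) ≤ K := K.2
  nlinarith [mul_nonneg hK0 (abs_nonneg x), mul_nonneg hK0 (abs_nonneg p),
    mul_nonneg (abs_nonneg (μ p)) (abs_nonneg x), mul_nonneg (mul_nonneg hK0 (abs_nonneg p)) (abs_nonneg x)]

lemma mu_growth (μ : ℝ → ℝ) (m : ℕ) (hm : 0 < m) (ζ : Fin m → ℝ) (hζ : StrictMono ζ)
    (hμ_low : ∃ K : NNReal, LipschitzOnWith K μ (Set.Iio (ζ ⟨0, hm⟩)))
    (hμ_high : ∃ K : NNReal, LipschitzOnWith K μ (Set.Ioi (ζ ⟨m - 1, Nat.sub_lt hm one_pos⟩)))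
    (hμ_mid : ∀ (k : Fin m) (h : (k : ℕ) + 1 < m),
      ∃ K : NNReal, LipschitzOnWith K μ (Set.Ioo (ζ k) (ζ ⟨(k : ℕ) + 1, h⟩))) :
    ∃ K : ℝ, 0 ≤ K ∧ ∀ x, |μ x| ≤ K * (1 + |x|) := by
  obtain ⟨K1, h10, h1⟩ := lip_growth _ _ hμ_low ⟨ζ ⟨0, hm⟩ - 1, by simp⟩
  obtain ⟨K2, h20, h2⟩ := lip_growth _ _ hμ_high ⟨ζ ⟨m - 1, Nat.sub_lt hm one_pos⟩ + 1, by simp⟩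
  have hmid : ∀ k : Fin m, ∃ K : ℝ, 0 ≤ K ∧ ∀ h : (k : ℕ) + 1 < m,
      ∀ x ∈ Set.Ioo (ζ k) (ζ ⟨(k : ℕ) + 1, h⟩), |μ x| ≤ K * (1 + |x|) := by
    intro k
    by_cases h : (k : ℕ) + 1 < m
    · have hlt : ζ k < ζ ⟨(k : ℕ) + 1, h⟩ := hζ (by rw [Fin.lt_def]; simp)
      obtain ⟨K, hK0, hK⟩ := lip_growth _ _ (hμ_mid k h) (Set.nonempty_Ioo.mpr hlt)
      exact ⟨K, hK0, fun _ => hK⟩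
    · exact ⟨0, le_rfl, fun h' => absurd h' h⟩
  choose K3 h30 h3 using hmid
  set S : ℝ := K1 + K2 + ∑ k, K3 k + ∑ k, |μ (ζ k)|
  have hs3 : 0 ≤ ∑ k, K3 k := Finset.sum_nonneg fun k _ => h30 k
  have hs4 : 0 ≤ ∑ k, |μ (ζ k)| := Finset.sum_nonneg fun k _ => abs_nonneg _
  refine ⟨S, by positivity, fun x => ?_⟩
  have fin : ∀ K, K ≤ S → |μ x| ≤ K * (1 + |x|) → |μ x| ≤ S * (1 + |x|) := by
    intro K hK h
    refine h.trans (by gcongr)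
  by_cases hx : ∃ k, x = ζ k
  · obtain ⟨k, rfl⟩ := hx
    refine fin (|μ (ζ k)|) ?_ ?_
    · have := Finset.single_le_sum (f := fun k => |μ (ζ k)|) (fun i _ => abs_nonneg _) (Finset.mem_univ k)
      linarith
    · nlinarith [abs_nonneg (μ (ζ k)), abs_nonneg (ζ k)]
  push Not at hx
  by_cases hlow : x < ζ ⟨0, hm⟩
  · exact fin K1 (by linarith) (h1 x hlow)
  push Not at hlow
  -- the largest index with `ζ k ≤ x`
  have hne : (Finset.univ.filter fun k : Fin m => ζ k ≤ x).Nonempty := ⟨⟨0, hm⟩, by simpa using hlow⟩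
  set k := (Finset.univ.filter fun k : Fin m => ζ k ≤ x).max' hne with hk
  have hkx : ζ k ≤ x := by
    have := Finset.max'_mem _ hne
    simpa using this
  have hkx' : ζ k < x := lt_of_le_of_ne hkx (fun h => hx k h.symm)
  by_cases h : (k : ℕ) + 1 < m
  · refine fin (K3 k) ?_ (h3 k h x ⟨hkx', ?_⟩)
    · have := Finset.single_le_sum (f := K3) (fun i _ => h30 i) (Finset.mem_univ k)
      linarith
    · by_contra hcon
      push Not at hcon
      have := Finset.le_max' (Finset.univ.filter fun k : Fin m => ζ k ≤ x) ⟨(k : ℕ) + 1, h⟩ (by simpa using hcon)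
      rw [← hk, Fin.le_def] at this
      simp at this
  · have hkm : k = ⟨m - 1, Nat.sub_lt hm one_pos⟩ := by
      ext; simp only; have := k.2; omega
    exact fin K2 (by linarith) (h2 x (by rw [hkm] at hkx'; exact hkx'))

lemma exists_eta (σ : ℝ → ℝ) (hσ : ∃ K : NNReal, LipschitzWith K σ) (m : ℕ) (ζ : Fin m → ℝ)
    (hnz : ∀ k, σ (ζ k) ≠ 0) :
    ∃ η : ℝ, 0 < η ∧ ∃ s0 : ℝ, 0 < s0 ∧ ∀ k x, |x - ζ k| ≤ η → s0 ≤ σ x ^ 2 := by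
  obtain ⟨K, hK⟩ := hσ
  have hcont : Continuous fun x => σ x ^ 2 := hK.continuous.pow 2
  have : ∀ k : Fin m, ∀ᶠ e : ℝ in nhdsWithin 0 (Set.Ioi 0), ∀ x, |x - ζ k| ≤ e → e ≤ σ x ^ 2 := by
    intro k
    have hpos : 0 < σ (ζ k) ^ 2 := by have := hnz k; positivity
    have h1 : ∀ᶠ x in nhds (ζ k), σ (ζ k) ^ 2 / 2 < σ x ^ 2 :=
      hcont.continuousAt.eventually (lt_mem_nhds (by linarith))
    obtain ⟨e, he, h2⟩ := Metric.eventually_nhds_iff.mp h1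
    have : 0 < min e (σ (ζ k) ^ 2 / 2) := by positivity
    filter_upwards [Ioo_mem_nhdsGT this] with r hr x hx
    have hr2 := hr.2
    rw [lt_min_iff] at hr2
    have := h2 (y := x) (by rw [Real.dist_eq]; linarith)
    linarith
  have h := (Filter.eventually_all.mpr this).and self_mem_nhdsWithin
  obtain ⟨e, he1, he2⟩ := h.exists
  exact ⟨e, he2, e, he2, he1⟩

/-- Moment properties of the law of the increment pair over a time step of length `h`. -/
structure StepLaw (L : Measure (ℝ × ℝ)) (M h : ℝ) : Prop where
  prob : IsProbabilityMeasure L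
  iu : Integrable (fun p : ℝ × ℝ => p.1 ^ 4) L
  iv : Integrable (fun p : ℝ × ℝ => p.2 ^ 4) L
  u1 : ∫ p, p.1 ∂L = 0
  u2 : ∫ p, p.1 ^ 2 ∂L = h
  u4 : ∫ p, p.1 ^ 4 ∂L ≤ M * h ^ 2
  v1 : ∫ p, |p.2| ∂L ≤ M * h
  v2 : ∫ p, p.2 ^ 2 ∂L ≤ M * h
  v4 : ∫ p, p.2 ^ 4 ∂L ≤ M * h
  vn : L.real {p | p.2 ≠ 0} ≤ M * h

lemma integrable_pow_of_four {α : Type*} [MeasurableSpace α] (L : Measure α) [IsFiniteMeasure L]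
    (X : α → ℝ) (hX : AEStronglyMeasurable X L) (h4 : Integrable (fun a => X a ^ 4) L) :
    Integrable X L ∧ Integrable (fun a => X a ^ 2) L ∧ Integrable (fun a => |X a|) L := by
  have h1 : Integrable X L := by
    refine Integrable.mono' ((integrable_const (1:ℝ)).add h4) hX (Filter.Eventually.of_forall fun a => ?_)
    simp only [Real.norm_eq_abs, Pi.add_apply]
    rw [abs_le]
    constructor <;> nlinarith [sq_nonneg (X a), sq_nonneg (X a ^ 2 - 1), sq_nonneg (X a - 1), sq_nonneg (X a + 1)]
  refine ⟨h1, ?_, h1.abs⟩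
  refine Integrable.mono' ((integrable_const (1:ℝ)).add h4) (hX.pow 2) (Filter.Eventually.of_forall fun a => ?_)
  simp only [Real.norm_eq_abs, Pi.add_apply]
  rw [abs_of_nonneg (sq_nonneg _)]
  nlinarith [sq_nonneg (X a ^ 2 - 1)]

namespace StepLaw
variable {L : Measure (ℝ × ℝ)} {M h : ℝ}

lemma iu' (S : StepLaw L M h) : Integrable (fun p : ℝ × ℝ => p.1) L ∧
    Integrable (fun p : ℝ × ℝ => p.1 ^ 2) L ∧ Integrable (fun p : ℝ × ℝ => |p.1|) L := by
  have := S.prob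
  exact integrable_pow_of_four L _ measurable_fst.aestronglyMeasurable S.iu

lemma iv' (S : StepLaw L M h) : Integrable (fun p : ℝ × ℝ => p.2) L ∧
    Integrable (fun p : ℝ × ℝ => p.2 ^ 2) L ∧ Integrable (fun p : ℝ × ℝ => |p.2|) L := by
  have := S.prob
  exact integrable_pow_of_four L _ measurable_snd.aestronglyMeasurable S.iv
end StepLaw

/-- one step increment -/
noncomputable def Hs (μ σ ρ : ℝ → ℝ) (h x : ℝ) (p : ℝ × ℝ) : ℝ := μ x * h + σ x * p.1 + ρ x * p.2

lemma Hs_meas (μ σ ρ : ℝ → ℝ) (hμ : Measurable μ) (hσ : Measurable σ) (hρ : Measurable ρ) (h : ℝ) :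
    Measurable (fun q : ℝ × (ℝ × ℝ) => Hs μ σ ρ h q.1 q.2) := by
  unfold Hs; fun_prop

lemma Hs_meas' (μ σ ρ : ℝ → ℝ) (h x : ℝ) : Measurable (Hs μ σ ρ h x) := by
  unfold Hs; fun_prop

section laws
variable {L : Measure (ℝ × ℝ)} {M h : ℝ} {μ σ ρ : ℝ → ℝ} {K : ℝ}

lemma law_sq (S : StepLaw L M h) (hM : 0 ≤ M) (h0 : 0 ≤ h) (h1 : h ≤ 1) (hK : 0 ≤ K)
    (hμ : ∀ x, |μ x| ≤ K * (1 + |x|)) (hσ : ∀ x, |σ x| ≤ K * (1 + |x|))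
    (hρ : ∀ x, |ρ x| ≤ K * (1 + |x|)) (x : ℝ) :
    Integrable (fun p => Hs μ σ ρ h x p ^ 2) L ∧
    ∫ p, Hs μ σ ρ h x p ^ 2 ∂L ≤ 3 * K ^ 2 * (2 + M) * (1 + |x|) ^ 2 * h := by
  have := S.prob
  have hb : ∀ p, Hs μ σ ρ h x p ^ 2 ≤ 3 * (K * (1 + |x|)) ^ 2 * (h ^ 2 + p.1 ^ 2 + p.2 ^ 2) := by
    intro p
    have e : ∀ a b c : ℝ, (a + b + c) ^ 2 ≤ 3 * (a ^ 2 + b ^ 2 + c ^ 2) := by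
      intro a b c; nlinarith [sq_nonneg (a - b), sq_nonneg (b - c), sq_nonneg (a - c)]
    have sq' : ∀ f : ℝ, |f| ≤ K * (1 + |x|) → f ^ 2 ≤ (K * (1 + |x|)) ^ 2 := by
      intro f hf; rw [← sq_abs f]; gcongr
    calc Hs μ σ ρ h x p ^ 2 ≤ 3 * ((μ x * h) ^ 2 + (σ x * p.1) ^ 2 + (ρ x * p.2) ^ 2) := e _ _ _
      _ = 3 * (μ x ^ 2 * h ^ 2 + σ x ^ 2 * p.1 ^ 2 + ρ x ^ 2 * p.2 ^ 2) := by ring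
      _ ≤ 3 * ((K * (1 + |x|)) ^ 2 * h ^ 2 + (K * (1 + |x|)) ^ 2 * p.1 ^ 2 + (K * (1 + |x|)) ^ 2 * p.2 ^ 2) := by
          have a1 := sq' _ (hμ x)
          have a2 := sq' _ (hσ x)
          have a3 := sq' _ (hρ x)
          gcongr
      _ = _ := by ring
  have hi : Integrable (fun p : ℝ × ℝ => 3 * (K * (1 + |x|)) ^ 2 * (h ^ 2 + p.1 ^ 2 + p.2 ^ 2)) L :=
    (((integrable_const _).add S.iu'.2.1).add S.iv'.2.1).const_mul _
  have hi2 : Integrable (fun p => Hs μ σ ρ h x p ^ 2) L := by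
    refine hi.mono' ((Hs_meas' μ σ ρ h x).pow_const 2).aestronglyMeasurable
      (Filter.Eventually.of_forall fun p => ?_)
    rw [Real.norm_eq_abs, abs_of_nonneg (sq_nonneg _)]; exact hb p
  refine ⟨hi2, (integral_mono hi2 hi hb).trans ?_⟩
  have i1 : Integrable (fun p : ℝ × ℝ => h ^ 2 + p.1 ^ 2) L := (integrable_const _).add S.iu'.2.1
  rw [integral_const_mul, integral_add i1 S.iv'.2.1, integral_add (integrable_const _) S.iu'.2.1,
    S.u2]
  simp only [integral_const, probReal_univ, one_smul]
  have hh : h ^ 2 ≤ h := by nlinarith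
  calc 3 * (K * (1 + |x|)) ^ 2 * (h ^ 2 + h + ∫ p, p.2 ^ 2 ∂L)
      ≤ 3 * (K * (1 + |x|)) ^ 2 * (h + h + M * h) := by
        have := S.v2
        gcongr
    _ = _ := by ring

lemma law_four (S : StepLaw L M h) (hM : 0 ≤ M) (h0 : 0 ≤ h) (h1 : h ≤ 1) (hK : 0 ≤ K)
    (hμ : ∀ x, |μ x| ≤ K * (1 + |x|)) (hσ : ∀ x, |σ x| ≤ K * (1 + |x|))
    (hρ : ∀ x, |ρ x| ≤ K * (1 + |x|)) (x : ℝ) :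
    Integrable (fun p => Hs μ σ ρ h x p ^ 4) L ∧
    ∫ p, Hs μ σ ρ h x p ^ 4 ∂L ≤ 27 * K ^ 4 * (1 + 2 * M) * (1 + |x|) ^ 4 * h := by
  have := S.prob
  have hb : ∀ p, Hs μ σ ρ h x p ^ 4 ≤ 27 * (K * (1 + |x|)) ^ 4 * (h ^ 4 + p.1 ^ 4 + p.2 ^ 4) := by
    intro p
    have e2 : ∀ a b c : ℝ, (a + b + c) ^ 2 ≤ 3 * (a ^ 2 + b ^ 2 + c ^ 2) := by
      intro a b c; nlinarith [sq_nonneg (a - b), sq_nonneg (b - c), sq_nonneg (a - c)]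
    have e : ∀ a b c : ℝ, (a + b + c) ^ 4 ≤ 27 * (a ^ 4 + b ^ 4 + c ^ 4) := by
      intro a b c
      have k1 := e2 a b c
      have k2 := e2 (a ^ 2) (b ^ 2) (c ^ 2)
      have k3 : ((a + b + c) ^ 2) ^ 2 ≤ (3 * (a ^ 2 + b ^ 2 + c ^ 2)) ^ 2 := by gcongr
      nlinarith
    have sq' : ∀ f : ℝ, |f| ≤ K * (1 + |x|) → f ^ 4 ≤ (K * (1 + |x|)) ^ 4 := by
      intro f hf
      have : f ^ 4 = |f| ^ 4 := by rw [← abs_pow]; exact (abs_of_nonneg (by positivity)).symm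
      rw [this]; gcongr
    calc Hs μ σ ρ h x p ^ 4 ≤ 27 * ((μ x * h) ^ 4 + (σ x * p.1) ^ 4 + (ρ x * p.2) ^ 4) := e _ _ _
      _ = 27 * (μ x ^ 4 * h ^ 4 + σ x ^ 4 * p.1 ^ 4 + ρ x ^ 4 * p.2 ^ 4) := by ring
      _ ≤ 27 * ((K * (1 + |x|)) ^ 4 * h ^ 4 + (K * (1 + |x|)) ^ 4 * p.1 ^ 4 + (K * (1 + |x|)) ^ 4 * p.2 ^ 4) := by
          have a1 := sq' _ (hμ x)
          have a2 := sq' _ (hσ x)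
          have a3 := sq' _ (hρ x)
          have b1 : 0 ≤ p.1 ^ 4 := by positivity
          have b2 : 0 ≤ p.2 ^ 4 := by positivity
          gcongr
      _ = _ := by ring
  have hi : Integrable (fun p : ℝ × ℝ => 27 * (K * (1 + |x|)) ^ 4 * (h ^ 4 + p.1 ^ 4 + p.2 ^ 4)) L :=
    (((integrable_const _).add S.iu).add S.iv).const_mul _
  have hi2 : Integrable (fun p => Hs μ σ ρ h x p ^ 4) L := by
    refine hi.mono' ((Hs_meas' μ σ ρ h x).pow_const 4).aestronglyMeasurable
      (Filter.Eventually.of_forall fun p => ?_)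
    rw [Real.norm_eq_abs, abs_of_nonneg (by positivity)]; exact hb p
  refine ⟨hi2, (integral_mono hi2 hi hb).trans ?_⟩
  have i1 : Integrable (fun p : ℝ × ℝ => h ^ 4 + p.1 ^ 4) L := (integrable_const _).add S.iu
  rw [integral_const_mul, integral_add i1 S.iv, integral_add (integrable_const _) S.iu]
  simp only [integral_const, probReal_univ, one_smul]
  have hh : h ^ 2 ≤ h := by nlinarith
  have hh4 : h ^ 4 ≤ h := by nlinarith [sq_nonneg h]
  calc 27 * (K * (1 + |x|)) ^ 4 * (h ^ 4 + ∫ p, p.1 ^ 4 ∂L + ∫ p, p.2 ^ 4 ∂L)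
      ≤ 27 * (K * (1 + |x|)) ^ 4 * (h + M * h + M * h) := by
        have := S.v4
        have := S.u4
        have : M * h ^ 2 ≤ M * h := by gcongr
        gcongr
        linarith
    _ = _ := by ring

lemma law_one (S : StepLaw L M h) (x : ℝ) :
    Integrable (fun p => Hs μ σ ρ h x p) L ∧
    ∫ p, Hs μ σ ρ h x p ∂L = μ x * h + ρ x * ∫ p, p.2 ∂L := by
  have := S.prob
  have i1 : Integrable (fun p : ℝ × ℝ => μ x * h + σ x * p.1) L :=
    (integrable_const _).add (S.iu'.1.const_mul _)
  have i2 : Integrable (fun p : ℝ × ℝ => ρ x * p.2) L := S.iv'.1.const_mul _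
  refine ⟨i1.add i2, ?_⟩
  unfold Hs
  rw [integral_add i1 i2, integral_add (integrable_const _) (S.iu'.1.const_mul _)]
  simp [integral_const_mul, S.u1]

lemma q4 (x : ℝ) : (1 + |x|) ^ 4 ≤ 8 * (1 + x ^ 4) := by
  have : x ^ 4 = |x| ^ 4 := by rw [← abs_pow]; exact (abs_of_nonneg (by positivity)).symm
  rw [this]
  set a := |x|
  nlinarith [sq_nonneg (a - 1), sq_nonneg (a ^ 2 - 1), sq_nonneg (a ^ 2 - a), sq_nonneg (a^2 - 2 * a + 1)]

lemma law_moment (S : StepLaw L M h) (hM : 0 ≤ M) (h0 : 0 ≤ h) (h1 : h ≤ 1) (hK : 0 ≤ K)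
    (hμ : ∀ x, |μ x| ≤ K * (1 + |x|)) (hσ : ∀ x, |σ x| ≤ K * (1 + |x|))
    (hρ : ∀ x, |ρ x| ≤ K * (1 + |x|)) (x : ℝ) :
    ∫⁻ p, ENNReal.ofReal (1 + (x + Hs μ σ ρ h x p) ^ 4) ∂L ≤
      ENNReal.ofReal ((1 + 8 * (4 * K * (1 + M) + 24 * K ^ 2 * (2 + M) + 81 * K ^ 4 * (1 + 2 * M)) * h)
        * (1 + x ^ 4)) := by
  have := S.prob
  obtain ⟨i1, e1⟩ := law_one (μ := μ) (σ := σ) (ρ := ρ) S x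
  obtain ⟨i2, e2⟩ := law_sq S hM h0 h1 hK hμ hσ hρ x
  obtain ⟨i4, e4⟩ := law_four S hM h0 h1 hK hμ hσ hρ x
  have hb : ∀ p, 1 + (x + Hs μ σ ρ h x p) ^ 4 ≤ (1 + x ^ 4) + 4 * x ^ 3 * Hs μ σ ρ h x p
      + 8 * x ^ 2 * Hs μ σ ρ h x p ^ 2 + 3 * Hs μ σ ρ h x p ^ 4 := by
    intro p
    set H := Hs μ σ ρ h x p
    nlinarith [sq_nonneg (H * (x - H))]
  have j1 : Integrable (fun p => (1 + x ^ 4) + 4 * x ^ 3 * Hs μ σ ρ h x p) L :=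
    (integrable_const _).add (i1.const_mul _)
  have j2 : Integrable (fun p => (1 + x ^ 4) + 4 * x ^ 3 * Hs μ σ ρ h x p
      + 8 * x ^ 2 * Hs μ σ ρ h x p ^ 2) L := j1.add (i2.const_mul _)
  have j3 : Integrable (fun p => (1 + x ^ 4) + 4 * x ^ 3 * Hs μ σ ρ h x p
      + 8 * x ^ 2 * Hs μ σ ρ h x p ^ 2 + 3 * Hs μ σ ρ h x p ^ 4) L := j2.add (i4.const_mul _)
  refine (lintegral_mono fun p => ENNReal.ofReal_le_ofReal (hb p)).trans ?_
  rw [← ofReal_integral_eq_lintegral_ofReal j3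
    (Filter.Eventually.of_forall fun p => le_trans (by positivity) (hb p))]
  refine ENNReal.ofReal_le_ofReal ?_
  rw [integral_add j2 (i4.const_mul _), integral_add j1 (i2.const_mul _),
    integral_add (integrable_const _) (i1.const_mul _), integral_const_mul, integral_const_mul,
    integral_const_mul, e1]
  simp only [integral_const, probReal_univ, one_smul]
  set q := 1 + |x| with hq
  have hq1 : 1 ≤ q := by simp [hq]
  have hxq : |x| ≤ q := by simp [hq]
  have q4 := q4 x
  rw [← hq] at q4
  have b1 : 4 * x ^ 3 * (μ x * h + ρ x * ∫ p, p.2 ∂L) ≤ 4 * K * (1 + M) * q ^ 4 * h := by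
    refine (le_abs_self _).trans ?_
    have v1 : |∫ p, p.2 ∂L| ≤ M * h := (abs_integral_le_integral_abs).trans S.v1
    have k1 : |μ x * h + ρ x * ∫ p, p.2 ∂L| ≤ K * q * h + K * q * (M * h) := by
      refine (abs_add_le _ _).trans ?_
      rw [abs_mul, abs_mul, abs_of_nonneg h0]
      have := hμ x
      have := hρ x
      gcongr
    rw [abs_mul, abs_mul, abs_pow, abs_of_pos (by norm_num : (0:ℝ) < 4)]
    calc 4 * |x| ^ 3 * |μ x * h + ρ x * ∫ p, p.2 ∂L| ≤ 4 * q ^ 3 * (K * q * h + K * q * (M * h)) := by gcongr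
      _ = _ := by ring
  have b2 : 8 * x ^ 2 * ∫ p, Hs μ σ ρ h x p ^ 2 ∂L ≤ 24 * K ^ 2 * (2 + M) * q ^ 4 * h := by
    have : x ^ 2 ≤ q ^ 2 := by rw [← sq_abs]; gcongr
    calc 8 * x ^ 2 * ∫ p, Hs μ σ ρ h x p ^ 2 ∂L ≤ 8 * q ^ 2 * (3 * K ^ 2 * (2 + M) * q ^ 2 * h) := by
          gcongr
      _ = _ := by ring
  have b3 : 3 * ∫ p, Hs μ σ ρ h x p ^ 4 ∂L ≤ 81 * K ^ 4 * (1 + 2 * M) * q ^ 4 * h := by linarith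
  set D := 4 * K * (1 + M) + 24 * K ^ 2 * (2 + M) + 81 * K ^ 4 * (1 + 2 * M) with hD
  have hD0 : 0 ≤ D := by positivity
  have : D * h * q ^ 4 ≤ D * h * (8 * (1 + x ^ 4)) := by gcongr
  have e : 4 * K * (1 + M) * q ^ 4 * h + 24 * K ^ 2 * (2 + M) * q ^ 4 * h + 81 * K ^ 4 * (1 + 2 * M) * q ^ 4 * h
    = D * h * q ^ 4 := by rw [hD]; ring
  nlinarith

lemma law_lip (S : StepLaw L M h) (hM : 0 ≤ M) (h0 : 0 ≤ h) (h1 : h ≤ 1) (hK : 0 ≤ K)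
    (hμ : ∀ x, |μ x| ≤ K * (1 + |x|)) (hσ : ∀ x, |σ x| ≤ K * (1 + |x|))
    (hρ : ∀ x, |ρ x| ≤ K * (1 + |x|)) (x : ℝ) :
    ∫⁻ p, ENNReal.ofReal (((1 + |x|) * |Hs μ σ ρ h x p|) ^ 2) ∂L ≤
      ENNReal.ofReal (24 * K ^ 2 * (2 + M) * h * (1 + x ^ 4)) := by
  obtain ⟨i2, e2⟩ := law_sq S hM h0 h1 hK hμ hσ hρ x
  have e : ∀ p, ((1 + |x|) * |Hs μ σ ρ h x p|) ^ 2 = (1 + |x|) ^ 2 * Hs μ σ ρ h x p ^ 2 := by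
    intro p; rw [mul_pow, sq_abs]
  simp only [e]
  rw [← ofReal_integral_eq_lintegral_ofReal (i2.const_mul _)
    (Filter.Eventually.of_forall fun p => by positivity)]
  refine ENNReal.ofReal_le_ofReal ?_
  rw [integral_const_mul]
  have q4 := q4 x
  calc (1 + |x|) ^ 2 * ∫ p, Hs μ σ ρ h x p ^ 2 ∂L
      ≤ (1 + |x|) ^ 2 * (3 * K ^ 2 * (2 + M) * (1 + |x|) ^ 2 * h) := by gcongr
    _ = 3 * K ^ 2 * (2 + M) * h * (1 + |x|) ^ 4 := by ring
    _ ≤ 3 * K ^ 2 * (2 + M) * h * (8 * (1 + x ^ 4)) := by gcongr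
    _ = _ := by ring

end laws

/-- smoothed absolute value -/
noncomputable def fA (a y : ℝ) : ℝ := Real.sqrt (a + y ^ 2)
/-- its curvature -/
noncomputable def wA (a y : ℝ) : ℝ := a / fA a y ^ 3

lemma fA_sq (a y : ℝ) (ha : 0 < a) : fA a y ^ 2 = a + y ^ 2 := by
  unfold fA; rw [Real.sq_sqrt (by positivity)]

lemma fA_pos (a y : ℝ) (ha : 0 < a) : 0 < fA a y := by
  unfold fA; apply Real.sqrt_pos.mpr; positivity

lemma fA_meas (a : ℝ) : Measurable (fA a) := by unfold fA; fun_prop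
lemma wA_meas (a : ℝ) : Measurable (wA a) := by
  have := fA_meas a
  unfold wA; fun_prop

lemma le_of_sq_le_sq' {x y : ℝ} (h : x ^ 2 ≤ y ^ 2) (hy : 0 ≤ y) : x ≤ y :=
  (le_abs_self x).trans (abs_le_of_sq_le_sq h hy)

lemma ofReal_integral_le {f : ℝ × ℝ → ℝ} {L : Measure (ℝ × ℝ)} (hf : Integrable f L) :
    ENNReal.ofReal (∫ p, f p ∂L) ≤ ∫⁻ p, ENNReal.ofReal (f p) ∂L := by
  have h1 : ∫ p, f p ∂L ≤ ∫ p, max (f p) 0 ∂L :=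
    integral_mono hf hf.pos_part (fun p => le_max_left _ _)
  refine (ENNReal.ofReal_le_ofReal h1).trans ?_
  rw [ofReal_integral_eq_lintegral_ofReal hf.pos_part (Filter.Eventually.of_forall fun p => le_max_right _ _)]
  refine lintegral_mono fun p => ?_
  simp

lemma fA_bregman (a y h : ℝ) (ha : 0 < a) :
    fA a y + y * h / fA a y + wA a y / 4 * (h ^ 2 - h ^ 4 / a) ≤ fA a (y + h) := by
  unfold wA
  have hA := fA_pos a y ha
  have hB := fA_pos a (y + h) ha
  have hA2 := fA_sq a y ha
  have hB2 := fA_sq a (y + h) ha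
  set A := fA a y
  set B := fA a (y + h)
  have id : (A * B - (a + y * (y + h))) * (A * B + (a + y * (y + h))) = a * h ^ 2 := by
    have : A ^ 2 * B ^ 2 = (a + y ^ 2) * (a + (y + h) ^ 2) := by rw [hA2, hB2]
    nlinarith
  have hle : a + y * (y + h) ≤ A * B := by
    apply le_of_sq_le_sq' _ (by positivity)
    nlinarith [mul_nonneg ha.le (sq_nonneg h)]
  have e1 : (a + y * (y + h)) / A = A + y * h / A := by
    have : a + y * (y + h) = A ^ 2 + y * h := by rw [hA2]; ring
    rw [this]; field_simp
  by_cases hh : h ^ 2 ≤ a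
  · have hB2A : B ≤ 2 * A := by
      apply le_of_sq_le_sq' _ (by positivity)
      nlinarith [sq_nonneg (y - h)]
    have k1 : a * h ^ 2 ≤ (A * B - (a + y * (y + h))) * (4 * A ^ 2) := by
      rw [← id]
      refine mul_le_mul_of_nonneg_left ?_ (by linarith)
      nlinarith
    have k2 : (a + y * (y + h) + a * h ^ 2 / (4 * A ^ 2)) / A ≤ B := by
      rw [div_le_iff₀ hA]
      have : a * h ^ 2 / (4 * A ^ 2) ≤ A * B - (a + y * (y + h)) := by
        rw [div_le_iff₀ (by positivity)]; exact k1
      linarith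
    have k3 : (a + y * (y + h) + a * h ^ 2 / (4 * A ^ 2)) / A = A + y * h / A + a / A ^ 3 / 4 * h ^ 2 := by
      rw [add_div, e1]; congr 1; field_simp
    rw [k3] at k2
    have k4 : a / A ^ 3 / 4 * (h ^ 2 - h ^ 4 / a) ≤ a / A ^ 3 / 4 * h ^ 2 := by
      gcongr
      have : 0 ≤ h ^ 4 / a := by positivity
      linarith
    linarith
  · push Not at hh
    have k1 : a / A ^ 3 / 4 * (h ^ 2 - h ^ 4 / a) ≤ 0 := by
      apply mul_nonpos_of_nonneg_of_nonpos (by positivity)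
      have : h ^ 2 ≤ h ^ 4 / a := by
        rw [le_div_iff₀ ha]; nlinarith [sq_nonneg h]
      linarith
    have k2 : (a + y * (y + h)) / A ≤ B := by
      rw [div_le_iff₀ hA]; linarith
    linarith

lemma fA_lip (a x y : ℝ) (ha : 0 < a) : fA a x ≤ fA a y + |x - y| := by
  have hB := fA_pos a y ha
  unfold fA
  apply Real.sqrt_le_iff.mpr
  constructor
  · positivity
  · have h2 := fA_sq a y ha
    unfold fA at h2 hB
    have h3 : |y| ≤ Real.sqrt (a + y ^ 2) := Real.abs_le_sqrt (by linarith)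
    have h4 : y * (x - y) ≤ Real.sqrt (a + y ^ 2) * |x - y| := by
      refine (le_abs_self _).trans ?_
      rw [abs_mul]; gcongr
    nlinarith [sq_abs (x - y)]

lemma fA_le (a y : ℝ) (ha : 0 < a) : fA a y ≤ Real.sqrt a + |y| := by
  have := fA_lip a y 0 ha
  simpa [fA] using this

section laws
variable {L : Measure (ℝ × ℝ)} {M h : ℝ} {μ σ ρ : ℝ → ℝ} {K : ℝ}

/-- localized curvature -/
noncomputable def wL (a z η x : ℝ) : ℝ := if |x - z| ≤ η then wA a (x - z) else 0

lemma wL_meas (a z η : ℝ) : Measurable (wL a z η) := by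
  unfold wL
  refine Measurable.ite ?_ ((wA_meas a).comp (measurable_id.sub_const z)) measurable_const
  exact measurableSet_le (by fun_prop) measurable_const

lemma wA_nonneg (a y : ℝ) (ha : 0 < a) : 0 ≤ wA a y := by
  unfold wA; have := fA_pos a y ha; positivity

lemma wL_nonneg (a z η x : ℝ) (ha : 0 < a) : 0 ≤ wL a z η x := by
  unfold wL; split_ifs
  · exact wA_nonneg _ _ ha
  · exact le_rfl

lemma law_cross (S : StepLaw L M h) (hM : 0 ≤ M) (h0 : 0 ≤ h) (δ : ℝ) (hδ : h ≤ δ) (hδ1 : δ ≤ 1)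
    (hδ0 : 0 < δ) (z η Kz : ℝ)
    (hμ : ∀ x, |x - z| ≤ η → |μ x| ≤ Kz) (hσ : ∀ x, |x - z| ≤ η → |σ x| ≤ Kz)
    (κ : ℝ) (hκ : 1 ≤ κ) (x : ℝ) :
    ∫⁻ p, ENNReal.ofReal (if |x - z| ≤ η ∧ |x - z| ≤ |Hs μ σ ρ h x p| then 1 else 0) ∂L ≤
      ENNReal.ofReal ((2 + 16 * Kz ^ 4 * (1 + M)) * Real.sqrt κ * Real.sqrt δ * wL (κ * δ) z η x + M * δ) := by
  have := S.prob
  by_cases hx : |x - z| ≤ η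
  swap
  · simp [hx]
  set y := x - z
  have hm1 := hμ x hx
  have hs1 := hσ x hx
  have hKz : 0 ≤ Kz := (abs_nonneg _).trans hm1
  set a := κ * δ with ha
  have ha0 : 0 < a := by positivity
  have haδ : δ ≤ a := by nlinarith
  set H0 : ℝ × ℝ → ℝ := fun p => μ x * h + σ x * p.1 with hH0
  set A := fA a y with hA
  have hA0 : 0 < A := fA_pos a y ha0
  have hA2 : A ^ 2 = a + y ^ 2 := fA_sq a y ha0
  -- pointwise bound
  have hpt : ∀ p, (if |y| ≤ η ∧ |y| ≤ |Hs μ σ ρ h x p| then (1:ℝ) else 0) ≤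
      (2 * a ^ 2 + 16 * Kz ^ 4 * (h ^ 4 + p.1 ^ 4)) / A ^ 4 + Set.indicator {p : ℝ × ℝ | p.2 ≠ 0} (fun _ => (1:ℝ)) p := by
    intro p
    have n1 : 0 ≤ (2 * a ^ 2 + 16 * Kz ^ 4 * (h ^ 4 + p.1 ^ 4)) / A ^ 4 := by positivity
    have n2 : 0 ≤ Set.indicator {p : ℝ × ℝ | p.2 ≠ 0} (fun _ => (1:ℝ)) p :=
      Set.indicator_nonneg (fun _ _ => zero_le_one) p
    split_ifs with hc
    · by_cases hp : p.2 = 0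
      · have hH : Hs μ σ ρ h x p = H0 p := by simp [Hs, hH0, hp]
        rw [hH] at hc
        have hy2 : y ^ 2 ≤ H0 p ^ 2 := sq_le_sq.mpr hc.2
        have hb : H0 p ^ 4 ≤ 8 * Kz ^ 4 * (h ^ 4 + p.1 ^ 4) := by
          have e2 : ∀ a b : ℝ, (a + b) ^ 2 ≤ 2 * (a ^ 2 + b ^ 2) := by
            intro a b; nlinarith [sq_nonneg (a - b)]
          have e : ∀ a b : ℝ, (a + b) ^ 4 ≤ 8 * (a ^ 4 + b ^ 4) := by
            intro a b
            have k1 := e2 a b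
            have k2 := e2 (a ^ 2) (b ^ 2)
            have k3 : ((a + b) ^ 2) ^ 2 ≤ (2 * (a ^ 2 + b ^ 2)) ^ 2 := by gcongr
            nlinarith
          have sq' : ∀ f : ℝ, |f| ≤ Kz → f ^ 4 ≤ Kz ^ 4 := by
            intro f hf
            have : f ^ 4 = |f| ^ 4 := by rw [← abs_pow]; exact (abs_of_nonneg (by positivity)).symm
            rw [this]; gcongr
          have a1 := sq' _ hm1
          have a2 := sq' _ hs1
          have b1 : 0 ≤ p.1 ^ 4 := by positivity
          calc H0 p ^ 4 ≤ 8 * ((μ x * h) ^ 4 + (σ x * p.1) ^ 4) := e _ _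
            _ = 8 * (μ x ^ 4 * h ^ 4 + σ x ^ 4 * p.1 ^ 4) := by ring
            _ ≤ 8 * (Kz ^ 4 * h ^ 4 + Kz ^ 4 * p.1 ^ 4) := by gcongr
            _ = _ := by ring
        have h4 : A ^ 4 ≤ 2 * a ^ 2 + 16 * Kz ^ 4 * (h ^ 4 + p.1 ^ 4) := by
          have e : A ^ 4 = (a + y ^ 2) ^ 2 := by rw [← hA2]; ring
          have k : (a + y ^ 2) ^ 2 ≤ (a + H0 p ^ 2) ^ 2 := by gcongr
          nlinarith [sq_nonneg (a - H0 p ^ 2)]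
        have : 1 ≤ (2 * a ^ 2 + 16 * Kz ^ 4 * (h ^ 4 + p.1 ^ 4)) / A ^ 4 := by
          rw [le_div_iff₀ (by positivity)]; linarith
        linarith
      · have : Set.indicator {p : ℝ × ℝ | p.2 ≠ 0} (fun _ => (1:ℝ)) p = 1 :=
          Set.indicator_of_mem (by exact hp) _
        linarith
    · linarith
  have hms : MeasurableSet {p : ℝ × ℝ | p.2 ≠ 0} := by
    have : {p : ℝ × ℝ | p.2 ≠ 0} = Prod.snd ⁻¹' {0}ᶜ := rfl
    rw [this]; exact measurable_snd (measurableSet_singleton _).compl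
  have i1 : Integrable (fun p : ℝ × ℝ => h ^ 4 + p.1 ^ 4) L := (integrable_const _).add S.iu
  have i2 : Integrable (fun p : ℝ × ℝ => 2 * a ^ 2 + 16 * Kz ^ 4 * (h ^ 4 + p.1 ^ 4)) L :=
    (integrable_const _).add (i1.const_mul _)
  have i3 : Integrable (Set.indicator {p : ℝ × ℝ | p.2 ≠ 0} (fun _ => (1:ℝ))) L :=
    (integrable_const _).indicator hms
  have i4 := (i2.div_const (A ^ 4)).add i3
  refine (lintegral_mono fun p => ENNReal.ofReal_le_ofReal (hpt p)).trans ?_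
  have eq := ofReal_integral_eq_lintegral_ofReal i4
    (Filter.Eventually.of_forall fun p => le_trans (by split_ifs <;> norm_num) (hpt p))
  simp only [Pi.add_apply] at eq
  rw [← eq]
  refine ENNReal.ofReal_le_ofReal ?_
  rw [integral_add (i2.div_const _) i3, integral_div, integral_add (integrable_const _) (i1.const_mul _),
    integral_const_mul (16 * Kz ^ 4), integral_add (integrable_const _) S.iu, integral_indicator_const _ hms]
  simp only [integral_const, probReal_univ, smul_eq_mul, mul_one, one_mul]
  have hvn := S.vn
  have hw : wL a z η x = wA a y := by unfold wL; rw [if_pos hx]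
  rw [hw]
  have k1 : M * h ≤ M * δ := by gcongr
  have k2 : (2 * a ^ 2 + 16 * Kz ^ 4 * (h ^ 4 + ∫ p, p.1 ^ 4 ∂L)) ≤ (2 + 16 * Kz ^ 4 * (1 + M)) * a ^ 2 := by
    have u4 := S.u4
    have l1 : h ^ 2 ≤ a ^ 2 := by gcongr; linarith
    have l2 : h ^ 4 ≤ a ^ 2 := by
      have : h ^ 2 ≤ 1 := by nlinarith
      nlinarith [sq_nonneg h]
    have l3 : M * h ^ 2 ≤ M * a ^ 2 := by gcongr
    calc 2 * a ^ 2 + 16 * Kz ^ 4 * (h ^ 4 + ∫ p, p.1 ^ 4 ∂L)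
        ≤ 2 * a ^ 2 + 16 * Kz ^ 4 * (a ^ 2 + M * a ^ 2) := by gcongr; linarith
      _ = _ := by ring
  have k3 : a ^ 2 / A ^ 4 ≤ Real.sqrt κ * Real.sqrt δ * wA a y := by
    rw [← Real.sqrt_mul (by linarith), ← ha]
    unfold wA
    rw [← hA]
    have hs : 0 < Real.sqrt a := Real.sqrt_pos.mpr ha0
    have l1 : Real.sqrt a ≤ A := by
      rw [hA]; unfold fA; exact Real.sqrt_le_sqrt (by nlinarith [sq_nonneg y])
    have l2 : Real.sqrt a * Real.sqrt a = a := Real.mul_self_sqrt ha0.le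
    calc a ^ 2 / A ^ 4 = a / A ^ 3 * (a / A) := by field_simp
      _ ≤ a / A ^ 3 * Real.sqrt a := by
        gcongr
        rw [div_le_iff₀ hA0]; nlinarith
      _ = _ := by ring
  have k4 : (2 * a ^ 2 + 16 * Kz ^ 4 * (h ^ 4 + ∫ p, p.1 ^ 4 ∂L)) / A ^ 4 ≤
      (2 + 16 * Kz ^ 4 * (1 + M)) * Real.sqrt κ * Real.sqrt δ * wA a y := by
    calc _ ≤ (2 + 16 * Kz ^ 4 * (1 + M)) * a ^ 2 / A ^ 4 := by gcongr
      _ = (2 + 16 * Kz ^ 4 * (1 + M)) * (a ^ 2 / A ^ 4) := by ring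
      _ ≤ (2 + 16 * Kz ^ 4 * (1 + M)) * (Real.sqrt κ * Real.sqrt δ * wA a y) := by gcongr
      _ = _ := by ring
  linarith

lemma law_drift (S : StepLaw L M h) (hM : 0 ≤ M) (h0 : 0 < h)
    (hμ : ∀ x, |μ x| ≤ K * (1 + |x|))
    (hρ : ∀ x, |ρ x| ≤ K * (1 + |x|)) (hK : 0 ≤ K) (z η Kz : ℝ)
    (hσ : ∀ x, |x - z| ≤ η → |σ x| ≤ Kz) (s0 : ℝ) (hs0 : 0 < s0)
    (hσ0 : ∀ x, |x - z| ≤ η → s0 ≤ σ x ^ 2)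
    (κ : ℝ) (hκ : 1 ≤ κ) (hκ2 : 2 * Kz ^ 2 * M ≤ κ) (x : ℝ) :
    ENNReal.ofReal (fA (κ * h) (x - z) + s0 / 8 * wL (κ * h) z η x * h) ≤
    ∫⁻ p, ENNReal.ofReal (fA (κ * h) (x + Hs μ σ ρ h x p - z) + K * (1 + M) * (1 + |x|) * h) ∂L := by
  have := S.prob
  set y := x - z with hy
  set a := κ * h with ha
  have ha0 : 0 < a := by positivity
  have hK1 : 0 ≤ K * (1 + |x|) := by positivity
  -- pointwise
  have hpt0 : ∀ p : ℝ × ℝ, fA a (y + σ x * p.1) - K * (1 + |x|) * h - K * (1 + |x|) * |p.2| ≤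
      fA a (x + Hs μ σ ρ h x p - z) := by
    intro p
    have := fA_lip a (y + σ x * p.1) (x + Hs μ σ ρ h x p - z) ha0
    have e : y + σ x * p.1 - (x + Hs μ σ ρ h x p - z) = -(μ x * h + ρ x * p.2) := by
      simp only [Hs, hy]; ring
    rw [e, abs_neg] at this
    have k := abs_add_le (μ x * h) (ρ x * p.2)
    rw [abs_mul, abs_mul, abs_of_pos h0] at k
    have k1 : |μ x| * h ≤ K * (1 + |x|) * h := by gcongr; exact hμ x
    have k2 : |ρ x| * |p.2| ≤ K * (1 + |x|) * |p.2| := by gcongr; exact hρ x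
    linarith
  have main : ∃ g : ℝ × ℝ → ℝ, Integrable g L ∧ (∀ p, g p ≤ fA a (y + σ x * p.1)) ∧
      fA a y + s0 / 8 * wL a z η x * h ≤ ∫ p, g p ∂L := by
    by_cases hx : |x - z| ≤ η
    · refine ⟨fun p => fA a y + y * (σ x * p.1) / fA a y + wA a y / 4 * ((σ x * p.1) ^ 2 - (σ x * p.1) ^ 4 / a),
        ?_, fun p => fA_bregman a y _ ha0, ?_⟩
      all_goals
        have e : (fun p : ℝ × ℝ => fA a y + y * (σ x * p.1) / fA a y + wA a y / 4 * ((σ x * p.1) ^ 2 - (σ x * p.1) ^ 4 / a))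
          = fun p : ℝ × ℝ => fA a y + (y * σ x / fA a y) * p.1 + (wA a y / 4 * σ x ^ 2) * p.1 ^ 2
            - (wA a y / 4 * σ x ^ 4 / a) * p.1 ^ 4 := by
          funext p; ring
        have i1 : Integrable (fun p : ℝ × ℝ => fA a y + (y * σ x / fA a y) * p.1) L :=
          (integrable_const _).add (S.iu'.1.const_mul _)
        have i2 : Integrable (fun p : ℝ × ℝ => fA a y + (y * σ x / fA a y) * p.1 + (wA a y / 4 * σ x ^ 2) * p.1 ^ 2) L :=
          i1.add (S.iu'.2.1.const_mul _)
        have i3 := S.iu.const_mul (wA a y / 4 * σ x ^ 4 / a)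
        rw [e]
      · exact i2.sub i3
      · rw [integral_sub i2 i3, integral_add i1 (S.iu'.2.1.const_mul _),
          integral_add (integrable_const _) (S.iu'.1.const_mul _), integral_const_mul, integral_const_mul,
          integral_const_mul, S.u1, S.u2]
        simp only [integral_const, probReal_univ, one_smul, mul_zero, add_zero]
        have hw : wL a z η x = wA a y := by unfold wL; rw [if_pos hx]
        rw [hw]
        have hw0 := wA_nonneg a y ha0
        have u4 := S.u4
        have hs1 := hσ0 x hx
        have hsK : σ x ^ 2 ≤ Kz ^ 2 := by
          rw [← sq_abs]; have := hσ x hx; gcongr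
        have k1 : wA a y / 4 * σ x ^ 4 / a * ∫ p, p.1 ^ 4 ∂L ≤ wA a y / 8 * σ x ^ 2 * h := by
          calc wA a y / 4 * σ x ^ 4 / a * ∫ p, p.1 ^ 4 ∂L
              ≤ wA a y / 4 * σ x ^ 4 / a * (M * h ^ 2) := by gcongr
            _ = wA a y / 8 * σ x ^ 2 * h * ((2 * σ x ^ 2 * M) / κ) := by
                rw [ha]; field_simp; ring
            _ ≤ wA a y / 8 * σ x ^ 2 * h * 1 := by
                gcongr
                rw [div_le_one (by linarith)]
                have : 2 * σ x ^ 2 * M ≤ 2 * Kz ^ 2 * M := by gcongr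
                linarith
            _ = _ := by ring
        have k2 : s0 * (wA a y / 8 * h) ≤ σ x ^ 2 * (wA a y / 8 * h) := by gcongr
        linarith
    · refine ⟨fun p => fA a y + (y * σ x / fA a y) * p.1, (integrable_const _).add (S.iu'.1.const_mul _), fun p => ?_, ?_⟩
      · have k1 : y * σ x / fA a y * p.1 = y * (σ x * p.1) / fA a y := by ring
        have hA0 := fA_pos a y ha0
        have hA2 := fA_sq a y ha0
        have hB0 := fA_pos a (y + σ x * p.1) ha0
        have hB2 := fA_sq a (y + σ x * p.1) ha0
        change fA a y + y * σ x / fA a y * p.1 ≤ fA a (y + σ x * p.1)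
        rw [k1]
        set t := σ x * p.1
        have : (a + y * (y + t)) ≤ fA a y * fA a (y + t) := by
          have : (a + y * (y + t)) ^ 2 ≤ (fA a y * fA a (y + t)) ^ 2 := by
            rw [mul_pow, hA2, hB2]
            nlinarith [mul_nonneg ha0.le (sq_nonneg t)]
          exact le_of_sq_le_sq' this (by positivity)
        have e : fA a y + y * t / fA a y = (a + y * (y + t)) / fA a y := by
          have : a + y * (y + t) = fA a y ^ 2 + y * t := by rw [hA2]; ring
          rw [this]; field_simp
        rw [e, div_le_iff₀ hA0]; linarith
      · rw [integral_add (integrable_const _) (S.iu'.1.const_mul _), integral_const_mul, S.u1]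
        unfold wL
        rw [if_neg hx]
        simp
  obtain ⟨g, hg, hgb, hgi⟩ := main
  have hD0 : 0 ≤ K * (1 + M) * (1 + |x|) * h := by positivity
  have i5 : Integrable (fun p : ℝ × ℝ => g p - K * (1 + |x|) * h - K * (1 + |x|) * |p.2|
      + K * (1 + M) * (1 + |x|) * h) L :=
    ((hg.sub (integrable_const _)).sub (S.iv'.2.2.const_mul _)).add (integrable_const _)
  have i6 : Integrable (fun p : ℝ × ℝ => g p - K * (1 + |x|) * h) L := hg.sub (integrable_const _)
  have i7 : Integrable (fun p : ℝ × ℝ => g p - K * (1 + |x|) * h - K * (1 + |x|) * |p.2|) L :=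
    i6.sub (S.iv'.2.2.const_mul _)
  have hIneq : fA a y + s0 / 8 * wL a z η x * h ≤ ∫ p, (g p - K * (1 + |x|) * h - K * (1 + |x|) * |p.2|
      + K * (1 + M) * (1 + |x|) * h) ∂L := by
    rw [integral_add i7 (integrable_const _), integral_sub i6 (S.iv'.2.2.const_mul _),
      integral_sub hg (integrable_const _), integral_const_mul (K * (1 + |x|)) (fun p : ℝ × ℝ => |p.2|)]
    simp only [integral_const, probReal_univ, one_smul]
    have : K * (1 + |x|) * ∫ p, |p.2| ∂L ≤ K * (1 + |x|) * (M * h) := by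
      have := S.v1
      gcongr
    nlinarith
  refine (ENNReal.ofReal_le_ofReal hIneq).trans ?_
  refine (ENNReal.ofReal_le_ofReal (le_refl _)).trans ((ofReal_integral_le i5).trans ?_)
  refine lintegral_mono fun p => ENNReal.ofReal_le_ofReal ?_
  have := hgb p
  have := hpt0 p
  linarith
end laws

lemma poisson_four (R : ℝ) (hR : 0 ≤ R) : ∃ C : ℝ, 0 ≤ C ∧ ∀ r : NNReal, (r : ℝ) ≤ R →
    Integrable (fun k : ℕ => (k : ℝ) ^ 4) (poissonMeasure r) ∧
    ∫ k, (k : ℝ) ^ 4 ∂(poissonMeasure r) ≤ C * r := by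
  have hs : Summable (fun k : ℕ => (k : ℝ) ^ 4 * ((R + 1) ^ k / (k.factorial : ℝ))) := by
    refine Summable.of_nonneg_of_le (fun k => by positivity) (fun k => ?_)
      ((Real.summable_pow_div_factorial (Real.exp 1 * (R + 1))).mul_left 24)
    have h1 : (k : ℝ) ^ 4 ≤ 24 * Real.exp 1 ^ k := by
      have := Real.pow_div_factorial_le_exp (x := (k : ℝ)) (by positivity) 4
      rw [← Real.exp_one_pow] at this
      have e : ((Nat.factorial 4 : ℕ) : ℝ) = 24 := by norm_num [Nat.factorial]
      rw [e, div_le_iff₀ (by norm_num)] at this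
      linarith
    calc (k : ℝ) ^ 4 * ((R + 1) ^ k / (k.factorial : ℝ))
        ≤ (24 * Real.exp 1 ^ k) * ((R + 1) ^ k / (k.factorial : ℝ)) := by gcongr
      _ = _ := by rw [mul_pow]; ring
  refine ⟨∑' k : ℕ, (k : ℝ) ^ 4 * ((R + 1) ^ k / (k.factorial : ℝ)), tsum_nonneg fun k => by positivity, ?_⟩
  intro r hr
  have hb : ∀ k : ℕ, Real.exp (-r) * (r : ℝ) ^ k / (k.factorial : ℝ) * (k : ℝ) ^ 4 ≤
      (k : ℝ) ^ 4 * ((R + 1) ^ k / (k.factorial : ℝ)) * r := by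
    intro k
    rcases k with _ | k
    · simp
    · have h1 : Real.exp (-(r : ℝ)) ≤ 1 := Real.exp_le_one_iff.mpr (by simp)
      have h2 : (r : ℝ) ^ (k + 1) ≤ (R + 1) ^ (k + 1) * r := by
        rw [pow_succ]
        have : (r : ℝ) ^ k ≤ (R + 1) ^ (k + 1) := by
          calc (r : ℝ) ^ k ≤ (R + 1) ^ k := by gcongr; linarith
            _ ≤ _ := pow_le_pow_right₀ (by linarith) (by omega)
        gcongr
      calc Real.exp (-r) * (r : ℝ) ^ (k + 1) / ((k + 1).factorial : ℝ) * ((k + 1 : ℕ) : ℝ) ^ 4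
          ≤ 1 * ((R + 1) ^ (k + 1) * r) / ((k + 1).factorial : ℝ) * ((k + 1 : ℕ) : ℝ) ^ 4 := by gcongr
        _ = _ := by ring
  have hi : Integrable (fun k : ℕ => (k : ℝ) ^ 4) (poissonMeasure r) := by
    rw [integrable_poissonMeasure_iff]
    refine Summable.of_nonneg_of_le (fun k => by positivity) (fun k => ?_) (hs.mul_right (r : ℝ))
    rw [Real.norm_of_nonneg (by positivity)]
    exact hb k
  refine ⟨hi, ?_⟩
  have h1 := hasSum_integral_poissonMeasure hi
  have h2 := (hs.mul_right (r : ℝ)).hasSum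
  rw [tsum_mul_right] at h2
  exact hasSum_le (fun k => hb k) h1 h2

lemma gauss_four : ∃ C : ℝ, 0 ≤ C ∧ ∀ h : ℝ, 0 ≤ h →
    Integrable (fun x : ℝ => x ^ 4) (gaussianReal 0 h.toNNReal) ∧
    ∫ x, x ^ 4 ∂(gaussianReal 0 h.toNNReal) = C * h ^ 2 := by
  refine ⟨∫ x, x ^ 4 ∂(gaussianReal 0 1), integral_nonneg fun x => by positivity, fun h h0 => ⟨?_, ?_⟩⟩
  · have := (memLp_id_gaussianReal (μ := 0) (v := h.toNNReal) 4).integrable_norm_pow (by norm_num)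
    refine this.congr (Filter.Eventually.of_forall fun x => ?_)
    simp only [id, NNReal.coe_ofNat]
    have e : ((4 : NNReal) : ENNReal).toReal = (4 : ℝ) := by norm_num
    simp [Real.norm_eq_abs, Even.pow_abs (by decide : Even 4)]
  · have e : gaussianReal 0 h.toNNReal = (gaussianReal 0 1).map (Real.sqrt h * ·) := by
      rw [gaussianReal_map_const_mul]
      congr 1
      · simp
      · ext; simp [Real.sq_sqrt h0, h0]
    rw [e, integral_map (by fun_prop) (by fun_prop)]
    simp only [mul_pow]
    rw [integral_const_mul, mul_comm]
    congr 1
    have : Real.sqrt h ^ 4 = (Real.sqrt h ^ 2) ^ 2 := by ring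
    rw [this, Real.sq_sqrt h0]

lemma stepLaw_of (B T : ℝ) (hB : 0 ≤ B) (hT : 0 ≤ T) : ∃ M : ℝ, 0 ≤ M ∧
    ∀ (L : Measure (ℝ × ℝ)) (h : ℝ) (r : NNReal), IsProbabilityMeasure L → 0 ≤ h → h ≤ T →
      L.map Prod.fst = gaussianReal 0 h.toNNReal →
      L.map Prod.snd = Measure.map (fun k : ℕ => (k : ℝ)) (poissonMeasure r) →
      (r : ℝ) ≤ B * h → StepLaw L M h := by
  obtain ⟨C1, hC1, H1⟩ := gauss_four
  obtain ⟨C2, hC2, H2⟩ := poisson_four (B * T) (by positivity)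
  refine ⟨C1 + C2 * B, by positivity, ?_⟩
  intro L h r hL h0 hhT hf hs hr
  obtain ⟨g1, g2⟩ := H1 h h0
  obtain ⟨p1, p2⟩ := H2 r (hr.trans (by gcongr))
  have tf : ∀ f : ℝ → ℝ, Measurable f → ∫ p, f p.1 ∂L = ∫ x, f x ∂(gaussianReal 0 h.toNNReal) := by
    intro f hfm
    rw [← hf, integral_map (by fun_prop) hfm.aestronglyMeasurable]
  have ts : ∀ f : ℝ → ℝ, Measurable f → ∫ p, f p.2 ∂L = ∫ k : ℕ, f k ∂(poissonMeasure r) := by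
    intro f hfm
    have := integral_map (μ := L) (φ := Prod.snd) (by fun_prop) (f := f) hfm.aestronglyMeasurable
    rw [← this, hs, integral_map (Measurable.of_discrete.aemeasurable) hfm.aestronglyMeasurable]
  have hM1 : C1 * h ^ 2 ≤ (C1 + C2 * B) * h ^ 2 := by
    gcongr; nlinarith [mul_nonneg hC2 hB]
  have hM2 : ∫ k, (k : ℝ) ^ 4 ∂(poissonMeasure r) ≤ (C1 + C2 * B) * h := by
    calc _ ≤ C2 * r := p2
      _ ≤ C2 * (B * h) := by gcongr
      _ ≤ _ := by nlinarith [mul_nonneg hC1 h0]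
  have q := integrable_pow_of_four (poissonMeasure r) (fun k : ℕ => (k : ℝ))
    Measurable.of_discrete.aestronglyMeasurable p1
  have kb : ∀ k : ℕ, (k : ℝ) ≤ (k : ℝ) ^ 4 ∧ (k : ℝ) ^ 2 ≤ (k : ℝ) ^ 4 := by
    intro k
    rcases k with _ | k
    · simp
    · have : (1 : ℝ) ≤ ((k + 1 : ℕ) : ℝ) := by push_cast; linarith [Nat.cast_nonneg (α := ℝ) k]
      exact ⟨le_self_pow₀ this (by norm_num), pow_le_pow_right₀ this (by norm_num)⟩
  have hv1 : ∫ p, |p.2| ∂L ≤ (C1 + C2 * B) * h := by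
    rw [ts (fun x => |x|) (by fun_prop)]
    refine (integral_mono q.2.2 p1 fun k => ?_).trans hM2
    simpa using (kb k).1
  have iv4 : Integrable (fun p : ℝ × ℝ => p.2 ^ 4) L := by
    have h1 : Integrable (fun x : ℝ => x ^ 4) (L.map Prod.snd) := by
      rw [hs]
      exact (integrable_map_measure (by fun_prop) (Measurable.of_discrete.aemeasurable)).mpr p1
    exact (integrable_map_measure (by fun_prop) (by fun_prop)).mp h1
  refine ⟨hL, ?_, iv4, ?_, ?_, ?_, hv1, ?_, ?_, ?_⟩
  · have h1 : Integrable (fun x : ℝ => x ^ 4) (L.map Prod.fst) := by rw [hf]; exact g1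
    exact (integrable_map_measure (by fun_prop) (by fun_prop)).mp h1
  · rw [tf (fun x => x) (by fun_prop)]; exact integral_id_gaussianReal
  · rw [tf (fun x => x ^ 2) (by fun_prop)]
    have := variance_fun_id_gaussianReal (μ := 0) (v := h.toNNReal)
    rw [variance_eq_integral measurable_id'.aemeasurable] at this
    simpa [integral_id_gaussianReal, h0] using this
  · rw [tf (fun x => x ^ 4) (by fun_prop), g2]; exact hM1
  · rw [ts (fun x => x ^ 2) (by fun_prop)]
    exact (integral_mono q.2.1 p1 fun k => (kb k).2).trans hM2
  · rw [ts (fun x => x ^ 4) (by fun_prop)]; exact hM2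
  · have hms : MeasurableSet {x : ℝ | x ≠ 0} := (measurableSet_singleton (0:ℝ)).compl
    have e1 : L.real {p | p.2 ≠ 0} = ∫ p, Set.indicator {x : ℝ | x ≠ 0} (fun _ => (1:ℝ)) p.2 ∂L := by
      have : (fun p : ℝ × ℝ => Set.indicator {x : ℝ | x ≠ 0} (fun _ => (1:ℝ)) p.2) =
        Set.indicator {p : ℝ × ℝ | p.2 ≠ 0} (fun _ => (1:ℝ)) := rfl
      have hms2 : MeasurableSet {p : ℝ × ℝ | p.2 ≠ 0} := measurable_snd hms
      rw [this, integral_indicator_const _ hms2]; simp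
    rw [e1, ts _ (measurable_const.indicator hms)]
    refine (integral_mono ?_ p1 fun k => ?_).trans hM2
    · exact Integrable.mono' p1 Measurable.of_discrete.aestronglyMeasurable
        (Filter.Eventually.of_forall fun k => by
          rcases k with _ | k
          · simp
          · rw [Set.indicator_of_mem (by simp; positivity)]
            have := (kb (k+1)).1
            have h3 : (1 : ℝ) ≤ ((k + 1 : ℕ) : ℝ) := by push_cast; linarith [Nat.cast_nonneg (α := ℝ) k]
            simp only [norm_one]; linarith)
    · rcases k with _ | k
      · simp
      · rw [Set.indicator_of_mem (by simp; positivity)]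
        have := (kb (k+1)).1
        have h3 : (1 : ℝ) ≤ ((k + 1 : ℕ) : ℝ) := by push_cast; linarith [Nat.cast_nonneg (α := ℝ) k]
        linarith

lemma enn_sq_sum {ι : Type*} (s : Finset ι) (f : ι → ENNReal) :
    (∑ i ∈ s, f i) ^ 2 ≤ (s.card : ENNReal) * ∑ i ∈ s, f i ^ 2 := by
  have := ENNReal.rpow_sum_le_const_mul_sum_rpow s f (p := 2) (by norm_num)
  have e : (2 : ℝ) - 1 = 1 := by norm_num
  simpa [e] using this

lemma enn_sq_add (a b : ENNReal) : (a + b) ^ 2 ≤ 2 * (a ^ 2 + b ^ 2) := by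
  have := enn_sq_sum (Finset.univ : Finset (Fin 2)) ![a, b]
  simpa using this

lemma enn_four_mul (a b : ENNReal) : 4 * (a * b) ≤ a ^ 2 + 4 * b ^ 2 := by
  by_cases ha : a = ⊤
  · simp [ha]
  by_cases hb : b = ⊤
  · simp [hb]
  lift a to NNReal using ha
  lift b to NNReal using hb
  norm_cast
  rw [← NNReal.coe_le_coe]
  push_cast
  nlinarith [sq_nonneg ((a : ℝ) - 2 * b)]

lemma enn_absorb (x y z : ENNReal) (hx : x ≠ ⊤) (h : 2 * x ≤ x + y + z) : x ≤ y + z := by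
  rw [two_mul, add_assoc] at h
  exact (ENNReal.add_le_add_iff_left hx).mp h

lemma tower {Ω : Type*} (mF : MeasurableSpace Ω) {m0 : MeasurableSpace Ω} {P : Measure Ω}
    [IsProbabilityMeasure P] (hle : mF ≤ m0) {V : Ω → ℝ × ℝ}
    (hV : Measurable V)
    (hind : Indep (MeasurableSpace.comap V inferInstance) mF P) {X : Ω → ℝ} (hX : Measurable[mF] X)
    {Z : Ω → ENNReal} (hZ : Measurable[mF] Z) {g : ℝ × (ℝ × ℝ) → ENNReal} (hg : Measurable g) :
    ∫⁻ ω, Z ω * g (X ω, V ω) ∂P = ∫⁻ ω, Z ω * ∫⁻ p, g (X ω, p) ∂(P.map V) ∂P := by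
  have hY : Measurable[mF] (fun ω => (Z ω, X ω)) := by
    let _ := mF
    exact Measurable.prodMk hZ hX
  have hY0 : Measurable (fun ω => (Z ω, X ω)) := hY.mono hle le_rfl
  have hi : IndepFun (fun ω => (Z ω, X ω)) V P := by
    rw [IndepFun_iff_Indep]
    exact (indep_of_indep_of_le_right hind hY.comap_le).symm
  have hprod := (indepFun_iff_map_prod_eq_prod_map_map hY0.aemeasurable hV.aemeasurable).mp hi
  have : IsProbabilityMeasure (P.map V) := Measure.isProbabilityMeasure_map hV.aemeasurable
  have hG : Measurable (fun q : (ENNReal × ℝ) × (ℝ × ℝ) => q.1.1 * g (q.1.2, q.2)) := by fun_prop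
  have h1 : ∫⁻ ω, Z ω * g (X ω, V ω) ∂P =
      ∫⁻ q, q.1.1 * g (q.1.2, q.2) ∂(P.map (fun ω => ((Z ω, X ω), V ω))) := by
    rw [lintegral_map hG (hY0.prodMk hV)]
  rw [h1, hprod, lintegral_prod _ hG.aemeasurable]
  rw [lintegral_map (Measurable.lintegral_prod_right' hG) hY0]
  refine lintegral_congr fun ω => ?_
  simp only
  rw [lintegral_const_mul _ (by fun_prop)]

section abstract
variable {Ω : Type*} {m0 : MeasurableSpace Ω} {P : Measure Ω}

lemma energy (B f β ρ : ℕ → Ω → ENNReal) (n : ℕ)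
    (hB0 : ∀ ω, B 0 ω = 0) (hBs : ∀ j ω, B (j + 1) ω = B j ω + β j ω) (hf : ∀ j ≤ n, Measurable (f j))
    (hβ : ∀ j < n, Measurable (β j)) (hρ : ∀ j < n, Measurable (ρ j))
    (H : ∀ j < n, ∫⁻ ω, ((B j ω) + B (j + 1) ω) * (f j ω + β j ω) ∂P
      ≤ ∫⁻ ω, ((B j ω) + B (j + 1) ω) * (f (j + 1) ω + ρ j ω) ∂P)
    (hfin : ∫⁻ ω, (B n ω) ^ 2 ∂P ≠ ⊤) :
    ∫⁻ ω, (B n ω) ^ 2 ∂P ≤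
      4 * ∫⁻ ω, (f n ω + ∑ i ∈ Finset.range n, ρ i ω) ^ 2 ∂P := by
  have hB : ∀ j ≤ n, Measurable (B j) := by
    intro j
    induction j with
    | zero =>
      intro _
      rw [show B 0 = fun _ => 0 from funext hB0]
      exact measurable_const
    | succ j ih =>
      intro hj
      rw [show B (j + 1) = fun ω => B j ω + β j ω from funext (hBs j)]
      exact (ih (by omega)).fun_add (hβ j (by omega))
  have hmono : ∀ i j, i ≤ j → ∀ ω, B i ω ≤ B j ω := by
    intro i j hij ω
    induction j, hij using Nat.le_induction with
    | base => exact le_rfl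
    | succ j _ ih => rw [hBs]; exact ih.trans le_self_add
  have key : ∀ j ≤ n, ∫⁻ ω, B j ω ^ 2 ∂P ≤ ∫⁻ ω, 2 * B j ω * f j ω ∂P +
      ∑ i ∈ Finset.range j, ∫⁻ ω, 2 * B n ω * ρ i ω ∂P := by
    intro j
    induction j with
    | zero => intro _; simp [hB0]
    | succ j ih =>
      intro hj
      have ih := ih (by omega)
      have hjn : j < n := by omega
      have mB := hB j (by omega)
      have mB1 := hB (j + 1) hj
      have mf := hf j (by omega)
      have mf1 := hf (j + 1) hj
      have mβ := hβ j hjn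
      have mρ := hρ j hjn
      have e1 : ∀ ω, B (j + 1) ω ^ 2 = B j ω ^ 2 + (B j ω + B (j + 1) ω) * β j ω := by
        intro ω
        simp only [hBs]
        ring
      have mZ : Measurable (fun ω => B j ω + B (j + 1) ω) := mB.fun_add mB1
      have Hj := H j hjn
      simp only [mul_add] at Hj
      rw [lintegral_add_left (mZ.fun_mul mf), lintegral_add_left (mZ.fun_mul mf1)] at Hj
      simp only [e1]
      rw [lintegral_add_left (mB.pow_const 2), Finset.sum_range_succ]
      have s1 : ∫⁻ ω, 2 * B j ω * f j ω ∂P ≤ ∫⁻ ω, (B j ω + B (j + 1) ω) * f j ω ∂P := by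
        refine lintegral_mono fun ω => ?_
        have := hmono j (j + 1) (by omega) ω
        rw [two_mul]
        gcongr
      have s2 : ∫⁻ ω, (B j ω + B (j + 1) ω) * f (j + 1) ω ∂P ≤ ∫⁻ ω, 2 * B (j + 1) ω * f (j + 1) ω ∂P := by
        refine lintegral_mono fun ω => ?_
        have := hmono j (j + 1) (by omega) ω
        rw [two_mul]
        gcongr
      have s3 : ∫⁻ ω, (B j ω + B (j + 1) ω) * ρ j ω ∂P ≤ ∫⁻ ω, 2 * B n ω * ρ j ω ∂P := by
        refine lintegral_mono fun ω => ?_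
        have := hmono j n (by omega) ω
        have := hmono (j + 1) n (by omega) ω
        rw [two_mul]
        gcongr
      set Sg := ∑ i ∈ Finset.range j, ∫⁻ ω, 2 * B n ω * ρ i ω ∂P
      calc ∫⁻ ω, B j ω ^ 2 ∂P + ∫⁻ ω, (B j ω + B (j + 1) ω) * β j ω ∂P
          ≤ (∫⁻ ω, (B j ω + B (j + 1) ω) * f j ω ∂P + Sg) + ∫⁻ ω, (B j ω + B (j + 1) ω) * β j ω ∂P := by
            gcongr; exact ih.trans (by gcongr)
        _ = (∫⁻ ω, (B j ω + B (j + 1) ω) * f j ω ∂P + ∫⁻ ω, (B j ω + B (j + 1) ω) * β j ω ∂P) + Sg := by ring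
        _ ≤ (∫⁻ ω, (B j ω + B (j + 1) ω) * f (j + 1) ω ∂P + ∫⁻ ω, (B j ω + B (j + 1) ω) * ρ j ω ∂P) + Sg := by
            gcongr ?_ + Sg
        _ ≤ (∫⁻ ω, 2 * B (j + 1) ω * f (j + 1) ω ∂P + ∫⁻ ω, 2 * B n ω * ρ j ω ∂P) + Sg := by gcongr
        _ = _ := by ring
  have k := key n le_rfl
  have mBn := hB n le_rfl
  have mρs : Measurable (fun ω => ∑ i ∈ Finset.range n, ρ i ω) :=
    Finset.measurable_fun_sum _ fun i hi => hρ i (Finset.mem_range.mp hi)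
  have e2 : ∫⁻ ω, 2 * B n ω * f n ω ∂P + ∑ i ∈ Finset.range n, ∫⁻ ω, 2 * B n ω * ρ i ω ∂P =
      ∫⁻ ω, 2 * B n ω * (f n ω + ∑ i ∈ Finset.range n, ρ i ω) ∂P := by
    rw [← lintegral_finsetSum _ (fun i hi => (mBn.const_mul 2).fun_mul (hρ i (Finset.mem_range.mp hi))),
      ← lintegral_add_left ((mBn.const_mul 2).fun_mul (hf n le_rfl))]
    refine lintegral_congr fun ω => ?_
    rw [mul_add, Finset.mul_sum]
  rw [e2] at k
  have k2 : 2 * ∫⁻ ω, B n ω ^ 2 ∂P ≤ ∫⁻ ω, B n ω ^ 2 ∂P + 4 * ∫⁻ ω, (f n ω + ∑ i ∈ Finset.range n, ρ i ω) ^ 2 ∂P + 0 := by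
    rw [add_zero]
    calc 2 * ∫⁻ ω, B n ω ^ 2 ∂P ≤ 2 * ∫⁻ ω, 2 * B n ω * (f n ω + ∑ i ∈ Finset.range n, ρ i ω) ∂P := by gcongr
      _ = ∫⁻ ω, 4 * (B n ω * (f n ω + ∑ i ∈ Finset.range n, ρ i ω)) ∂P := by
        rw [← lintegral_const_mul _ ((mBn.const_mul 2).fun_mul ((hf n le_rfl).fun_add mρs))]
        refine lintegral_congr fun ω => ?_
        ring
      _ ≤ ∫⁻ ω, (B n ω ^ 2 + 4 * (f n ω + ∑ i ∈ Finset.range n, ρ i ω) ^ 2) ∂P :=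
        lintegral_mono fun ω => enn_four_mul _ _
      _ = _ := by
        rw [lintegral_add_left (mBn.pow_const 2), lintegral_const_mul _ (((hf n le_rfl).fun_add mρs).pow_const 2)]
  simpa using enn_absorb _ _ _ hfin k2

lemma crossing (B D b : ℕ → Ω → ENNReal) (n : ℕ)
    (hB0 : ∀ ω, B 0 ω = 0) (hBs : ∀ j ω, B (j + 1) ω = B j ω + D j ω) (d : ENNReal) (hd : d ≠ ⊤) [IsProbabilityMeasure P]
    (hD : ∀ j < n, Measurable (D j)) (hb : ∀ j < n, Measurable (b j)) (hDd : ∀ j < n, ∀ ω, D j ω ≤ d)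
    (H : ∀ j < n, ∫⁻ ω, (B j ω) * D j ω ∂P
      ≤ ∫⁻ ω, (B j ω) * b j ω ∂P) :
    ∫⁻ ω, (B n ω) ^ 2 ∂P ≤
      4 * ∫⁻ ω, (∑ i ∈ Finset.range n, b i ω) ^ 2 ∂P + 2 * (n * d ^ 2) := by
  have hB : ∀ j ≤ n, Measurable (B j) := by
    intro j
    induction j with
    | zero =>
      intro _
      rw [show B 0 = fun _ => 0 from funext hB0]
      exact measurable_const
    | succ j ih =>
      intro hj
      rw [show B (j + 1) = fun ω => B j ω + D j ω from funext (hBs j)]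
      exact (ih (by omega)).fun_add (hD j (by omega))
  have hmono : ∀ i j, i ≤ j → ∀ ω, B i ω ≤ B j ω := by
    intro i j hij ω
    induction j, hij using Nat.le_induction with
    | base => exact le_rfl
    | succ j _ ih => rw [hBs]; exact ih.trans le_self_add
  have key : ∀ j ≤ n, ∫⁻ ω, B j ω ^ 2 ∂P ≤
      ∑ i ∈ Finset.range j, ∫⁻ ω, 2 * B n ω * b i ω ∂P + j * d ^ 2 := by
    intro j
    induction j with
    | zero => intro _; simp [hB0]
    | succ j ih =>
      intro hj
      have ih := ih (by omega)
      have hjn : j < n := by omega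
      have mB := hB j (by omega)
      have mD := hD j hjn
      have mb := hb j hjn
      have e1 : ∀ ω, B (j + 1) ω ^ 2 = B j ω ^ 2 + 2 * (B j ω * D j ω) + D j ω ^ 2 := by
        intro ω
        simp only [hBs]
        ring
      have Hj := H j hjn
      simp only [e1]
      rw [lintegral_add_left ((mB.pow_const 2).fun_add ((mB.fun_mul mD).const_mul 2)),
        lintegral_add_left (mB.pow_const 2), lintegral_const_mul _ (mB.fun_mul mD), Finset.sum_range_succ]
      have s1 : 2 * ∫⁻ ω, B j ω * D j ω ∂P ≤ ∫⁻ ω, 2 * B n ω * b j ω ∂P := by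
        calc 2 * ∫⁻ ω, B j ω * D j ω ∂P ≤ 2 * ∫⁻ ω, B j ω * b j ω ∂P := by gcongr 2 * ?_
          _ = ∫⁻ ω, 2 * (B j ω * b j ω) ∂P := (lintegral_const_mul _ (mB.fun_mul mb)).symm
          _ ≤ _ := by
            refine lintegral_mono fun ω => ?_
            have := hmono j n (by omega) ω
            rw [mul_assoc]
            gcongr
      have s2 : ∫⁻ ω, D j ω ^ 2 ∂P ≤ d ^ 2 := by
        calc ∫⁻ ω, D j ω ^ 2 ∂P ≤ ∫⁻ ω, d ^ 2 ∂P := lintegral_mono fun ω => by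
              have := hDd j hjn ω
              gcongr
          _ = _ := by simp
      set Sg := ∑ i ∈ Finset.range j, ∫⁻ ω, 2 * B n ω * b i ω ∂P
      calc _ ≤ (Sg + j * d ^ 2) + ∫⁻ ω, 2 * B n ω * b j ω ∂P + d ^ 2 := by gcongr
        _ = _ := by push_cast; ring
  have k := key n le_rfl
  have mBn := hB n le_rfl
  have mbs : Measurable (fun ω => ∑ i ∈ Finset.range n, b i ω) :=
    Finset.measurable_fun_sum _ fun i hi => hb i (Finset.mem_range.mp hi)
  have e2 : ∑ i ∈ Finset.range n, ∫⁻ ω, 2 * B n ω * b i ω ∂P =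
      ∫⁻ ω, 2 * B n ω * (∑ i ∈ Finset.range n, b i ω) ∂P := by
    rw [← lintegral_finsetSum _ (fun i hi => (mBn.const_mul 2).fun_mul (hb i (Finset.mem_range.mp hi)))]
    refine lintegral_congr fun ω => ?_
    rw [Finset.mul_sum]
  rw [e2] at k
  have hfin : ∫⁻ ω, B n ω ^ 2 ∂P ≠ ⊤ := by
    have hb : ∀ ω, B n ω ^ 2 ≤ (n * d) ^ 2 := by
      intro ω
      have : B n ω ≤ n * d := by
        have : ∀ j ≤ n, B j ω ≤ j * d := by
          intro j
          induction j with
          | zero => intro _; simp [hB0]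
          | succ j ih =>
            intro hj
            rw [hBs]
            have h1 := ih (by omega)
            have h2 := hDd j (by omega) ω
            calc B j ω + D j ω ≤ j * d + d := by gcongr
              _ = _ := by push_cast; ring
        exact this n le_rfl
      gcongr
    have : ∫⁻ ω, B n ω ^ 2 ∂P ≤ (n * d) ^ 2 := (lintegral_mono hb).trans (by simp)
    exact ne_top_of_le_ne_top (by finiteness) this
  have k2 : 2 * ∫⁻ ω, B n ω ^ 2 ∂P ≤ ∫⁻ ω, B n ω ^ 2 ∂P + 4 * ∫⁻ ω, (∑ i ∈ Finset.range n, b i ω) ^ 2 ∂P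
      + 2 * (n * d ^ 2) := by
    calc 2 * ∫⁻ ω, B n ω ^ 2 ∂P ≤ 2 * (∫⁻ ω, 2 * B n ω * (∑ i ∈ Finset.range n, b i ω) ∂P + n * d ^ 2) := by gcongr
      _ = ∫⁻ ω, 4 * (B n ω * (∑ i ∈ Finset.range n, b i ω)) ∂P + 2 * (n * d ^ 2) := by
        rw [mul_add, ← lintegral_const_mul _ ((mBn.const_mul 2).fun_mul mbs)]
        congr 1
        refine lintegral_congr fun ω => ?_
        ring
      _ ≤ ∫⁻ ω, (B n ω ^ 2 + 4 * (∑ i ∈ Finset.range n, b i ω) ^ 2) ∂P + 2 * (n * d ^ 2) := by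
        gcongr; exact enn_four_mul _ _
      _ = _ := by
        rw [lintegral_add_left (mBn.pow_const 2), lintegral_const_mul _ (mbs.pow_const 2)]
  exact enn_absorb _ _ _ hfin k2
end abstract

/-- The Euler chain: adapted grid values with independent increments. -/
structure EMChain {Ω : Type*} {m0 : MeasurableSpace Ω} (P : Measure Ω) (n : ℕ) (δ M ξ : ℝ)
    (μ σ ρ : ℝ → ℝ) (X : ℕ → Ω → ℝ) (G : ℕ → MeasurableSpace Ω) (V : ℝ → ℕ → Ω → ℝ × ℝ) : Prop where
  le : ∀ j ≤ n, G j ≤ m0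
  mono : ∀ i j, i ≤ j → j ≤ n → G i ≤ G j
  hX : ∀ j ≤ n, Measurable[G j] (X j)
  hV : ∀ r ∈ Set.Icc (0:ℝ) 1, ∀ j < n, Measurable[G (j + 1)] (V r j)
  ind : ∀ r ∈ Set.Icc (0:ℝ) 1, ∀ j < n, Indep (MeasurableSpace.comap (V r j) inferInstance) (G j) P
  law : ∀ r ∈ Set.Icc (0:ℝ) 1, ∀ j < n, StepLaw (P.map (V r j)) M (r * δ)
  init : ∀ ω, X 0 ω = ξ
  step : ∀ j < n, ∀ ω, X (j + 1) ω = X j ω + Hs μ σ ρ δ (X j ω) (V 1 j ω)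

namespace EMChain
variable {Ω : Type*} {m0 : MeasurableSpace Ω} {P : Measure Ω} [IsProbabilityMeasure P] {n : ℕ} {δ M ξ : ℝ}
    {μ σ ρ : ℝ → ℝ} {X : ℕ → Ω → ℝ} {G : ℕ → MeasurableSpace Ω} {V : ℝ → ℕ → Ω → ℝ × ℝ}

lemma X0 (E : EMChain P n δ M ξ μ σ ρ X G V) (j : ℕ) (hj : j ≤ n) : Measurable (X j) :=
  (E.hX j hj).mono (E.le j hj) le_rfl

lemma V0 (E : EMChain P n δ M ξ μ σ ρ X G V) (r : ℝ) (hr : r ∈ Set.Icc (0:ℝ) 1) (j : ℕ) (hj : j < n) :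
    Measurable (V r j) :=
  (E.hV r hr j hj).mono (E.le (j + 1) (by omega)) le_rfl

lemma tow (E : EMChain P n δ M ξ μ σ ρ X G V) (r : ℝ) (hr : r ∈ Set.Icc (0:ℝ) 1) (j : ℕ) (hj : j < n)
    {Z : Ω → ENNReal} (hZ : Measurable[G j] Z) {g : ℝ × (ℝ × ℝ) → ENNReal} (hg : Measurable g) :
    ∫⁻ ω, Z ω * g (X j ω, V r j ω) ∂P = ∫⁻ ω, Z ω * ∫⁻ p, g (X j ω, p) ∂(P.map (V r j)) ∂P :=
  tower (G j) (E.le j (by omega)) (E.V0 r hr j hj) (E.ind r hr j hj) (E.hX j (by omega)) hZ hg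

lemma tow1 (E : EMChain P n δ M ξ μ σ ρ X G V) (r : ℝ) (hr : r ∈ Set.Icc (0:ℝ) 1) (j : ℕ) (hj : j < n)
    {g : ℝ × (ℝ × ℝ) → ENNReal} (hg : Measurable g) :
    ∫⁻ ω, g (X j ω, V r j ω) ∂P = ∫⁻ ω, ∫⁻ p, g (X j ω, p) ∂(P.map (V r j)) ∂P := by
  have := E.tow r hr j hj (Z := fun _ => 1) (@measurable_const _ _ _ (G j) 1) hg
  simpa using this

/-- growth hypotheses -/
structure Growth (μ σ ρ : ℝ → ℝ) (K : ℝ) : Prop where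
  hK : 0 ≤ K
  mμ : Measurable μ
  mσ : Measurable σ
  mρ : Measurable ρ
  hμ : ∀ x, |μ x| ≤ K * (1 + |x|)
  hσ : ∀ x, |σ x| ≤ K * (1 + |x|)
  hρ : ∀ x, |ρ x| ≤ K * (1 + |x|)

lemma one_mem : (1 : ℝ) ∈ Set.Icc (0:ℝ) 1 := by simp

lemma law1 (E : EMChain P n δ M ξ μ σ ρ X G V) (j : ℕ) (hj : j < n) :
    StepLaw (P.map (V 1 j)) M δ := by simpa using E.law 1 one_mem j hj

lemma moment (E : EMChain P n δ M ξ μ σ ρ X G V) {K : ℝ} (g : Growth μ σ ρ K) (hM : 0 ≤ M)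
    (h0 : 0 < δ) (h1 : δ ≤ 1) {T : ℝ} (hT : n * δ = T) (j : ℕ) (hj : j ≤ n) :
    ∫⁻ ω, ENNReal.ofReal (1 + X j ω ^ 4) ∂P ≤ ENNReal.ofReal
      (Real.exp (8 * (4 * K * (1 + M) + 24 * K ^ 2 * (2 + M) + 81 * K ^ 4 * (1 + 2 * M)) * T) * (1 + ξ ^ 4)) := by
  set D := 8 * (4 * K * (1 + M) + 24 * K ^ 2 * (2 + M) + 81 * K ^ 4 * (1 + 2 * M)) with hD
  have hK := g.hK
  have hD0 : 0 ≤ D := by positivity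
  have key : ∀ j ≤ n, ∫⁻ ω, ENNReal.ofReal (1 + X j ω ^ 4) ∂P ≤ ENNReal.ofReal ((1 + D * δ) ^ j * (1 + ξ ^ 4)) := by
    intro j
    induction j with
    | zero => intro _; simp [E.init]
    | succ j ih =>
      intro hj
      have ih := ih (by omega)
      have hHs := Hs_meas μ σ ρ g.mμ g.mσ g.mρ δ
      have t := E.tow1 1 one_mem j (by omega)
        (g := fun q => ENNReal.ofReal (1 + (q.1 + Hs μ σ ρ δ q.1 q.2) ^ 4)) (by fun_prop)
      calc ∫⁻ ω, ENNReal.ofReal (1 + X (j + 1) ω ^ 4) ∂P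
          = ∫⁻ ω, ENNReal.ofReal (1 + (X j ω + Hs μ σ ρ δ (X j ω) (V 1 j ω)) ^ 4) ∂P := by
            refine lintegral_congr fun ω => ?_
            rw [E.step j (by omega)]
        _ = _ := t
        _ ≤ ∫⁻ ω, ENNReal.ofReal ((1 + D * δ) * (1 + X j ω ^ 4)) ∂P :=
            lintegral_mono fun ω => law_moment (E.law1 j (by omega)) hM h0.le h1 hK g.hμ g.hσ g.hρ (X j ω)
        _ = ENNReal.ofReal (1 + D * δ) * ∫⁻ ω, ENNReal.ofReal (1 + X j ω ^ 4) ∂P := by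
            have := E.X0 j (by omega)
            rw [← lintegral_const_mul _ (by fun_prop)]
            refine lintegral_congr fun ω => ?_
            rw [ENNReal.ofReal_mul (by positivity)]
        _ ≤ ENNReal.ofReal (1 + D * δ) * ENNReal.ofReal ((1 + D * δ) ^ j * (1 + ξ ^ 4)) := by gcongr
        _ = _ := by rw [← ENNReal.ofReal_mul (by positivity)]; congr 1; ring
  refine (key j hj).trans (ENNReal.ofReal_le_ofReal ?_)
  gcongr
  have hD1 : 1 + D * δ ≤ Real.exp (D * δ) := by linarith [Real.add_one_le_exp (D * δ)]
  calc (1 + D * δ) ^ j ≤ Real.exp (D * δ) ^ j := by gcongr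
    _ = Real.exp (D * (j * δ)) := by rw [← Real.exp_nat_mul]; congr 1; ring
    _ ≤ Real.exp (D * T) := by
      rw [← hT]
      have : (j : ℝ) ≤ n := by exact_mod_cast hj
      gcongr

lemma int_le (Y : Ω → ℝ) (hY : Measurable Y) (A c : ℝ) (hc : 0 ≤ c)
    (hA : ∫⁻ ω, ENNReal.ofReal (1 + Y ω ^ 4) ∂P ≤ ENNReal.ofReal A) (F : Ω → ENNReal)
    (hF : ∀ ω, F ω ≤ ENNReal.ofReal (c * (1 + Y ω ^ 4))) : ∫⁻ ω, F ω ∂P ≤ ENNReal.ofReal (c * A) := by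
  calc ∫⁻ ω, F ω ∂P ≤ ∫⁻ ω, ENNReal.ofReal c * ENNReal.ofReal (1 + Y ω ^ 4) ∂P :=
        lintegral_mono fun ω => by rw [← ENNReal.ofReal_mul hc]; exact hF ω
    _ = ENNReal.ofReal c * ∫⁻ ω, ENNReal.ofReal (1 + Y ω ^ 4) ∂P := lintegral_const_mul _ (by fun_prop)
    _ ≤ ENNReal.ofReal c * ENNReal.ofReal A := by gcongr
    _ = _ := (ENNReal.ofReal_mul hc).symm

lemma sum_sq_le (a : ℕ → Ω → ENNReal) (ha : ∀ j < n, Measurable (a j)) (c : ℝ) (hc : 0 ≤ c)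
    (hb : ∀ j < n, ∫⁻ ω, a j ω ^ 2 ∂P ≤ ENNReal.ofReal c) :
    ∫⁻ ω, (∑ j ∈ Finset.range n, a j ω) ^ 2 ∂P ≤ ENNReal.ofReal ((n : ℝ) ^ 2 * c) := by
  calc ∫⁻ ω, (∑ j ∈ Finset.range n, a j ω) ^ 2 ∂P
      ≤ ∫⁻ ω, (n : ENNReal) * ∑ j ∈ Finset.range n, a j ω ^ 2 ∂P := lintegral_mono fun ω => by
        simpa using enn_sq_sum (Finset.range n) (fun j => a j ω)
    _ = n * ∑ j ∈ Finset.range n, ∫⁻ ω, a j ω ^ 2 ∂P := by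
      have hm : ∀ j ∈ Finset.range n, Measurable (fun ω => a j ω ^ 2) := fun j hj =>
        (ha j (Finset.mem_range.mp hj)).pow_const 2
      rw [lintegral_const_mul _ (Finset.measurable_fun_sum _ hm), lintegral_finsetSum _ hm]
    _ ≤ n * ∑ j ∈ Finset.range n, ENNReal.ofReal c := by
      gcongr with j hj; exact hb j (Finset.mem_range.mp hj)
    _ = _ := by
      rw [ENNReal.ofReal_mul (by positivity), ENNReal.ofReal_pow (by positivity), ENNReal.ofReal_natCast]
      simp only [Finset.sum_const, Finset.card_range, nsmul_eq_mul]
      ring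

lemma wL_le (a z η x : ℝ) (ha : 0 < a) : wL a z η x ≤ a / Real.sqrt a ^ 3 := by
  have hs : 0 < Real.sqrt a := Real.sqrt_pos.mpr ha
  unfold wL
  split_ifs
  · unfold wA
    gcongr
    unfold fA
    exact Real.sqrt_le_sqrt (by nlinarith [sq_nonneg (x - z)])
  · positivity

lemma occ (E : EMChain P n δ M ξ μ σ ρ X G V) {K : ℝ} (g : Growth μ σ ρ K) (hM : 0 ≤ M)
    (h0 : 0 < δ) (h1 : δ ≤ 1) {T : ℝ} (hT : n * δ = T) (A : ℝ) (hA0 : 0 ≤ A)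
    (hA : ∀ j ≤ n, ∫⁻ ω, ENNReal.ofReal (1 + X j ω ^ 4) ∂P ≤ ENNReal.ofReal A)
    (z η Kz : ℝ) (hσ : ∀ x, |x - z| ≤ η → |σ x| ≤ Kz) (s0 : ℝ) (hs0 : 0 < s0)
    (hσ0 : ∀ x, |x - z| ≤ η → s0 ≤ σ x ^ 2)
    (κ : ℝ) (hκ : 1 ≤ κ) (hκ2 : 2 * Kz ^ 2 * M ≤ κ) :
    ∫⁻ ω, (∑ j ∈ Finset.range n, ENNReal.ofReal (wL (κ * δ) z η (X j ω) * δ)) ^ 2 ∂P ≤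
      ENNReal.ofReal (4 * (2 * ((8 / s0) ^ 2 * (κ + 2 * z ^ 2 + 2) * A
        + T ^ 2 * ((8 / s0) ^ 2 * (K * (1 + M)) ^ 2 * 4 * A)))) := by
  have hK := g.hK
  have ha0 : 0 < κ * δ := by positivity
  set c := 8 / s0 with hc
  have hc0 : 0 < c := by positivity
  have mX := E.X0
  have mfA := fA_meas (κ * δ)
  have mwL := wL_meas (κ * δ) z η
  set f : ℕ → Ω → ENNReal := fun j ω => ENNReal.ofReal (c * fA (κ * δ) (X j ω - z)) with hf
  set β : ℕ → Ω → ENNReal := fun j ω => ENNReal.ofReal (wL (κ * δ) z η (X j ω) * δ) with hβ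
  set rr : ℕ → Ω → ENNReal := fun j ω => ENNReal.ofReal (c * (K * (1 + M) * (1 + |X j ω|) * δ)) with hrr
  have mf : ∀ j ≤ n, Measurable (f j) := fun j hj => by
    have := mX j hj
    simp only [hf]; fun_prop
  have mβ' : ∀ i j, i ≤ j → j ≤ n → Measurable[G j] (β i) := fun i j hij hj => by
    have hX : Measurable[G j] (X i) := (E.hX i (hij.trans hj)).mono (E.mono i j hij hj) le_rfl
    have : Measurable (fun x : ℝ => ENNReal.ofReal (wL (κ * δ) z η x * δ)) := by fun_prop
    exact this.comp hX
  have mβ : ∀ j < n, Measurable (β j) := fun j hj => (mβ' j j le_rfl hj.le).mono (E.le j hj.le) le_rfl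
  have mrr : ∀ j < n, Measurable (rr j) := fun j hj => by
    have := mX j hj.le
    simp only [hrr]; fun_prop
  have hen := energy (P := P) (fun j ω => ∑ i ∈ Finset.range j, β i ω) f β rr n (by simp)
    (fun j ω => Finset.sum_range_succ _ _) mf mβ mrr ?_ ?_
  · refine hen.trans ?_
    have b1 : ∫⁻ ω, f n ω ^ 2 ∂P ≤ ENNReal.ofReal (c ^ 2 * (κ + 2 * z ^ 2 + 2) * A) := by
      refine int_le (X n) (mX n le_rfl) A _ (by positivity) (hA n le_rfl) _ fun ω => ?_
      simp only [hf]
      have := fA_pos (κ * δ) (X n ω - z) ha0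
      rw [← ENNReal.ofReal_pow (by positivity), mul_pow, fA_sq _ _ ha0]
      refine ENNReal.ofReal_le_ofReal ?_
      rw [mul_assoc]
      gcongr
      set x := X n ω
      have e1 : κ * δ ≤ κ := by nlinarith
      have e2 : (x - z) ^ 2 ≤ 2 * x ^ 2 + 2 * z ^ 2 := by nlinarith [sq_nonneg (x + z)]
      have e3 : x ^ 2 ≤ 1 + x ^ 4 := by nlinarith [sq_nonneg (x ^ 2 - 1)]
      have e4 : 0 ≤ (κ + 2 * z ^ 2) * x ^ 4 := by positivity
      nlinarith
    have b2 : ∫⁻ ω, (∑ i ∈ Finset.range n, rr i ω) ^ 2 ∂P ≤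
        ENNReal.ofReal (T ^ 2 * (c ^ 2 * (K * (1 + M)) ^ 2 * 4 * A)) := by
      have := sum_sq_le (P := P) (n := n) rr mrr (c ^ 2 * (K * (1 + M)) ^ 2 * δ ^ 2 * 4 * A) (by positivity) ?_
      · refine this.trans (le_of_eq ?_)
        rw [← hT]; congr 1; ring
      · intro j hj
        refine int_le (X j) (mX j hj.le) A _ (by positivity) (hA j hj.le) _ fun ω => ?_
        simp only [hrr]
        rw [← ENNReal.ofReal_pow (by positivity)]
        refine ENNReal.ofReal_le_ofReal ?_
        set x := X j ω
        have e : (1 + |x|) ^ 2 ≤ 4 * (1 + x ^ 4) := by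
          nlinarith [sq_nonneg (|x| - 1), sq_nonneg (x ^ 2 - 1), sq_abs x]
        calc (c * (K * (1 + M) * (1 + |x|) * δ)) ^ 2 = c ^ 2 * (K * (1 + M)) ^ 2 * δ ^ 2 * (1 + |x|) ^ 2 := by ring
          _ ≤ c ^ 2 * (K * (1 + M)) ^ 2 * δ ^ 2 * (4 * (1 + x ^ 4)) := by gcongr
          _ = _ := by ring
    calc 4 * ∫⁻ ω, (f n ω + ∑ i ∈ Finset.range n, rr i ω) ^ 2 ∂P
        ≤ 4 * ∫⁻ ω, 2 * (f n ω ^ 2 + (∑ i ∈ Finset.range n, rr i ω) ^ 2) ∂P := by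
          gcongr; exact enn_sq_add _ _
      _ = 4 * (2 * (∫⁻ ω, f n ω ^ 2 ∂P + ∫⁻ ω, (∑ i ∈ Finset.range n, rr i ω) ^ 2 ∂P)) := by
          have m1 := (mf n le_rfl).pow_const 2
          have m2 : Measurable (fun ω => (∑ i ∈ Finset.range n, rr i ω) ^ 2) :=
            (Finset.measurable_fun_sum _ fun i hi => mrr i (Finset.mem_range.mp hi)).pow_const 2
          rw [lintegral_const_mul _ (m1.fun_add m2), lintegral_add_left m1]
      _ ≤ 4 * (2 * (ENNReal.ofReal (c ^ 2 * (κ + 2 * z ^ 2 + 2) * A) +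
            ENNReal.ofReal (T ^ 2 * (c ^ 2 * (K * (1 + M)) ^ 2 * 4 * A)))) := by gcongr
      _ = _ := by
          rw [← ENNReal.ofReal_add (by positivity) (by positivity), ENNReal.ofReal_mul (by norm_num),
            ENNReal.ofReal_mul (by norm_num)]
          simp
  · intro j hj
    have mZ : Measurable[G j] (fun ω => ((∑ i ∈ Finset.range j, β i ω) + ∑ i ∈ Finset.range (j + 1), β i ω)
        * ENNReal.ofReal c) := by
      refine @Measurable.mul_const _ _ _ _ (G j) _ _ ?_ _
      refine @Measurable.fun_add _ _ _ _ (G j) _ _ _ ?_ ?_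
      · exact @Finset.measurable_fun_sum _ _ _ _ _ _ (G j) _ _ fun i hi =>
          mβ' i j (Finset.mem_range.mp hi).le hj.le
      · exact @Finset.measurable_fun_sum _ _ _ _ _ _ (G j) _ _ fun i hi =>
          mβ' i j (Nat.lt_succ_iff.mp (Finset.mem_range.mp hi)) hj.le
    have hHs := Hs_meas μ σ ρ g.mμ g.mσ g.mρ δ
    have t := E.tow 1 one_mem j hj mZ (g := fun q => ENNReal.ofReal
      (fA (κ * δ) (q.1 + Hs μ σ ρ δ q.1 q.2 - z) + K * (1 + M) * (1 + |q.1|) * δ)) (by fun_prop)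
    have e1 : ∀ ω, ((∑ i ∈ Finset.range j, β i ω) + ∑ i ∈ Finset.range (j + 1), β i ω) * (f (j + 1) ω + rr j ω)
        = ((∑ i ∈ Finset.range j, β i ω) + ∑ i ∈ Finset.range (j + 1), β i ω) * ENNReal.ofReal c *
          ENNReal.ofReal (fA (κ * δ) (X j ω + Hs μ σ ρ δ (X j ω) (V 1 j ω) - z) + K * (1 + M) * (1 + |X j ω|) * δ) := by
      intro ω
      have := fA_pos (κ * δ) (X (j + 1) ω - z) ha0
      rw [mul_assoc]
      congr 1
      simp only [hf, hrr]
      rw [← ENNReal.ofReal_add (by positivity) (by positivity), ← ENNReal.ofReal_mul hc0.le, ← E.step j hj]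
      congr 1; ring
    simp only [e1]
    rw [t]
    refine lintegral_mono fun ω => ?_
    have d := law_drift (E.law1 j hj) hM h0 g.hμ g.hρ hK z η Kz hσ s0 hs0 hσ0 κ hκ hκ2 (X j ω)
    have e2 : f j ω + β j ω = ENNReal.ofReal c *
        ENNReal.ofReal (fA (κ * δ) (X j ω - z) + s0 / 8 * wL (κ * δ) z η (X j ω) * δ) := by
      have := fA_pos (κ * δ) (X j ω - z) ha0
      have := wL_nonneg (κ * δ) z η (X j ω) ha0
      simp only [hf, hβ]
      rw [← ENNReal.ofReal_add (by positivity) (by positivity), ← ENNReal.ofReal_mul hc0.le]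
      congr 1
      rw [hc]; field_simp
    change _ * (f j ω + β j ω) ≤ _
    rw [e2, ← mul_assoc]
    gcongr
  · have hb : ∀ ω, (∑ i ∈ Finset.range n, β i ω) ^ 2 ≤
        (n * ENNReal.ofReal (κ * δ / Real.sqrt (κ * δ) ^ 3 * δ)) ^ 2 := by
      intro ω
      have : ∑ i ∈ Finset.range n, β i ω ≤ n * ENNReal.ofReal (κ * δ / Real.sqrt (κ * δ) ^ 3 * δ) := by
        calc ∑ i ∈ Finset.range n, β i ω ≤ ∑ i ∈ Finset.range n, ENNReal.ofReal (κ * δ / Real.sqrt (κ * δ) ^ 3 * δ) := by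
              refine Finset.sum_le_sum fun i _ => ENNReal.ofReal_le_ofReal ?_
              have := wL_le (κ * δ) z η (X i ω) ha0
              gcongr
          _ = _ := by simp
      gcongr
    have : ∫⁻ ω, (∑ i ∈ Finset.range n, β i ω) ^ 2 ∂P ≤
        (n * ENNReal.ofReal (κ * δ / Real.sqrt (κ * δ) ^ 3 * δ)) ^ 2 := (lintegral_mono hb).trans (by simp)
    exact ne_top_of_le_ne_top (by finiteness) this

lemma cross (E : EMChain P n δ M ξ μ σ ρ X G V) {K : ℝ} (g : Growth μ σ ρ K) (hM : 0 ≤ M)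
    (h0 : 0 < δ) (h1 : δ ≤ 1) {T : ℝ} (hT : n * δ = T) (Co : ℝ) (hCo0 : 0 ≤ Co)
    (z η Kz : ℝ) (hμ : ∀ x, |x - z| ≤ η → |μ x| ≤ Kz) (hσ : ∀ x, |x - z| ≤ η → |σ x| ≤ Kz)
    (κ : ℝ) (hκ : 1 ≤ κ)
    (hCo : ∫⁻ ω, (∑ j ∈ Finset.range n, ENNReal.ofReal (wL (κ * δ) z η (X j ω) * δ)) ^ 2 ∂P ≤ ENNReal.ofReal Co)
    (r : ℝ) (hr : r ∈ Set.Icc (0:ℝ) 1) :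
    ∫⁻ ω, (∑ j ∈ Finset.range n, ENNReal.ofReal (δ * if |X j ω - z| ≤ η ∧
        |X j ω - z| ≤ |Hs μ σ ρ (r * δ) (X j ω) (V r j ω)| then 1 else 0)) ^ 2 ∂P ≤
      ENNReal.ofReal ((8 * ((2 + 16 * Kz ^ 4 * (1 + M)) * Real.sqrt κ) ^ 2 * Co + 8 * T ^ 2 * M ^ 2 + 2 * T) * δ) := by
  have ha0 : 0 < κ * δ := by positivity
  have mX := E.X0
  have mwL := wL_meas (κ * δ) z η
  have hHs := Hs_meas μ σ ρ g.mμ g.mσ g.mρ (r * δ)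
  set C' := (2 + 16 * Kz ^ 4 * (1 + M)) * Real.sqrt κ with hC'
  have hC'0 : 0 ≤ C' := by positivity
  have hT0 : 0 ≤ T := by rw [← hT]; positivity
  set gg : ℝ × (ℝ × ℝ) → ENNReal := fun q => ENNReal.ofReal (if |q.1 - z| ≤ η ∧
        |q.1 - z| ≤ |Hs μ σ ρ (r * δ) q.1 q.2| then 1 else 0) with hgg
  have mgg : Measurable gg := by
    refine ENNReal.measurable_ofReal.comp (Measurable.ite ?_ measurable_const measurable_const)
    have s1 : MeasurableSet {q : ℝ × (ℝ × ℝ) | |q.1 - z| ≤ η} := measurableSet_le (by fun_prop) measurable_const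
    have s2 : MeasurableSet {q : ℝ × (ℝ × ℝ) | |q.1 - z| ≤ |Hs μ σ ρ (r * δ) q.1 q.2|} :=
      measurableSet_le (by fun_prop) hHs.abs
    exact s1.inter s2
  have hDe : ∀ j ω, ENNReal.ofReal (δ * if |X j ω - z| ≤ η ∧
        |X j ω - z| ≤ |Hs μ σ ρ (r * δ) (X j ω) (V r j ω)| then 1 else 0) = ENNReal.ofReal δ * gg (X j ω, V r j ω) := by
    intro j ω
    rw [ENNReal.ofReal_mul h0.le]
  simp only [hDe]
  set D : ℕ → Ω → ENNReal := fun j ω => ENNReal.ofReal δ * gg (X j ω, V r j ω) with hD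
  set b : ℕ → Ω → ENNReal := fun j ω => ENNReal.ofReal δ *
    ENNReal.ofReal (C' * Real.sqrt δ * wL (κ * δ) z η (X j ω) + M * δ) with hb
  have mD' : ∀ i j, i < j → j ≤ n → Measurable[G j] (D i) := fun i j hij hj => by
    have hX : Measurable[G j] (X i) := (E.hX i (by omega)).mono (E.mono i j hij.le hj) le_rfl
    have hV : Measurable[G j] (V r i) := (E.hV r hr i (by omega)).mono (E.mono (i + 1) j hij hj) le_rfl
    have : Measurable (fun q => ENNReal.ofReal δ * gg q) := by fun_prop
    exact this.comp (by
      let _ := G j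
      exact hX.prodMk hV)
  have mD : ∀ j < n, Measurable (D j) := fun j hj =>
    (mD' j (j + 1) (by omega) hj).mono (E.le (j + 1) hj) le_rfl
  have mb : ∀ j < n, Measurable (b j) := fun j hj => by
    have := mX j hj.le
    simp only [hb]; fun_prop
  have hcr := crossing (P := P) (fun j ω => ∑ i ∈ Finset.range j, D i ω) D b n (by simp)
    (fun j ω => Finset.sum_range_succ _ _) (ENNReal.ofReal δ) ENNReal.ofReal_ne_top mD mb ?_ ?_
  · refine hcr.trans ?_
    have hbs : ∀ ω, ∑ i ∈ Finset.range n, b i ω = ENNReal.ofReal (C' * Real.sqrt δ) *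
        (∑ j ∈ Finset.range n, ENNReal.ofReal (wL (κ * δ) z η (X j ω) * δ)) + ENNReal.ofReal (T * M * δ) := by
      intro ω
      have : ∀ i, b i ω = ENNReal.ofReal (C' * Real.sqrt δ) * ENNReal.ofReal (wL (κ * δ) z η (X i ω) * δ)
          + ENNReal.ofReal (M * δ * δ) := by
        intro i
        have := wL_nonneg (κ * δ) z η (X i ω) ha0
        simp only [hb]
        rw [← ENNReal.ofReal_mul h0.le, ← ENNReal.ofReal_mul (by positivity),
          ← ENNReal.ofReal_add (by positivity) (by positivity)]
        congr 1; ring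
      simp only [this]
      rw [Finset.sum_add_distrib, ← Finset.mul_sum]
      congr 1
      rw [Finset.sum_const, Finset.card_range, nsmul_eq_mul, ← ENNReal.ofReal_natCast,
        ← ENNReal.ofReal_mul (by positivity), ← hT]
      congr 1; ring
    have mS : Measurable (fun ω => ∑ j ∈ Finset.range n, ENNReal.ofReal (wL (κ * δ) z η (X j ω) * δ)) := by
      refine Finset.measurable_fun_sum _ fun i hi => ?_
      have := mX i (Finset.mem_range.mp hi).le
      fun_prop
    have b1 : ∫⁻ ω, (∑ i ∈ Finset.range n, b i ω) ^ 2 ∂P ≤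
        ENNReal.ofReal (2 * (C' ^ 2 * δ * Co + (T * M * δ) ^ 2)) := by
      simp only [hbs]
      calc _ ≤ ∫⁻ ω, 2 * ((ENNReal.ofReal (C' * Real.sqrt δ) *
        (∑ j ∈ Finset.range n, ENNReal.ofReal (wL (κ * δ) z η (X j ω) * δ))) ^ 2 + ENNReal.ofReal (T * M * δ) ^ 2) ∂P :=
            lintegral_mono fun ω => enn_sq_add _ _
        _ = 2 * (ENNReal.ofReal (C' * Real.sqrt δ) ^ 2 *
            (∫⁻ ω, (∑ j ∈ Finset.range n, ENNReal.ofReal (wL (κ * δ) z η (X j ω) * δ)) ^ 2 ∂P)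
            + ENNReal.ofReal (T * M * δ) ^ 2) := by
          rw [lintegral_const_mul _ (by fun_prop), lintegral_add_right _ measurable_const]
          simp only [mul_pow]
          rw [lintegral_const_mul _ (by fun_prop)]
          simp
        _ ≤ 2 * (ENNReal.ofReal (C' * Real.sqrt δ) ^ 2 * ENNReal.ofReal Co + ENNReal.ofReal (T * M * δ) ^ 2) := by
          gcongr
        _ = _ := by
          rw [← ENNReal.ofReal_pow (by positivity), ← ENNReal.ofReal_pow (by positivity),
            ← ENNReal.ofReal_mul (by positivity), ← ENNReal.ofReal_add (by positivity) (by positivity),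
            ENNReal.ofReal_mul (p := 2) (by norm_num), mul_pow, Real.sq_sqrt h0.le]
          simp
    calc 4 * ∫⁻ ω, (∑ i ∈ Finset.range n, b i ω) ^ 2 ∂P + 2 * (n * ENNReal.ofReal δ ^ 2)
        ≤ 4 * ENNReal.ofReal (2 * (C' ^ 2 * δ * Co + (T * M * δ) ^ 2)) + 2 * (n * ENNReal.ofReal δ ^ 2) := by gcongr
      _ = ENNReal.ofReal (4 * (2 * (C' ^ 2 * δ * Co + (T * M * δ) ^ 2)) + 2 * (n * δ ^ 2)) := by
        rw [ENNReal.ofReal_add (by positivity) (by positivity), ENNReal.ofReal_mul (p := 4) (by norm_num),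
          ENNReal.ofReal_mul (p := 2) (q := n * δ ^ 2) (by norm_num), ENNReal.ofReal_mul (p := n) (by positivity),
          ENNReal.ofReal_pow h0.le]
        simp
      _ ≤ _ := by
        refine ENNReal.ofReal_le_ofReal ?_
        have e : (n : ℝ) * δ ^ 2 = T * δ := by rw [← hT]; ring
        rw [e]
        have : δ ^ 2 ≤ δ := by nlinarith
        have : (T * M * δ) ^ 2 ≤ T ^ 2 * M ^ 2 * δ := by
          calc (T * M * δ) ^ 2 = T ^ 2 * M ^ 2 * δ ^ 2 := by ring
            _ ≤ _ := by gcongr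
        nlinarith
  · intro j _ ω
    simp only [hD, hgg]
    calc _ ≤ ENNReal.ofReal δ * 1 := by
          gcongr
          split_ifs <;> simp
      _ = _ := mul_one _
  · intro j hj
    have mZ : Measurable[G j] (fun ω => (∑ i ∈ Finset.range j, D i ω) * ENNReal.ofReal δ) := by
      refine @Measurable.mul_const _ _ _ _ (G j) _ _ ?_ _
      exact @Finset.measurable_fun_sum _ _ _ _ _ _ (G j) _ _ fun i hi =>
          mD' i j (Finset.mem_range.mp hi) hj.le
    have t := E.tow r hr j hj mZ mgg
    simp only [hD, hb, ← mul_assoc]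
    simp only [hD] at t
    rw [t]
    refine lintegral_mono fun ω => ?_
    gcongr
    exact law_cross (E.law r hr j hj) hM (mul_nonneg hr.1 h0.le) δ (by nlinarith [hr.2]) h1 h0 z η Kz hμ hσ κ hκ (X j ω)

lemma lip (E : EMChain P n δ M ξ μ σ ρ X G V) {K : ℝ} (g : Growth μ σ ρ K) (hM : 0 ≤ M)
    (h0 : 0 < δ) (h1 : δ ≤ 1) {T : ℝ} (hT : n * δ = T) (A : ℝ) (hA0 : 0 ≤ A)
    (hA : ∀ j ≤ n, ∫⁻ ω, ENNReal.ofReal (1 + X j ω ^ 4) ∂P ≤ ENNReal.ofReal A)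
    (r : ℝ) (hr : r ∈ Set.Icc (0:ℝ) 1) :
    ∫⁻ ω, (∑ j ∈ Finset.range n, ENNReal.ofReal (δ * ((1 + |X j ω|) *
        |Hs μ σ ρ (r * δ) (X j ω) (V r j ω)|))) ^ 2 ∂P ≤
      ENNReal.ofReal (T ^ 2 * (24 * K ^ 2 * (2 + M)) * A * δ) := by
  have hHs := Hs_meas μ σ ρ g.mμ g.mσ g.mρ (r * δ)
  have hK := g.hK
  have key := sum_sq_le (P := P) (n := n) (fun j ω => ENNReal.ofReal (δ * ((1 + |X j ω|) *
        |Hs μ σ ρ (r * δ) (X j ω) (V r j ω)|))) ?_ (δ ^ 2 * (24 * K ^ 2 * (2 + M) * δ) * A) (by positivity) ?_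
  · refine key.trans (le_of_eq ?_)
    rw [← hT]; congr 1; ring
  · intro j hj
    have a := E.X0 j hj.le
    have b := E.V0 r hr j hj
    have : Measurable (fun q : ℝ × (ℝ × ℝ) => ENNReal.ofReal (δ * ((1 + |q.1|) *
        |Hs μ σ ρ (r * δ) q.1 q.2|))) := by fun_prop
    exact this.comp (a.prodMk b)
  · intro j hj
    have t := E.tow1 r hr j hj (g := fun q => ENNReal.ofReal (δ ^ 2) * ENNReal.ofReal (((1 + |q.1|) *
        |Hs μ σ ρ (r * δ) q.1 q.2|) ^ 2)) (by fun_prop)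
    have e : ∀ ω, ENNReal.ofReal (δ * ((1 + |X j ω|) * |Hs μ σ ρ (r * δ) (X j ω) (V r j ω)|)) ^ 2 =
      ENNReal.ofReal (δ ^ 2) * ENNReal.ofReal (((1 + |X j ω|) *
        |Hs μ σ ρ (r * δ) (X j ω) (V r j ω)|) ^ 2) := by
      intro ω
      rw [← ENNReal.ofReal_pow (by positivity), mul_pow, ENNReal.ofReal_mul (by positivity)]
    simp only [e]
    rw [t]
    refine int_le (X j) (E.X0 j hj.le) A _ (by positivity) (hA j hj.le) _ fun ω => ?_
    have hm : Measurable (fun p => Hs μ σ ρ (r * δ) (X j ω) p) := Hs_meas' _ _ _ _ _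
    rw [lintegral_const_mul _ (by fun_prop), mul_assoc, ENNReal.ofReal_mul (by positivity)]
    gcongr
    have hrd : r * δ ≤ δ := by nlinarith [hr.2]
    refine (law_lip (E.law r hr j hj) hM (mul_nonneg hr.1 h0.le) (hrd.trans h1) hK g.hμ g.hσ g.hρ (X j ω)).trans ?_
    refine ENNReal.ofReal_le_ofReal ?_
    gcongr

end EMChain

/-- pointwise bound function for the increment of `ν` -/
noncomputable def Rb (C0 : ℝ) (m : ℕ) (ζ : Fin m → ℝ) (η x d : ℝ) : ℝ :=
  C0 * ((1 + |x|) * |d| + ∑ k : Fin m, if |x - ζ k| ≤ η ∧ |x - ζ k| ≤ |d| then (1 : ℝ) else 0)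

lemma Rb_nonneg (C0 : ℝ) (h : 0 ≤ C0) (m : ℕ) (ζ : Fin m → ℝ) (η x d : ℝ) : 0 ≤ Rb C0 m ζ η x d := by
  unfold Rb
  have : 0 ≤ ∑ k : Fin m, if |x - ζ k| ≤ η ∧ |x - ζ k| ≤ |d| then (1 : ℝ) else 0 :=
    Finset.sum_nonneg fun k _ => by split_ifs <;> norm_num
  positivity

lemma Rb_meas (C0 : ℝ) (m : ℕ) (ζ : Fin m → ℝ) (η : ℝ) :
    Measurable (fun q : ℝ × ℝ => Rb C0 m ζ η q.1 q.2) := by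
  unfold Rb
  refine Measurable.const_mul (Measurable.fun_add (by fun_prop) ?_) _
  refine Finset.measurable_fun_sum _ fun k _ => Measurable.ite ?_ measurable_const measurable_const
  have s1 : MeasurableSet {q : ℝ × ℝ | |q.1 - ζ k| ≤ η} := measurableSet_le (by fun_prop) measurable_const
  have s2 : MeasurableSet {q : ℝ × ℝ | |q.1 - ζ k| ≤ |q.2|} := measurableSet_le (by fun_prop) (by fun_prop)
  exact s1.inter s2

namespace EMChain
variable {Ω : Type*} {m0 : MeasurableSpace Ω}

lemma combined (P : Measure Ω) [IsProbabilityMeasure P] (T M ξ : ℝ) (hM : 0 ≤ M)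
    (μ σ ρ : ℝ → ℝ) (K : ℝ) (g : Growth μ σ ρ K) (m : ℕ) (ζ : Fin m → ℝ) (η s0 : ℝ)
    (hη : 0 < η) (hs0 : 0 < s0) (hs : ∀ k x, |x - ζ k| ≤ η → s0 ≤ σ x ^ 2) (C0 : ℝ) (hC0 : 0 ≤ C0) :
    ∃ C : ℝ, 0 ≤ C ∧ ∀ (n : ℕ) (δ : ℝ) (X : ℕ → Ω → ℝ) (G : ℕ → MeasurableSpace Ω)
      (V : ℝ → ℕ → Ω → ℝ × ℝ), EMChain P n δ M ξ μ σ ρ X G V → 0 < δ → δ ≤ 1 → n * δ = T →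
      ∀ r ∈ Set.Icc (0:ℝ) 1,
      ∫⁻ ω, (∑ j ∈ Finset.range n, ENNReal.ofReal (δ * Rb C0 m ζ η (X j ω)
        (Hs μ σ ρ (r * δ) (X j ω) (V r j ω)))) ^ 2 ∂P ≤ ENNReal.ofReal (C * δ) := by
  by_cases hT0 : 0 ≤ T
  swap
  · refine ⟨0, le_rfl, fun n δ X G V E h0 h1 hT => ?_⟩
    exact absurd (by rw [← hT]; positivity) hT0
  have hK := g.hK
  set A := Real.exp (8 * (4 * K * (1 + M) + 24 * K ^ 2 * (2 + M) + 81 * K ^ 4 * (1 + 2 * M)) * T) * (1 + ξ ^ 4)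
    with hA
  have hA0 : 0 ≤ A := by positivity
  set Kz : Fin m → ℝ := fun k => K * (1 + (|ζ k| + η)) with hKz
  have hKz0 : ∀ k, 0 ≤ Kz k := fun k => by positivity
  have hloc : ∀ k x, |x - ζ k| ≤ η → K * (1 + |x|) ≤ Kz k := by
    intro k x hx
    simp only [hKz]
    gcongr
    have := abs_add_le (ζ k) (x - ζ k)
    simp only [add_sub_cancel] at this
    linarith
  set κ : Fin m → ℝ := fun k => 1 + 2 * Kz k ^ 2 * M with hκ
  have hκ1 : ∀ k, 1 ≤ κ k := fun k => by
    have : 0 ≤ 2 * Kz k ^ 2 * M := by positivity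
    simp only [hκ]; linarith
  set Co : Fin m → ℝ := fun k => 4 * (2 * ((8 / s0) ^ 2 * (κ k + 2 * ζ k ^ 2 + 2) * A
        + T ^ 2 * ((8 / s0) ^ 2 * (K * (1 + M)) ^ 2 * 4 * A))) with hCo
  have hCo0 : ∀ k, 0 ≤ Co k := fun k => by
    have := hκ1 k
    have : 0 ≤ κ k := by linarith
    positivity
  set D : Fin m → ℝ := fun k =>
    8 * ((2 + 16 * Kz k ^ 4 * (1 + M)) * Real.sqrt (κ k)) ^ 2 * Co k + 8 * T ^ 2 * M ^ 2 + 2 * T with hD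
  have hD0 : ∀ k, 0 ≤ D k := fun k => by
    have := hCo0 k
    positivity
  set Dl : ℝ := T ^ 2 * (24 * K ^ 2 * (2 + M)) * A with hDl
  have hDl0 : 0 ≤ Dl := by positivity
  have hDs : 0 ≤ ∑ k, D k := Finset.sum_nonneg fun k _ => hD0 k
  refine ⟨C0 ^ 2 * (2 * (Dl + m * ∑ k, D k)), by positivity, ?_⟩
  intro n δ X G V E h0 h1 hT r hr
  have hmom := E.moment g hM h0 h1 hT
  have hlip := E.lip g hM h0 h1 hT A hA0 hmom r hr
  have hcr : ∀ k, _ := fun k => E.cross g hM h0 h1 hT (Co k) (hCo0 k) (ζ k) η (Kz k)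
    (fun x hx => (g.hμ x).trans (hloc k x hx)) (fun x hx => (g.hσ x).trans (hloc k x hx)) (κ k) (hκ1 k)
    (E.occ g hM h0 h1 hT A hA0 hmom (ζ k) η (Kz k) (fun x hx => (g.hσ x).trans (hloc k x hx)) s0 hs0 (hs k)
      (κ k) (hκ1 k) (by simp only [hκ]; linarith)) r hr
  have hHs := Hs_meas μ σ ρ g.mμ g.mσ g.mρ (r * δ)
  have mH : ∀ j < n, Measurable (fun ω => Hs μ σ ρ (r * δ) (X j ω) (V r j ω)) := fun j hj =>
    hHs.comp ((E.X0 j hj.le).prodMk (E.V0 r hr j hj))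
  set a : Ω → ENNReal := fun ω => ∑ j ∈ Finset.range n, ENNReal.ofReal (δ * ((1 + |X j ω|) *
        |Hs μ σ ρ (r * δ) (X j ω) (V r j ω)|)) with ha
  set b : Fin m → Ω → ENNReal := fun k ω => ∑ j ∈ Finset.range n, ENNReal.ofReal (δ * if |X j ω - ζ k| ≤ η ∧
        |X j ω - ζ k| ≤ |Hs μ σ ρ (r * δ) (X j ω) (V r j ω)| then 1 else 0) with hb
  have ma : Measurable a := by
    refine Finset.measurable_fun_sum _ fun j hj => ?_
    have := mH j (Finset.mem_range.mp hj)
    have := E.X0 j (Finset.mem_range.mp hj).le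
    fun_prop
  have mb : ∀ k, Measurable (b k) := by
    intro k
    refine Finset.measurable_fun_sum _ fun j hj => ?_
    have hh := mH j (Finset.mem_range.mp hj)
    have hx := E.X0 j (Finset.mem_range.mp hj).le
    refine ENNReal.measurable_ofReal.comp (Measurable.const_mul (Measurable.ite ?_ measurable_const measurable_const) _)
    have s1 : MeasurableSet {ω | |X j ω - ζ k| ≤ η} := measurableSet_le (by fun_prop) measurable_const
    have s2 : MeasurableSet {ω | |X j ω - ζ k| ≤ |Hs μ σ ρ (r * δ) (X j ω) (V r j ω)|} :=
      measurableSet_le (by fun_prop) hh.abs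
    exact s1.inter s2
  have hpt : ∀ ω, ∑ j ∈ Finset.range n, ENNReal.ofReal (δ * Rb C0 m ζ η (X j ω)
        (Hs μ σ ρ (r * δ) (X j ω) (V r j ω))) = ENNReal.ofReal C0 * (a ω + ∑ k, b k ω) := by
    intro ω
    simp only [ha, hb]
    rw [Finset.sum_comm, ← Finset.sum_add_distrib, Finset.mul_sum]
    refine Finset.sum_congr rfl fun j _ => ?_
    rw [← ENNReal.ofReal_sum_of_nonneg (fun k _ => by split_ifs <;> simp [h0.le]),
      ← ENNReal.ofReal_add (by positivity) (Finset.sum_nonneg (fun k _ => by split_ifs <;> simp [h0.le])),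
      ← ENNReal.ofReal_mul hC0]
    unfold Rb
    rw [← Finset.mul_sum]
    congr 1
    ring
  have hsq : ∀ ω, (ENNReal.ofReal C0 * (a ω + ∑ k, b k ω)) ^ 2 ≤
      ENNReal.ofReal (C0 ^ 2) * (2 * (a ω ^ 2 + m * ∑ k, b k ω ^ 2)) := by
    intro ω
    rw [mul_pow, ← ENNReal.ofReal_pow hC0]
    gcongr
    refine (enn_sq_add _ _).trans ?_
    gcongr
    simpa using enn_sq_sum Finset.univ (fun k => b k ω)
  have mS : Measurable (fun ω => ∑ k, b k ω ^ 2) :=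
    Finset.measurable_fun_sum _ fun k _ => (mb k).pow_const 2
  calc _ ≤ ∫⁻ ω, ENNReal.ofReal (C0 ^ 2) * (2 * (a ω ^ 2 + m * ∑ k, b k ω ^ 2)) ∂P :=
        lintegral_mono fun ω => by simp only [hpt]; exact hsq ω
    _ = ENNReal.ofReal (C0 ^ 2) * (2 * (∫⁻ ω, a ω ^ 2 ∂P + m * ∑ k, ∫⁻ ω, b k ω ^ 2 ∂P)) := by
        rw [lintegral_const_mul _ (by fun_prop), lintegral_const_mul _ (by fun_prop),
          lintegral_add_left (by fun_prop), lintegral_const_mul _ mS,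
          lintegral_finsetSum _ (fun k _ => (mb k).pow_const 2)]
    _ ≤ ENNReal.ofReal (C0 ^ 2) * (2 * (ENNReal.ofReal (Dl * δ) + m * ∑ k, ENNReal.ofReal (D k * δ))) := by
        gcongr with k
        exact hcr k
    _ = _ := by
        rw [← ENNReal.ofReal_sum_of_nonneg (fun k _ => mul_nonneg (hD0 k) h0.le), ← Finset.sum_mul,
          show (m : ENNReal) = ENNReal.ofReal (m : ℝ) by simp, show (2 : ENNReal) = ENNReal.ofReal 2 by simp,
          ← ENNReal.ofReal_mul (by positivity), ← ENNReal.ofReal_add (by positivity) (by positivity),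
          ← ENNReal.ofReal_mul (by positivity), ← ENNReal.ofReal_mul (by positivity)]
        congr 1
        ring

end EMChain

lemma joint_meas {Ω : Type*} {m0 : MeasurableSpace Ω} (f : ℝ → Ω → ℝ) (T : ℝ)
    (hf : ∀ t ∈ Set.Icc (0:ℝ) T, Measurable (f t)) (A : Set Ω) (hA : MeasurableSet A)
    (hr : ∀ ω ∈ A, ∀ t ∈ Set.Ico (0:ℝ) T,
      Filter.Tendsto (fun u => f u ω) (nhdsWithin t (Set.Ioi t)) (nhds (f t ω))) :
    ∃ f' : ℝ × Ω → ℝ, Measurable f' ∧ ∀ t ∈ Set.Ico (0:ℝ) T, ∀ ω ∈ A, f' (t, ω) = f t ω := by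
  classical
  set S : Set (ℝ × Ω) := Set.Ico (0:ℝ) T ×ˢ A with hS
  have mS : MeasurableSet S := measurableSet_Ico.prod hA
  set τ : ℕ → ℕ → ℝ := fun k i => min (((i : ℝ) + 1) / ((k : ℝ) + 1)) T with hτ
  set g : ℕ → ℝ × Ω → ℝ := fun k => S.indicator
    (fun p => f (τ k (⌊p.1 * ((k : ℝ) + 1)⌋.toNat)) p.2) with hg
  refine ⟨S.indicator (fun p => f p.1 p.2), ?_, ?_⟩
  · refine measurable_of_tendsto_metrizable (f := g) ?_ ?_
    · intro k
      by_cases hT : 0 ≤ T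
      · refine Measurable.indicator ?_ mS
        have h1 : Measurable (fun q : ℕ × Ω => f (τ k q.1) q.2) := by
          refine measurable_from_prod_countable_right fun i => ?_
          exact hf (τ k i) ⟨le_min (by positivity) hT, min_le_right _ _⟩
        have h2 : Measurable (fun p : ℝ × Ω => ((⌊p.1 * ((k : ℝ) + 1)⌋.toNat, p.2) : ℕ × Ω)) := by
          refine Measurable.prodMk ?_ measurable_snd
          have : Measurable (fun z : ℤ => z.toNat) := measurable_from_top
          exact this.comp (Int.measurable_floor.comp (by fun_prop))
        exact h1.comp h2
      · have : S = ∅ := by rw [hS, Set.Ico_eq_empty (fun h => hT h.le), Set.empty_prod]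
        simp [hg, this]
    · rw [tendsto_pi_nhds]
      rintro ⟨t, ω⟩
      by_cases h : (t, ω) ∈ S
      · simp only [hg, Set.indicator_of_mem h]
        obtain ⟨ht, hω⟩ := h
        simp only at ht hω
        refine (hr ω hω t ht).comp ?_
        have hfl : ∀ k : ℕ, t < (((⌊t * ((k : ℝ) + 1)⌋.toNat : ℕ) : ℝ) + 1) / ((k : ℝ) + 1) ∧
            (((⌊t * ((k : ℝ) + 1)⌋.toNat : ℕ) : ℝ) + 1) / ((k : ℝ) + 1) ≤ t + 1 / ((k : ℝ) + 1) := by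
          intro k
          have hk : (0:ℝ) < (k : ℝ) + 1 := by positivity
          have h0 : 0 ≤ t * ((k : ℝ) + 1) := mul_nonneg ht.1 hk.le
          have e : (((⌊t * ((k : ℝ) + 1)⌋.toNat : ℕ) : ℝ)) = (⌊t * ((k : ℝ) + 1)⌋ : ℝ) := by
            have : ((⌊t * ((k : ℝ) + 1)⌋.toNat : ℕ) : ℤ) = ⌊t * ((k : ℝ) + 1)⌋ :=
              Int.toNat_of_nonneg (Int.floor_nonneg.mpr h0)
            exact_mod_cast this
          rw [e]
          constructor
          · rw [lt_div_iff₀ hk]; exact Int.lt_floor_add_one _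
          · rw [div_le_iff₀ hk, add_mul, div_mul_cancel₀ _ hk.ne']
            linarith [Int.floor_le (t * ((k : ℝ) + 1))]
        have hlim : Filter.Tendsto (fun k : ℕ => t + 1 / ((k : ℝ) + 1)) Filter.atTop (nhds t) := by
          simpa using tendsto_one_div_add_atTop_nhds_zero_nat.const_add t
        refine tendsto_nhdsWithin_iff.mpr ⟨?_, Filter.Eventually.of_forall fun k => ?_⟩
        · refine tendsto_of_tendsto_of_tendsto_of_le_of_le tendsto_const_nhds hlim (fun k => ?_) (fun k => ?_)
          · exact le_min (hfl k).1.le ht.2.le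
          · exact (min_le_left _ _).trans (hfl k).2
        · exact lt_min (hfl k).1 ht.2
      · simp only [hg, Set.indicator_of_notMem h]
        exact tendsto_const_nhds
  · intro t ht ω hω
    exact Set.indicator_of_mem (s := S) (a := (t, ω)) ⟨ht, hω⟩ _

lemma slice (T δ : ℝ) (n : ℕ) (h0 : 0 < δ) (hT : n * δ = T) (F : ℝ → ENNReal) :
    ∫⁻ s in Set.Ioc (0:ℝ) T, F s ≤
      ∑ j ∈ Finset.range n, ∫⁻ r in Set.Ico (0:ℝ) 1, ENNReal.ofReal δ * F (((j : ℝ) + r) * δ) := by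
  rw [setLIntegral_congr (Ico_ae_eq_Ioc (μ := volume)).symm]
  have hsub : ∀ k : ℕ, ∫⁻ s in Set.Ico (0:ℝ) (k * δ), F s ≤
      ∑ j ∈ Finset.range k, ∫⁻ r in Set.Ico (0:ℝ) 1, ENNReal.ofReal δ * F (((j : ℝ) + r) * δ) := by
    intro k
    induction k with
    | zero => simp
    | succ k ih =>
      rw [Finset.sum_range_succ]
      have hI : Set.Ico (0:ℝ) ((k + 1 : ℕ) * δ) ⊆ Set.Ico (0:ℝ) (k * δ) ∪
          (fun r : ℝ => ((k : ℝ) + r) * δ) '' Set.Ico (0:ℝ) 1 := by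
        intro s hs
        rcases lt_or_ge s (k * δ) with h | h
        · exact Or.inl ⟨hs.1, h⟩
        · right
          refine ⟨s / δ - k, ⟨?_, ?_⟩, ?_⟩
          · rw [sub_nonneg, le_div_iff₀ h0]; exact h
          · have := hs.2
            push_cast at this
            rw [sub_lt_iff_lt_add, div_lt_iff₀ h0]; linarith
          · field_simp; ring
      have hcv := lintegral_image_eq_lintegral_abs_deriv_mul (s := Set.Ico (0:ℝ) 1)
        (f := fun r : ℝ => ((k : ℝ) + r) * δ) (f' := fun _ => δ) measurableSet_Ico
        (fun x _ => by
          have := (((hasDerivAt_id x).const_add (k : ℝ)).mul_const δ).hasDerivWithinAt (s := Set.Ico (0:ℝ) 1)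
          simpa using this)
        (fun x _ y _ h => by
          have := mul_right_cancel₀ h0.ne' h
          linarith) F
      simp only [abs_of_pos h0] at hcv
      calc _ ≤ ∫⁻ s in Set.Ico (0:ℝ) (k * δ) ∪ (fun r : ℝ => ((k : ℝ) + r) * δ) '' Set.Ico (0:ℝ) 1, F s :=
            lintegral_mono_set hI
        _ ≤ _ := lintegral_union_le _ _ _
        _ ≤ _ := by rw [hcv]; gcongr
  rw [← hT]; exact hsub n

lemma jensen_sq (f : ℝ → ENNReal) (hf : Measurable f) :
    (∫⁻ r in Set.Ico (0:ℝ) 1, f r) ^ 2 ≤ ∫⁻ r in Set.Ico (0:ℝ) 1, f r ^ 2 := by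
  have h := ENNReal.lintegral_mul_le_Lp_mul_Lq (volume.restrict (Set.Ico (0:ℝ) 1))
    (Real.HolderConjugate.two_two) (f := f) (g := fun _ => 1) hf.aemeasurable aemeasurable_const
  simp only [Pi.mul_apply, mul_one, ENNReal.one_rpow, lintegral_const, MeasurableSet.univ, Measure.restrict_apply,
    Set.univ_inter, Real.volume_Ico, sub_zero, ENNReal.ofReal_one] at h
  calc _ ≤ ((∫⁻ r in Set.Ico (0:ℝ) 1, f r ^ (2:ℝ)) ^ (1 / 2 : ℝ)) ^ 2 := by gcongr
    _ = _ := by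
        rw [← ENNReal.rpow_natCast, ← ENNReal.rpow_mul]
        simp

lemma sup_le_sq (f : ℝ → ℝ) (T : ℝ) :
    (⨆ τ : Set.Icc (0:ℝ) T, ENNReal.ofReal (|∫ s in Set.Ioc (0:ℝ) (τ : ℝ), f s| ^ 2)) ≤
      (∫⁻ s in Set.Ioc (0:ℝ) T, ENNReal.ofReal |f s|) ^ 2 := by
  refine iSup_le fun τ => ?_
  rw [ENNReal.ofReal_pow (abs_nonneg _)]
  gcongr
  have h := enorm_integral_le_lintegral_enorm (μ := volume.restrict (Set.Ioc (0:ℝ) (τ : ℝ))) f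
  simp only [Real.enorm_eq_ofReal_abs] at h
  exact h.trans (lintegral_mono_set (Set.Ioc_subset_Ioc_right τ.2.2))

section grid
variable {Ω : Type*} (μ σ ρ : ℝ → ℝ) (W N : ℝ → Ω → ℝ) (δ ξ : ℝ)

/-- the increments over a partial step -/
def Vinc (r : ℝ) (j : ℕ) (ω : Ω) : ℝ × ℝ :=
  (W (((j : ℝ) + r) * δ) ω - W ((j : ℝ) * δ) ω, N (((j : ℝ) + r) * δ) ω - N ((j : ℝ) * δ) ω)

lemma floor_grid (h0 : 0 < δ) (j : ℕ) (r : ℝ) (hr : r ∈ Set.Ico (0:ℝ) 1) :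
    ⌊((j : ℝ) + r) * δ / δ⌋.toNat = j := by
  rw [mul_div_cancel_right₀ _ h0.ne']
  have : ⌊(j : ℝ) + r⌋ = (j : ℤ) := by
    rw [Int.floor_eq_iff]
    have := hr.1
    have := hr.2
    constructor <;> push_cast <;> linarith
  rw [this]; simp

lemma lastGrid_grid (h0 : 0 < δ) (j : ℕ) (r : ℝ) (hr : r ∈ Set.Ico (0:ℝ) 1) :
    lastGrid δ (((j : ℝ) + r) * δ) = j * δ := by
  unfold lastGrid
  rw [floor_grid δ h0 j r hr]

lemma emProc_grid (h0 : 0 < δ) (j : ℕ) (r : ℝ) (hr : r ∈ Set.Ico (0:ℝ) 1) (ω : Ω) :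
    emProc μ σ ρ W N δ ξ (((j : ℝ) + r) * δ) ω = emGrid μ σ ρ W N δ ξ j ω +
      Hs μ σ ρ (r * δ) (emGrid μ σ ρ W N δ ξ j ω) (Vinc W N δ r j ω) := by
  unfold emProc
  rw [lastGrid_grid δ h0 j r hr, floor_grid δ h0 j r hr]
  unfold Hs Vinc
  simp only
  ring

lemma emProc_grid0 (h0 : 0 < δ) (j : ℕ) (ω : Ω) :
    emProc μ σ ρ W N δ ξ ((j : ℝ) * δ) ω = emGrid μ σ ρ W N δ ξ j ω := by
  have := emProc_grid μ σ ρ W N δ ξ h0 j 0 (by simp) ω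
  simp only [add_zero] at this
  rw [this]
  simp [Hs, Vinc]

end grid

lemma grid_bound (T : ℝ) (n : ℕ) (δ : ℝ) (h0 : 0 < δ) (hnT : n * δ = T) (j : ℕ) (hj : j < n) (r : ℝ)
    (hr : r ∈ Set.Icc (0:ℝ) 1) :
    0 ≤ (j : ℝ) * δ ∧ (j : ℝ) * δ ≤ ((j : ℝ) + r) * δ ∧ ((j : ℝ) + r) * δ ≤ ((j + 1 : ℕ) : ℝ) * δ ∧
      ((j + 1 : ℕ) : ℝ) * δ ≤ T := by
  have h1 := hr.1
  have h2 := hr.2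
  refine ⟨by positivity, by gcongr; linarith, by gcongr; push_cast; linarith, ?_⟩
  rw [← hnT]
  have : ((j + 1 : ℕ) : ℝ) ≤ n := by exact_mod_cast hj
  gcongr

lemma meas_inc {Ω : Type*} {mG : MeasurableSpace Ω} {a b c d : Ω → ℝ} (ha : Measurable a) (hb : Measurable b)
    (hc : Measurable c) (hd : Measurable d) : Measurable (fun ω => (a ω - b ω, c ω - d ω)) := by fun_prop

lemma meas_comp_pair {Ω : Type*} {mG : MeasurableSpace Ω} {g : ℝ × (ℝ × ℝ) → ℝ} (hg : Measurable g) {x : Ω → ℝ}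
    {v : Ω → ℝ × ℝ} (hx : Measurable x) (hv : Measurable v) : Measurable (g ∘ fun ω => (x ω, v ω)) :=
  hg.comp (hx.prodMk hv)

lemma chain_of {Ω : Type*} {m0 : MeasurableSpace Ω}
    (F : Filtration ℝ m0) (P : Measure Ω) [IsProbabilityMeasure P]
    (T : ℝ) (hT : 0 < T)
    (lam : ℝ → ℝ)
    (hlam_pos : ∀ t ∈ Set.Icc (0:ℝ) T, 0 < lam t)
    (lamB : ℝ) (hlamB : ∀ t ∈ Set.Icc (0:ℝ) T, lam t ≤ lamB)
    (W N : ℝ → Ω → ℝ)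
    (hW_adapted : ∀ t ∈ Set.Icc (0:ℝ) T, Measurable[F t] (W t))
    (hN_adapted : ∀ t ∈ Set.Icc (0:ℝ) T, Measurable[F t] (N t))
    (hW_gauss : ∀ s t : ℝ, 0 ≤ s → s ≤ t → t ≤ T →
      Measure.map (fun ω => W t ω - W s ω) P = gaussianReal 0 (Real.toNNReal (t - s)))
    (hN_poisson : ∀ s t : ℝ, 0 ≤ s → s ≤ t → t ≤ T →
      Measure.map (fun ω => N t ω - N s ω) P
        = Measure.map (fun k : ℕ => (k : ℝ))
            (poissonMeasure (Real.toNNReal (∫ u in s..t, lam u))))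
    (h_indep : ∀ s t : ℝ, 0 ≤ s → s ≤ t → t ≤ T →
      Indep (MeasurableSpace.comap (fun ω => (W t ω - W s ω, N t ω - N s ω)) inferInstance)
        (F s) P)
    (μ σ ρ : ℝ → ℝ) (hμ_meas : Measurable μ) (hσ_meas : Measurable σ) (hρ_meas : Measurable ρ) (ξ : ℝ) :
    ∃ M : ℝ, 0 ≤ M ∧ ∀ (n : ℕ) (δ : ℝ), 0 < δ → n * δ = T →
      EMChain P n δ M ξ μ σ ρ (fun j => emGrid μ σ ρ W N δ ξ j) (fun j => F ((j : ℝ) * δ)) (Vinc W N δ) := by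
  have hB : 0 ≤ lamB := by
    have h0 : (0:ℝ) ∈ Set.Icc (0:ℝ) T := ⟨le_rfl, hT.le⟩
    exact (hlam_pos 0 h0).le.trans (hlamB 0 h0)
  obtain ⟨M, hM, HM⟩ := stepLaw_of lamB T hB hT.le
  refine ⟨M, hM, fun n δ h0 hnT => ?_⟩
  have hg := grid_bound T n δ h0 hnT
  have hVm : ∀ r ∈ Set.Icc (0:ℝ) 1, ∀ j < n, Measurable[F (((j + 1 : ℕ) : ℝ) * δ)] (Vinc W N δ r j) := by
    intro r hr j hj
    obtain ⟨g1, g2, g3, g4⟩ := hg j hj r hr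
    have w1 := (hW_adapted _ ⟨g1.trans g2, g3.trans g4⟩).mono (F.mono g3) le_rfl
    have w2 := (hW_adapted _ ⟨g1, g2.trans (g3.trans g4)⟩).mono (F.mono (g2.trans g3)) le_rfl
    have n1 := (hN_adapted _ ⟨g1.trans g2, g3.trans g4⟩).mono (F.mono g3) le_rfl
    have n2 := (hN_adapted _ ⟨g1, g2.trans (g3.trans g4)⟩).mono (F.mono (g2.trans g3)) le_rfl
    exact meas_inc w1 w2 n1 n2
  have hstep : ∀ j ω, emGrid μ σ ρ W N δ ξ (j + 1) ω = emGrid μ σ ρ W N δ ξ j ω +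
      Hs μ σ ρ δ (emGrid μ σ ρ W N δ ξ j ω) (Vinc W N δ 1 j ω) := by
    intro j ω
    rw [emGrid]
    unfold Hs Vinc
    simp only
    ring
  constructor
  · exact fun j _ => F.le _
  · intro i j hij _
    refine F.mono ?_
    have : (i : ℝ) ≤ j := by exact_mod_cast hij
    gcongr
  · intro j
    induction j with
    | zero =>
      intro _
      have : emGrid μ σ ρ W N δ ξ 0 = fun _ : Ω => ξ := by funext ω; rw [emGrid]
      rw [this]
      exact @measurable_const _ _ _ (F _) ξ
    | succ j ih =>
      intro hj
      have hX := ih (by omega)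
      have hX' : Measurable[F (((j + 1 : ℕ) : ℝ) * δ)] (emGrid μ σ ρ W N δ ξ j) :=
        hX.mono (F.mono (by push_cast; gcongr; linarith)) le_rfl
      have hV := hVm 1 EMChain.one_mem j (by omega)
      have e : emGrid μ σ ρ W N δ ξ (j + 1) = (fun q : ℝ × (ℝ × ℝ) => q.1 + Hs μ σ ρ δ q.1 q.2) ∘
          (fun ω => (emGrid μ σ ρ W N δ ξ j ω, Vinc W N δ 1 j ω)) := by
        funext ω; exact hstep j ω
      have hm : Measurable (fun q : ℝ × (ℝ × ℝ) => q.1 + Hs μ σ ρ δ q.1 q.2) :=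
        measurable_fst.fun_add (Hs_meas μ σ ρ hμ_meas hσ_meas hρ_meas δ)
      rw [e]
      exact meas_comp_pair hm hX' hV
  · exact hVm
  · intro r hr j hj
    obtain ⟨g1, g2, g3, g4⟩ := hg j hj r hr
    exact h_indep _ _ g1 g2 (g3.trans g4)
  · intro r hr j hj
    obtain ⟨g1, g2, g3, g4⟩ := hg j hj r hr
    have mV : Measurable (Vinc W N δ r j) := (hVm r hr j hj).mono (F.le _) le_rfl
    have er : ((j : ℝ) + r) * δ - (j : ℝ) * δ = r * δ := by ring
    refine HM _ _ (Real.toNNReal (∫ u in ((j : ℝ) * δ)..(((j : ℝ) + r) * δ), lam u))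
      (Measure.isProbabilityMeasure_map mV.aemeasurable) (mul_nonneg hr.1 h0.le) ?_ ?_ ?_ ?_
    · rw [← er]; linarith
    · rw [Measure.map_map measurable_fst mV, ← er]
      exact hW_gauss _ _ g1 g2 (g3.trans g4)
    · rw [Measure.map_map measurable_snd mV]
      exact hN_poisson _ _ g1 g2 (g3.trans g4)
    · rw [Real.coe_toNNReal']
      refine max_le ?_ (mul_nonneg hB (mul_nonneg hr.1 h0.le))
      have hb : ∀ x ∈ Set.uIoc ((j : ℝ) * δ) (((j : ℝ) + r) * δ), ‖lam x‖ ≤ lamB := by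
        intro x hx
        rw [Set.uIoc_of_le g2] at hx
        have hx' : x ∈ Set.Icc (0:ℝ) T := ⟨g1.trans hx.1.le, hx.2.trans (g3.trans g4)⟩
        rw [Real.norm_eq_abs, abs_of_pos (hlam_pos x hx')]
        exact hlamB x hx'
      have := intervalIntegral.norm_integral_le_of_norm_le_const hb
      rw [er, abs_of_nonneg (mul_nonneg hr.1 h0.le)] at this
      exact (le_abs_self _).trans this
  · intro ω
    simp only [emGrid]
  · intro j _ ω
    exact hstep j ω

lemma path_bound {Ω : Type*} {m0 : MeasurableSpace Ω} (P : Measure Ω) [IsProbabilityMeasure P]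
    (T : ℝ) (W N : ℝ → Ω → ℝ)
    (hWm : ∀ t ∈ Set.Icc (0:ℝ) T, Measurable (W t))
    (hNm : ∀ t ∈ Set.Icc (0:ℝ) T, Measurable (N t))
    (hW_cont : ∀ᵐ ω ∂P, ContinuousOn (fun t => W t ω) (Set.Icc 0 T))
    (hN_rc : ∀ᵐ ω ∂P, ∀ t ∈ Set.Ico (0:ℝ) T,
      Filter.Tendsto (fun u => N u ω) (nhdsWithin t (Set.Ioi t)) (nhds (N t ω)))
    (μ σ ρ : ℝ → ℝ) (hμ : Measurable μ) (hσ : Measurable σ) (hρ : Measurable ρ)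
    (m : ℕ) (ζ α : Fin m → ℝ) (c ξ η C0 : ℝ)
    (hnu : ∀ x1 x2 : ℝ,
      |nuFun (Gtransform m ζ α c) μ σ x2 x2 - nuFun (Gtransform m ζ α c) μ σ x1 x2| ≤
        Rb C0 m ζ η x2 (x1 - x2))
    (n : ℕ) (δ : ℝ) (h0 : 0 < δ) (hnT : n * δ = T)
    (mX : ∀ j ≤ n, Measurable (emGrid μ σ ρ W N δ ξ j)) (D : ENNReal)
    (hD : ∀ r ∈ Set.Icc (0:ℝ) 1,
      ∫⁻ ω, (∑ j ∈ Finset.range n, ENNReal.ofReal (δ * Rb C0 m ζ η (emGrid μ σ ρ W N δ ξ j ω)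
        (Hs μ σ ρ (r * δ) (emGrid μ σ ρ W N δ ξ j ω) (Vinc W N δ r j ω)))) ^ 2 ∂P ≤ D) :
    ∫⁻ ω, ⨆ τ : Set.Icc (0:ℝ) T,
          ENNReal.ofReal (|∫ s in Set.Ioc (0:ℝ) (τ : ℝ),
              (nuFun (Gtransform m ζ α c) μ σ
                  (emProc μ σ ρ W N δ ξ (lastGrid δ s) ω)
                  (emProc μ σ ρ W N δ ξ (lastGrid δ s) ω)
                - nuFun (Gtransform m ζ α c) μ σ
                    (emProc μ σ ρ W N δ ξ s ω)
                    (emProc μ σ ρ W N δ ξ (lastGrid δ s) ω))| ^ 2) ∂P ≤ D := by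
  have hW_rc : ∀ᵐ ω ∂P, ∀ t ∈ Set.Ico (0:ℝ) T,
      Filter.Tendsto (fun u => W u ω) (nhdsWithin t (Set.Ioi t)) (nhds (W t ω)) := by
    filter_upwards [hW_cont] with ω hω t ht
    have := hω t ⟨ht.1, ht.2.le⟩
    refine this.tendsto.mono_left ?_
    refine nhdsWithin_le_iff.mpr ?_
    have : Set.Ioc t T ∈ nhdsWithin t (Set.Ioi t) := Ioc_mem_nhdsGT ht.2
    exact Filter.mem_of_superset this fun x hx => ⟨ht.1.trans hx.1.le, hx.2⟩
  obtain ⟨B, hBs, mB, hB0⟩ := exists_measurable_superset_of_null (ae_iff.mp (hW_rc.and hN_rc))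
  have hA : ∀ ω ∈ Bᶜ, (∀ t ∈ Set.Ico (0:ℝ) T,
      Filter.Tendsto (fun u => W u ω) (nhdsWithin t (Set.Ioi t)) (nhds (W t ω))) ∧
      (∀ t ∈ Set.Ico (0:ℝ) T,
      Filter.Tendsto (fun u => N u ω) (nhdsWithin t (Set.Ioi t)) (nhds (N t ω))) := by
    intro ω hω
    by_contra h
    exact hω (hBs h)
  have hAae : ∀ᵐ ω ∂P, ω ∈ Bᶜ := by rw [ae_iff]; simpa using hB0
  obtain ⟨W', mW', hW'⟩ := joint_meas W T hWm Bᶜ mB.compl fun ω hω => (hA ω hω).1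
  obtain ⟨N', mN', hN'⟩ := joint_meas N T hNm Bᶜ mB.compl fun ω hω => (hA ω hω).2
  have hg := grid_bound T n δ h0 hnT
  set V' : ℕ → ℝ × Ω → ℝ × ℝ := fun j p =>
    (W' (((j : ℝ) + p.1) * δ, p.2) - W' ((j : ℝ) * δ, p.2),
      N' (((j : ℝ) + p.1) * δ, p.2) - N' ((j : ℝ) * δ, p.2)) with hV'
  have mV' : ∀ j, Measurable (V' j) := by
    intro j
    simp only [hV']
    have a1 : Measurable (fun p : ℝ × Ω => (((j : ℝ) + p.1) * δ, p.2)) := by fun_prop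
    have a2 : Measurable (fun p : ℝ × Ω => ((j : ℝ) * δ, p.2)) := by fun_prop
    exact ((mW'.comp a1).fun_sub (mW'.comp a2)).prodMk ((mN'.comp a1).fun_sub (mN'.comp a2))
  have eV : ∀ j < n, ∀ r ∈ Set.Ico (0:ℝ) 1, ∀ ω ∈ Bᶜ, Vinc W N δ r j ω = V' j (r, ω) := by
    intro j hj r hr ω hω
    obtain ⟨g1, g2, g3, g4⟩ := hg j hj r ⟨hr.1, hr.2.le⟩
    have g5 : ((j : ℝ) + r) * δ < T := by
      refine lt_of_lt_of_le ?_ g4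
      push_cast
      have := hr.2
      gcongr
    simp only [hV', Vinc]
    rw [hW' _ ⟨g1.trans g2, g5⟩ ω hω, hW' _ ⟨g1, g2.trans_lt g5⟩ ω hω,
      hN' _ ⟨g1.trans g2, g5⟩ ω hω, hN' _ ⟨g1, g2.trans_lt g5⟩ ω hω]
  obtain ⟨q, hq⟩ : ∃ q : ℕ → ℝ × Ω → ENNReal, ∀ j, q j = fun p =>
    ENNReal.ofReal (δ * Rb C0 m ζ η (emGrid μ σ ρ W N δ ξ j p.2)
        (Hs μ σ ρ (p.1 * δ) (emGrid μ σ ρ W N δ ξ j p.2) (V' j p))) := ⟨_, fun _ => rfl⟩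
  have hq' : ∀ j r ω, q j (r, ω) = ENNReal.ofReal (δ * Rb C0 m ζ η (emGrid μ σ ρ W N δ ξ j ω)
        (Hs μ σ ρ (r * δ) (emGrid μ σ ρ W N δ ξ j ω) (V' j (r, ω)))) := fun j r ω => by rw [hq]
  set Q : ℝ × Ω → ENNReal := fun p => ∑ j ∈ Finset.range n, q j p with hQ
  have mQj : ∀ j < n, Measurable (q j) := by
    intro j hj
    rw [hq]
    have x1 : Measurable (fun p : ℝ × Ω => emGrid μ σ ρ W N δ ξ j p.2) :=
      (mX j hj.le).comp measurable_snd
    have v1 := mV' j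
    have h1 : Measurable (fun p : ℝ × Ω => Hs μ σ ρ (p.1 * δ) (emGrid μ σ ρ W N δ ξ j p.2) (V' j p)) := by
      unfold Hs
      fun_prop
    exact ENNReal.measurable_ofReal.comp (((Rb_meas C0 m ζ η).comp (x1.prodMk h1)).const_mul δ)
  have mQ : Measurable Q := Finset.measurable_fun_sum _ fun j hj => mQj j (Finset.mem_range.mp hj)
  have hpt : ∀ ω ∈ Bᶜ, (⨆ τ : Set.Icc (0:ℝ) T,
          ENNReal.ofReal (|∫ s in Set.Ioc (0:ℝ) (τ : ℝ),
              (nuFun (Gtransform m ζ α c) μ σ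
                  (emProc μ σ ρ W N δ ξ (lastGrid δ s) ω)
                  (emProc μ σ ρ W N δ ξ (lastGrid δ s) ω)
                - nuFun (Gtransform m ζ α c) μ σ
                    (emProc μ σ ρ W N δ ξ s ω)
                    (emProc μ σ ρ W N δ ξ (lastGrid δ s) ω))| ^ 2)) ≤
        ∫⁻ r in Set.Ico (0:ℝ) 1, Q (r, ω) ^ 2 := by
    intro ω hω
    refine (sup_le_sq _ T).trans ?_
    refine le_trans ?_ (jensen_sq (fun r => Q (r, ω)) (mQ.comp measurable_prodMk_right))
    refine pow_le_pow_left' ?_ 2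
    refine (slice T δ n h0 hnT _).trans ?_
    simp only [hQ]
    have mω : ∀ j ∈ Finset.range n, Measurable (fun r : ℝ => q j (r, ω)) := fun j hj =>
      (mQj j (Finset.mem_range.mp hj)).comp measurable_prodMk_right
    rw [lintegral_finsetSum _ mω]
    refine Finset.sum_le_sum fun j hj => ?_
    refine setLIntegral_mono' measurableSet_Ico fun r hr => ?_
    rw [hq', lastGrid_grid δ h0 j r hr, emProc_grid0 _ _ _ _ _ _ _ h0, emProc_grid _ _ _ _ _ _ _ h0 j r hr,
      ← ENNReal.ofReal_mul h0.le, ← eV j (Finset.mem_range.mp hj) r hr ω hω]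
    refine ENNReal.ofReal_le_ofReal ?_
    gcongr
    have := hnu (emGrid μ σ ρ W N δ ξ j ω +
      Hs μ σ ρ (r * δ) (emGrid μ σ ρ W N δ ξ j ω) (Vinc W N δ r j ω)) (emGrid μ σ ρ W N δ ξ j ω)
    rwa [add_sub_cancel_left] at this
  calc _ ≤ ∫⁻ ω, ∫⁻ r in Set.Ico (0:ℝ) 1, Q (r, ω) ^ 2 ∂volume ∂P := by
        refine lintegral_mono_ae ?_
        filter_upwards [hAae] with ω hω using hpt ω hω
    _ = ∫⁻ r in Set.Ico (0:ℝ) 1, ∫⁻ ω, Q (r, ω) ^ 2 ∂P := by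
        refine lintegral_lintegral_swap ?_
        have : Measurable (fun p : Ω × ℝ => Q (p.2, p.1) ^ 2) := (mQ.comp measurable_swap).pow_const 2
        exact this.aemeasurable
    _ ≤ ∫⁻ r in Set.Ico (0:ℝ) 1, D := by
        refine setLIntegral_mono' measurableSet_Ico fun r hr => ?_
        refine le_trans (le_of_eq ?_) (hD r ⟨hr.1, hr.2.le⟩)
        refine lintegral_congr_ae ?_
        filter_upwards [hAae] with ω hω
        simp only [hQ]
        congr 1
        refine Finset.sum_congr rfl fun j hj => ?_
        rw [hq', eV j (Finset.mem_range.mp hj) r hr ω hω]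
    _ = D := by simp

/-- Estimate of the drift part of the transformed Euler–Maruyama error:
`E[sup_{τ ∈ [0,T]} |∫_0^τ (ν(X_{s̲}, X_{s̲}) - ν(X_s, X_{s̲})) ds|²] ≤ C δ`. -/
theorem em_transformed_drift_estimate
    {Ω : Type*} {m0 : MeasurableSpace Ω}
    (F : Filtration ℝ m0) (P : Measure Ω) [IsProbabilityMeasure P]
    (T : ℝ) (hT : 0 < T)
    (lam : ℝ → ℝ) (hlam_meas : Measurable lam)
    (hlam_pos : ∀ t ∈ Set.Icc (0:ℝ) T, 0 < lam t)
    (lamB : ℝ) (hlamB : ∀ t ∈ Set.Icc (0:ℝ) T, lam t ≤ lamB)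
    (W N : ℝ → Ω → ℝ)
    (hW0 : ∀ ω, W 0 ω = 0) (hN0 : ∀ ω, N 0 ω = 0)
    (hW_adapted : ∀ t ∈ Set.Icc (0:ℝ) T, Measurable[F t] (W t))
    (hN_adapted : ∀ t ∈ Set.Icc (0:ℝ) T, Measurable[F t] (N t))
    (hW_cont : ∀ᵐ ω ∂P, ContinuousOn (fun t => W t ω) (Set.Icc 0 T))
    (hN_mono : ∀ᵐ ω ∂P, ∀ s t : ℝ, 0 ≤ s → s ≤ t → t ≤ T → N s ω ≤ N t ω)
    (hN_rc : ∀ᵐ ω ∂P, ∀ t ∈ Set.Ico (0:ℝ) T,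
      Filter.Tendsto (fun u => N u ω) (nhdsWithin t (Set.Ioi t)) (nhds (N t ω)))
    (hN_int : ∀ᵐ ω ∂P, ∀ t ∈ Set.Icc (0:ℝ) T, ∃ k : ℕ, N t ω = k)
    (hW_gauss : ∀ s t : ℝ, 0 ≤ s → s ≤ t → t ≤ T →
      Measure.map (fun ω => W t ω - W s ω) P = gaussianReal 0 (Real.toNNReal (t - s)))
    (hN_poisson : ∀ s t : ℝ, 0 ≤ s → s ≤ t → t ≤ T →
      Measure.map (fun ω => N t ω - N s ω) P
        = Measure.map (fun k : ℕ => (k : ℝ))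
            (poissonMeasure (Real.toNNReal (∫ u in s..t, lam u))))
    (h_indep : ∀ s t : ℝ, 0 ≤ s → s ≤ t → t ≤ T →
      Indep (MeasurableSpace.comap (fun ω => (W t ω - W s ω, N t ω - N s ω)) inferInstance)
        (F s) P)
    (hWN_indep : ∀ s t : ℝ, 0 ≤ s → s ≤ t → t ≤ T →
      IndepFun (fun ω => W t ω - W s ω) (fun ω => N t ω - N s ω) P)
    (μ σ ρ : ℝ → ℝ) (hμ_meas : Measurable μ) (hσ_meas : Measurable σ) (hρ_meas : Measurable ρ)
    (m : ℕ) (hm : 0 < m) (ζ : Fin m → ℝ) (hζ : StrictMono ζ)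
    (hμ_low : ∃ K : NNReal, LipschitzOnWith K μ (Set.Iio (ζ ⟨0, hm⟩)))
    (hμ_high : ∃ K : NNReal, LipschitzOnWith K μ (Set.Ioi (ζ ⟨m - 1, Nat.sub_lt hm one_pos⟩)))
    (hμ_mid : ∀ (k : Fin m) (h : (k : ℕ) + 1 < m),
      ∃ K : NNReal, LipschitzOnWith K μ (Set.Ioo (ζ k) (ζ ⟨(k : ℕ) + 1, h⟩)))
    (hσ_lip : ∃ K : NNReal, LipschitzWith K σ)
    (hσ_nz : ∀ k : Fin m, σ (ζ k) ≠ 0)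
    (hρ_lip : ∃ K : NNReal, LipschitzWith K ρ)
    (μm μp : Fin m → ℝ)
    (hμm : ∀ k : Fin m, Filter.Tendsto μ (nhdsWithin (ζ k) (Set.Iio (ζ k))) (nhds (μm k)))
    (hμp : ∀ k : Fin m, Filter.Tendsto μ (nhdsWithin (ζ k) (Set.Ioi (ζ k))) (nhds (μp k)))
    (α : Fin m → ℝ) (hα_def : ∀ k : Fin m, α k = (μm k - μp k) / (2 * σ (ζ k) ^ 2))
    (hα_ne : ∀ k : Fin m, α k ≠ 0)
    (c : ℝ) (hc0 : 0 < c) (hc1 : ∀ k : Fin m, c < 1 / (6 * |α k|))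
    (hc2 : ∀ (k : Fin m) (h : (k : ℕ) + 1 < m), c < (ζ ⟨(k : ℕ) + 1, h⟩ - ζ k) / 2)
    (ξ : ℝ) :
    ∃ C : ℝ, 0 < C ∧ ∃ δ0 : ℝ, δ0 ∈ Set.Ioo (0:ℝ) 1 ∧ ∀ n : ℕ, 0 < n → T / n < δ0 →
      ∫⁻ ω, ⨆ τ : Set.Icc (0:ℝ) T,
          ENNReal.ofReal (|∫ s in Set.Ioc (0:ℝ) (τ : ℝ),
              (nuFun (Gtransform m ζ α c) μ σ
                  (emProc μ σ ρ W N (T / n) ξ (lastGrid (T / n) s) ω)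
                  (emProc μ σ ρ W N (T / n) ξ (lastGrid (T / n) s) ω)
                - nuFun (Gtransform m ζ α c) μ σ
                    (emProc μ σ ρ W N (T / n) ξ s ω)
                    (emProc μ σ ρ W N (T / n) ξ (lastGrid (T / n) s) ω))| ^ 2) ∂P
        ≤ ENNReal.ofReal (C * (T / n)) := by
  obtain ⟨K1, hK10, hK1⟩ := mu_growth μ m hm ζ hζ hμ_low hμ_high hμ_mid
  obtain ⟨K2, hK20, hK2⟩ := lip_growth σ Set.univ
    (hσ_lip.imp fun K h => h.lipschitzOnWith) ⟨0, trivial⟩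
  obtain ⟨K3, hK30, hK3⟩ := lip_growth ρ Set.univ
    (hρ_lip.imp fun K h => h.lipschitzOnWith) ⟨0, trivial⟩
  have g : EMChain.Growth μ σ ρ (K1 + K2 + K3) := by
    refine ⟨by positivity, hμ_meas, hσ_meas, hρ_meas, fun x => (hK1 x).trans ?_,
      fun x => (hK2 x trivial).trans ?_, fun x => (hK3 x trivial).trans ?_⟩ <;> gcongr <;> linarith
  obtain ⟨η, hη, s0, hs0, hs⟩ := exists_eta σ hσ_lip m ζ hσ_nz
  obtain ⟨C0, hC0, hnu⟩ := nu_bound m ζ α c hc0 η hη μ σ (K1 + K2 + K3) g.hK g.hμ g.hσ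
  obtain ⟨M, hM, hch⟩ := chain_of F P T hT lam hlam_pos lamB hlamB W N hW_adapted hN_adapted
    hW_gauss hN_poisson h_indep μ σ ρ hμ_meas hσ_meas hρ_meas ξ
  obtain ⟨C, hC, H⟩ := EMChain.combined P T M ξ hM μ σ ρ (K1 + K2 + K3) g m ζ η s0 hη hs0 hs C0 hC0
  refine ⟨C + 1, by positivity, 1 / 2, by norm_num, fun n hn hlt => ?_⟩
  have hn' : (0:ℝ) < n := by exact_mod_cast hn
  have h0 : 0 < T / n := by positivity
  have hnT : n * (T / n) = T := by field_simp
  have E := hch n (T / n) h0 hnT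
  refine (path_bound P T W N (fun t ht => (hW_adapted t ht).mono (F.le t) le_rfl)
    (fun t ht => (hN_adapted t ht).mono (F.le t) le_rfl) hW_cont hN_rc μ σ ρ hμ_meas hσ_meas hρ_meas
    m ζ α c ξ η C0 hnu n (T / n) h0 hnT E.X0 _
    (H n (T / n) _ _ _ E h0 (by linarith) hnT)).trans ?_
  refine ENNReal.ofReal_le_ofReal ?_
  gcongr
  linarith
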